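/- arXiv:2403.12713 — 5 statements merged into one kernel-verified Lean document; each statement's English description precedes it below -/
import Mathlib

section
/- Let 𝒢 be a connected hypergraph with corank crk(𝒢) ≥ 3 and rank rk(𝒢). If 𝒢 is (1 + ⌈rk(𝒢)/crk(𝒢)⌉)-flag-connected, then 𝒢 is quasi-Eulerian, i.e., 𝒢 admits an Euler family. -/
open Finset

/-- A closed walk in a hypergraph with vertex type `V` whose edges are indexed by `ι`
(the edge with index `i` is the finset `E i`; multiple edges are allowed, corresponding
to indices with equal edge sets).  It is an alternating cyclic sequence
`v_1, e_1, v_2, e_2, …, v_t, e_t` with `{v_i, v_{i+1}} ⊆ e_i` and `v_i ≠ v_{i+1}`,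
indices taken modulo `t`. -/
structure ClosedWalk {V ι : Type*} (E : ι → Finset V) where
  len : ℕ
  len_pos : 0 < len
  vtx : ZMod len → V
  edg : ZMod len → ι
  mem_self : ∀ i, vtx i ∈ E (edg i)
  mem_succ : ∀ i, vtx (i + 1) ∈ E (edg i)
  vtx_ne : ∀ i, vtx i ≠ vtx (i + 1)

/-- An Euler tour is a closed walk traversing each edge exactly once. -/
def IsEulerTour {V ι : Type*} (E : ι → Finset V) (W : ClosedWalk E) : Prop :=
  ∀ e : ι, ∃! i : ZMod W.len, W.edg i = e

/-- A closed walk is spanning if it traverses every vertex. -/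
def IsSpanningWalk {V ι : Type*} (E : ι → Finset V) (W : ClosedWalk E) : Prop :=
  ∀ v : V, ∃ i : ZMod W.len, W.vtx i = v

/-- The hypergraph has a spanning Euler tour: a closed walk traversing each edge
exactly once and visiting every vertex. -/
def HasSpanningEulerTour {V ι : Type*} (E : ι → Finset V) : Prop :=
  ∃ W : ClosedWalk E, IsEulerTour E W ∧ IsSpanningWalk E W

/-- An Euler family: a (finite) family of closed walks such that every edge is
traversed exactly once, by exactly one walk of the family.  A hypergraph having an
Euler family is called quasi-Eulerian. -/
def HasEulerFamily {V ι : Type*} (E : ι → Finset V) : Prop :=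
  ∃ (m : ℕ) (W : Fin m → ClosedWalk E),
    ∀ e : ι, ∃! p : (j : Fin m) × ZMod (W j).len, (W p.1).edg p.2 = e

/-- Connectivity of a hypergraph: every two vertices are joined by a walk, i.e. they
are related by the reflexive-transitive closure of "lying in a common edge". -/
def HConnected {V ι : Type*} (E : ι → Finset V) : Prop :=
  ∀ u v : V, Relation.ReflTransGen (fun a b => ∃ i, a ∈ E i ∧ b ∈ E i) u v

/-- `k`-flag-connectivity: the hypergraph is connected and remains connected whenever
fewer than `k` flags are removed.  A flag is a pair `(v, i)` with `v ∈ E i`, and removing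
a set `F` of flags replaces each edge `E i` by `E i \ {v | (v, i) ∈ F}`. -/
def FlagConnected {V ι : Type*} [DecidableEq V] [DecidableEq ι] (E : ι → Finset V) (k : ℕ) :
    Prop :=
  HConnected E ∧
    ∀ F : Finset (V × ι), (∀ p ∈ F, p.1 ∈ E p.2) → F.card < k →
      HConnected (fun i => (E i).filter (fun v => (v, i) ∉ F))

open Classical in
theorem SimpleGraph.exists_irreducible_odd_coloring {W : Type*} [Fintype W]
    (G : SimpleGraph W) (h : ¬ ∃ M : G.Subgraph, M.IsPerfectMatching) :
    ∃ (U : Finset W) (κ : W → W),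
      (∀ x y, x ∉ U → y ∉ U → G.Adj x y → κ x = κ y) ∧
      #U < #{c | Odd #{x | x ∉ U ∧ κ x = c}} ∧
      ∀ f ∈ U, ∀ a b, ∃ y, y ∉ U ∧ G.Adj f y ∧ κ y ≠ a ∧ κ y ≠ b := by
  have key : ∃ n : ℕ, ∃ (U : Finset W) (κ : W → W), #U = n ∧
      (∀ x y, x ∉ U → y ∉ U → G.Adj x y → κ x = κ y) ∧
      #U < #{c | Odd #{x | x ∉ U ∧ κ x = c}} := by
    rw [SimpleGraph.tutte] at h
    push Not at h
    obtain ⟨u, hu⟩ := h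
    unfold SimpleGraph.IsTutteViolator at hu
    set H := ((⊤ : G.Subgraph).deleteVerts u).coe with hH
    have hmem : ∀ x : W, x ∉ u → x ∈ ((⊤ : G.Subgraph).deleteVerts u).verts := by
      intro x hx; simp [hx]
    let rep : H.ConnectedComponent → W := fun c => (Quot.out c).1
    have hrep : Function.Injective rep := by
      intro c d hcd
      have : Quot.out c = Quot.out d := Subtype.ext hcd
      rw [← Quot.out_eq c, ← Quot.out_eq d, this]
    refine ⟨_, u.toFinset, fun x => if hx : x ∉ u then
      rep (H.connectedComponentMk ⟨x, hmem x hx⟩) else x, rfl, ?_, ?_⟩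
    · intro x y hx hy hxy
      simp only [Set.mem_toFinset] at hx hy
      simp only [hx, hy, not_false_eq_true, dite_true]
      congr 1
      apply SimpleGraph.ConnectedComponent.sound
      apply SimpleGraph.Adj.reachable
      simp [hH, hx, hy, hxy]
    · rw [← Set.ncard_eq_toFinset_card']
      refine hu.trans_le ?_
      rw [← Set.ncard_image_of_injective _ hrep, ← Set.ncard_coe_finset]
      apply Set.ncard_le_ncard _ (Set.toFinite _)
      rintro _ ⟨c, hc, rfl⟩
      simp only [SimpleGraph.oddComponents, Set.mem_ofPred_eq] at hc
      simp only [Finset.coe_filter, Finset.mem_univ, true_and, Set.mem_ofPred_eq]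
      convert hc using 1
      rw [← Set.ncard_image_of_injective _ Subtype.val_injective, ← Set.ncard_coe_finset]
      congr 1
      ext x
      simp only [Set.mem_toFinset, Finset.coe_filter, Finset.mem_univ, true_and,
        Set.mem_ofPred_eq, Set.mem_image, SimpleGraph.ConnectedComponent.mem_supp_iff]
      constructor
      · rintro ⟨hx, hxc⟩
        simp only [hx, not_false_eq_true, dite_true] at hxc
        exact ⟨_, hrep hxc, rfl⟩
      · rintro ⟨⟨y, hy⟩, hyc, rfl⟩
        have hyu : y ∉ u := by simpa using hy
        simp [hyu, hyc]
  obtain ⟨U, κ, hn, hadj, hlt⟩ := Nat.find_spec key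
  refine ⟨U, κ, hadj, hlt, ?_⟩
  intro f hf a b
  by_contra! hcon
  have hab : ∀ y, y ∉ U → G.Adj f y → κ y = a ∨ κ y = b := by
    intro y hy hfy
    by_contra! hh
    exact hh.2 (hcon y hy hfy hh.1)
  refine Nat.find_min key (m := #(U.erase f)) ?_ ?_
  · rw [← hn]; exact Finset.card_erase_lt_of_mem hf
  refine ⟨U.erase f, fun x => if x = f ∨ κ x = b then a else κ x, rfl, ?_, ?_⟩
  · intro x y hx hy hxy
    simp only [Finset.mem_erase, not_and] at hx hy
    by_cases hxf : x = f <;> by_cases hyf : y = f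
    · simp [hxf, hyf]
    · subst hxf
      rcases hab y (hy hyf) hxy with h | h <;> simp [h]
    · subst hyf
      rcases hab x (hx hxf) hxy.symm with h | h <;> simp [h]
    · simp [hxf, hyf, hadj x y (hx hxf) (hy hyf) hxy]
  · have hother : ∀ c, c ≠ a → c ≠ b →
        Finset.univ.filter (fun x => x ∉ U.erase f ∧ (if x = f ∨ κ x = b then a else κ x) = c) =
          Finset.univ.filter (fun x => x ∉ U ∧ κ x = c) := by
      intro c hca hcb
      ext x
      simp only [Finset.mem_filter, Finset.mem_univ, true_and, Finset.mem_erase, not_and]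
      by_cases hxf : x = f
      · subst hxf; simp [hf, hca.symm]
      · by_cases hxb : κ x = b
        · simp [hxb, hca.symm, hcb.symm]
        · simp [hxf, hxb]
    have hmerge : a ≠ b →
        Finset.univ.filter (fun x => x ∉ U.erase f ∧ (if x = f ∨ κ x = b then a else κ x) = a) =
          insert f (({x | x ∉ U ∧ κ x = a} : Finset W) ∪ ({x | x ∉ U ∧ κ x = b} : Finset W)) := by
      intro hne
      ext x
      simp only [Finset.mem_filter, Finset.mem_univ, true_and, Finset.mem_erase, not_and,
        Finset.mem_insert, Finset.mem_union]
      by_cases hxf : x = f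
      · simp [hxf]
      · by_cases hxb : κ x = b
        · simp [hxf, hxb, hne.symm]
        · simp [hxf, hxb]
    obtain ⟨z, hz⟩ : ∃ z, ({c | Odd #{x | x ∉ U ∧ κ x = c}} : Finset W).erase z ⊆
        Finset.univ.filter (fun c =>
          Odd #{x | x ∉ U.erase f ∧ (if x = f ∨ κ x = b then a else κ x) = c}) := by
      by_cases hb : Odd #{x | x ∉ U ∧ κ x = b}
      · refine ⟨b, fun c hc => ?_⟩
        simp only [Finset.mem_erase, Finset.mem_filter, Finset.mem_univ, true_and] at hc
        refine Finset.mem_filter.2 ⟨Finset.mem_univ _, ?_⟩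
        by_cases hca : c = a
        · subst hca
          rw [hmerge hc.1, Finset.card_insert_of_notMem (by simp [hf]),
            Finset.card_union_of_disjoint]
          · exact (hc.2.add_odd hb).add_one
          · rw [Finset.disjoint_left]
            intro x hx hx'
            simp only [Finset.mem_filter, Finset.mem_univ, true_and] at hx hx'
            exact hc.1 (hx.2.symm.trans hx'.2)
        · rw [hother c hca hc.1]; exact hc.2
      · refine ⟨a, fun c hc => ?_⟩
        simp only [Finset.mem_erase, Finset.mem_filter, Finset.mem_univ, true_and] at hc
        refine Finset.mem_filter.2 ⟨Finset.mem_univ _, ?_⟩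
        rw [hother c hc.1 (by rintro rfl; exact hb hc.2)]
        exact hc.2
    have h1 := Finset.card_le_card hz
    have h2 := Finset.pred_card_le_card_erase (s := ({c | Odd #{x | x ∉ U ∧ κ x = c}} : Finset W))
      (a := z)
    have h3 := Finset.card_erase_lt_of_mem hf
    change #(U.erase f) < #(Finset.univ.filter fun c =>
      Odd #{x | x ∉ U.erase f ∧ (if x = f ∨ κ x = b then a else κ x) = c})
    omega

/-- The gadget graph of a hypergraph `E`: its vertices are the flags of `E` together with
`#(E i) - 2` dummies for every edge `i`.  Flags at a common vertex (of different edges) are adjacent,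
and each dummy of `i` is adjacent to all flags of `i`. -/
def flagGraph {V ι : Type*} (E : ι → Finset V) :
    SimpleGraph (Σ i, (E i ⊕ Fin (#(E i) - 2))) where
  Adj x y := match x, y with
    | ⟨i, .inl u⟩, ⟨j, .inl v⟩ => i ≠ j ∧ (u : V) = v
    | ⟨i, .inl _⟩, ⟨j, .inr _⟩ => i = j
    | ⟨i, .inr _⟩, ⟨j, .inl _⟩ => i = j
    | ⟨_, .inr _⟩, ⟨_, .inr _⟩ => False
  symm := by
    constructor
    rintro ⟨i, u | d⟩ ⟨j, v | d'⟩ <;> simp +contextual [eq_comm]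
  loopless := by
    constructor
    rintro ⟨i, u | d⟩ <;> simp

theorem card_filter_sigma_sum {ι : Type*} [Fintype ι] {α β : ι → Type*} [∀ i, Fintype (α i)]
    [∀ i, Fintype (β i)] (P : (Σ i, (α i ⊕ β i)) → Prop) [DecidablePred P] :
    #{x | P x} = ∑ i, (#{a : α i | P ⟨i, .inl a⟩} + #{b : β i | P ⟨i, .inr b⟩}) := by
  simp_rw [Finset.card_filter, Fintype.sum_sigma, Fintype.sum_sum_type]

theorem add_two_mul_le_of_flag_bounds {q S T s t c r m : ℕ} (hc3 : 3 ≤ c) (hm : 1 ≤ m)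
    (hs : s ≤ r * S) (ht : c * T ≤ t) (hr : r ≤ c * m) (h1 : q ≤ t)
    (h2 : q * (1 + m) ≤ t + s) (h3 : m = 1 → 3 * q ≤ t + 2 * s) :
    q + 2 * T ≤ 2 * S + t := by
  rcases le_or_gt T S with hTS | hTS
  · omega
  by_cases hsm : m = 1 ∧ c = 3
  · obtain ⟨rfl, rfl⟩ := hsm
    have := h3 rfl
    have : r * S ≤ 3 * S := Nat.mul_le_mul_right _ (by omega)
    omega
  · have hcm : 2 * (1 + m) ≤ m * c := by
      rcases Nat.lt_or_ge c 4 with h | h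
      · obtain rfl : c = 3 := by omega
        omega
      · nlinarith
    obtain ⟨d, rfl⟩ := Nat.exists_eq_add_of_lt hTS
    have e1 : r * S ≤ c * m * S := Nat.mul_le_mul_right _ hr
    have e2 : m * (c * (S + d + 1)) ≤ m * t := Nat.mul_le_mul_left _ ht
    have e3 : 2 * (1 + m) * (d + 1) ≤ m * c * (d + 1) := Nat.mul_le_mul_right _ hcm
    have : (1 + m) * (q + 2 * (S + d + 1)) ≤ (1 + m) * (2 * S + t) := by nlinarith
    exact Nat.le_of_mul_le_mul_left this (by omega)

open Classical in
set_option maxHeartbeats 1000000 in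
theorem flagGraph_exists_isPerfectMatching {V ι : Type*} [Fintype ι] (E : ι → Finset V)
    {c r m : ℕ} (hc3 : 3 ≤ c) (hcE : ∀ i, c ≤ #(E i)) (hEr : ∀ i, #(E i) ≤ r) (hr : r ≤ c * m)
    (hcut : ∀ (A : Set V) (B : Finset ι), (∃ u, u ∈ A) → (∃ w, w ∉ A) →
      (∀ i, i ∉ B → ∀ a ∈ E i, ∀ b ∈ E i, a ∈ A → b ∈ A) →
      1 + m ≤ ∑ i ∈ B, #{v : E i | (v : V) ∈ A}) :
    ∃ M : (flagGraph E).Subgraph, M.IsPerfectMatching := by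
  by_contra hno
  obtain ⟨U, κ, hκ, hlt, hirr⟩ := (flagGraph E).exists_irreducible_odd_coloring hno
  let fl : ∀ i, E i → Σ i, (E i ⊕ Fin (#(E i) - 2)) := fun i v => ⟨i, .inl v⟩
  let du : ∀ i, Fin (#(E i) - 2) → Σ i, (E i ⊕ Fin (#(E i) - 2)) := fun i d => ⟨i, .inr d⟩
  have hκfd : ∀ i v d, fl i v ∉ U → du i d ∉ U → κ (fl i v) = κ (du i d) :=
    fun i v d h1 h2 => hκ _ _ h1 h2 rfl
  have hκff : ∀ i j (v : E i) (w : E j), (v : V) = w → fl i v ∉ U → fl j w ∉ U →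
      κ (fl i v) = κ (fl j w) := by
    intro i j v w hvw h1 h2
    by_cases hij : i = j
    · subst hij
      rw [Subtype.ext hvw]
    · exact hκ _ _ h1 h2 ⟨hij, hvw⟩
  let z : ∀ i, Fin (#(E i) - 2) := fun i => ⟨0, by have := hcE i; omega⟩
  -- the shape of an irreducible colouring
  have hS : ∀ i v, fl i v ∈ U → ∀ w, fl i w ∈ U := by
    intro i v hv w
    by_contra hw
    let b := κ (fl i w)
    obtain ⟨a, ha⟩ : ∃ a, ∀ j (u : E j), (u : V) = v → fl j u ∉ U → κ (fl j u) = a := by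
      by_cases h : ∃ j, ∃ u : E j, (u : V) = v ∧ fl j u ∉ U
      · obtain ⟨j, u, huv, hu⟩ := h
        exact ⟨κ (fl j u), fun j' u' h1 h2 => hκff _ _ _ _ (h1.trans huv.symm) h2 hu⟩
      · push Not at h
        exact ⟨b, fun j u h1 h2 => absurd (h j u h1) h2⟩
    obtain ⟨⟨j, u | d⟩, hy, hadj, hya, hyb⟩ := hirr _ hv a b
    · exact hya (ha j u hadj.2.symm hy)
    · obtain rfl : i = j := hadj
      exact hyb (hκfd _ _ _ hw hy).symm
  have hT : ∀ i d, du i d ∈ U → (∀ d', du i d' ∈ U) ∧ ∀ v, fl i v ∉ U := by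
    intro i d hd
    constructor
    · intro d'
      by_contra hd'
      obtain ⟨⟨j, u | e⟩, hy, hadj, hya, -⟩ := hirr _ hd (κ (du i d')) (κ (du i d'))
      · obtain rfl : i = j := hadj
        exact hya (hκfd _ _ _ hy hd')
      · exact hadj
    · intro v hv
      obtain ⟨⟨j, u | e⟩, hy, hadj, -, -⟩ := hirr _ hd (du i d) (du i d)
      · obtain rfl : i = j := hadj
        exact hy (hS _ _ hv u)
      · exact hadj
  let S : Finset ι := {i | ∀ v, fl i v ∈ U}
  let T : Finset ι := {i | ∀ d, du i d ∈ U}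
  have hne : ∀ i, ∃ v, v ∈ E i := fun i =>
    Finset.card_pos.1 (by have := hcE i; omega)
  have hflU : ∀ i v, fl i v ∈ U ↔ i ∈ S := fun i v =>
    ⟨fun h => by simpa [S] using hS i v h, fun h => by
      simp only [S, Finset.mem_filter] at h
      exact h.2 v⟩
  have hduU : ∀ i d, du i d ∈ U ↔ i ∈ T := fun i d =>
    ⟨fun h => by simpa [T] using (hT i d h).1, fun h => by
      simp only [T, Finset.mem_filter] at h
      exact h.2 d⟩
  have hST : ∀ i, i ∈ S → i ∉ T := by
    intro i hiS hiT
    obtain ⟨v, hv⟩ := hne i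
    exact (hT i (z i) ((hduU _ _).2 hiT)).2 ⟨v, hv⟩ ((hflU _ _).2 hiS)
  have hUcard : #U = ∑ i ∈ S, #(E i) + ∑ i ∈ T, (#(E i) - 2) := by
    have h := card_filter_sigma_sum (fun x => x ∈ U)
    rw [Finset.filter_univ_mem] at h
    rw [h, Finset.sum_add_distrib]
    have e1 : ∀ i, #{v : E i | fl i v ∈ U} = if i ∈ S then #(E i) else 0 := by
      intro i
      simp only [hflU]
      by_cases h : i ∈ S <;> simp [h]
    have e2 : ∀ i, #{d | du i d ∈ U} = if i ∈ T then #(E i) - 2 else 0 := by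
      intro i
      simp only [hduU]
      by_cases h : i ∈ T <;> simp [h]
    have e1' := Finset.sum_congr (rfl : (Finset.univ : Finset ι) = Finset.univ) (fun i _ => e1 i)
    have e2' := Finset.sum_congr (rfl : (Finset.univ : Finset ι) = Finset.univ) (fun i _ => e2 i)
    rw [Finset.sum_ite_mem, Finset.univ_inter] at e1' e2'
    rw [← e1', ← e2']
  -- the odd colours that avoid the dummies isolated by `U`
  let O : Finset (Σ i, (E i ⊕ Fin (#(E i) - 2))) := {c | Odd #{x | x ∉ U ∧ κ x = c}}
  let D := S.biUnion fun i => Finset.univ.image fun d => κ (du i d)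
  let Q := O \ D
  have hD : #D ≤ ∑ i ∈ S, (#(E i) - 2) := by
    refine Finset.card_biUnion_le.trans (Finset.sum_le_sum fun i _ => ?_)
    exact Finset.card_image_le.trans (by simp)
  have hOQ : #O ≤ #D + #Q := by
    have := Finset.le_card_sdiff D O
    simp only [Q]; omega
  have hlt' : #U < #O := by convert hlt
  have hSsum : ∑ i ∈ S, #(E i) = ∑ i ∈ S, (#(E i) - 2) + 2 * #S := by
    rw [mul_comm, ← smul_eq_mul, ← Finset.sum_const, ← Finset.sum_add_distrib]
    exact Finset.sum_congr rfl fun i _ => by have := hcE i; omega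
  have hTsum : ∑ i ∈ T, #(E i) = ∑ i ∈ T, (#(E i) - 2) + 2 * #T := by
    rw [mul_comm, ← smul_eq_mul, ← Finset.sum_const, ← Finset.sum_add_distrib]
    exact Finset.sum_congr rfl fun i _ => by have := hcE i; omega
  have hQbig : 2 * #S + ∑ i ∈ T, (#(E i) - 2) < #Q := by omega
  have hodd : ∀ c ∈ Q, Odd (∑ i ∈ T, #{v : E i | κ (fl i v) = c}) := by
    intro c hc
    simp only [Q, O, Finset.mem_sdiff, Finset.mem_filter, Finset.mem_univ, true_and] at hc
    obtain ⟨hcO, hcD⟩ := hc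
    rw [card_filter_sigma_sum (fun x => x ∉ U ∧ κ x = c)] at hcO
    have hev : Even (∑ i, ((#{v : E i | fl i v ∉ U ∧ κ (fl i v) = c} +
        #{d | du i d ∉ U ∧ κ (du i d) = c}) +
        if i ∈ T then #{v : E i | κ (fl i v) = c} else 0)) := by
      refine Finset.even_sum _ fun i _ => ?_
      simp only [hflU, hduU]
      by_cases hiS : i ∈ S
      · have : ∀ d, κ (du i d) ≠ c := by
          intro d hd
          exact hcD (Finset.mem_biUnion.2 ⟨i, hiS, Finset.mem_image.2 ⟨d, Finset.mem_univ _, hd⟩⟩)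
        simp [hiS, hST i hiS, this]
      by_cases hiT : i ∈ T
      · simp [hiS, hiT]
      · have hcol : ∀ d v, κ (fl i v) = κ (du i d) := fun d v =>
          hκfd _ _ _ (by rwa [hflU]) (by rwa [hduU])
        obtain ⟨v, hv⟩ := hne i
        have hcol' : ∀ d, κ (du i d) = κ (du i (z i)) := fun d =>
          (hcol d ⟨v, hv⟩).symm.trans (hcol (z i) _)
        by_cases hz : κ (du i (z i)) = c
        · have h3 := hcE i
          simp only [hiS, hiT, hcol (z i), hcol', hz, not_false_eq_true, and_self,
            Finset.filter_true, Finset.card_univ, Fintype.card_coe, Fintype.card_fin, if_false]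
          exact ⟨#(E i) - 1, by omega⟩
        · simp [hiS, hiT, hcol (z i), hcol', hz]
    rw [Finset.sum_add_distrib, Finset.sum_ite_mem, Finset.univ_inter, Nat.even_add'] at hev
    exact hev.1 hcO
  -- the vertices of a given colour
  let A : (Σ i, (E i ⊕ Fin (#(E i) - 2))) → Set V :=
    fun c => {u | ∃ i, ∃ v : E i, (v : V) = u ∧ fl i v ∉ U ∧ κ (fl i v) = c}
  have hAcol : ∀ c i (v : E i), fl i v ∉ U → (v : V) ∈ A c → κ (fl i v) = c := by
    rintro c i v hv ⟨j, w, hwv, hw, rfl⟩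
    exact hκff _ _ _ _ hwv.symm hv hw
  have hAdisj : ∀ u c c', u ∈ A c → u ∈ A c' → c = c' := by
    rintro u c c' ⟨i, v, rfl, hv, rfl⟩ h'
    exact hAcol c' i v hv h'
  have hTflag : ∀ c ∈ Q, ∃ i ∈ T, ∃ v : E i, κ (fl i v) = c := by
    intro c hc
    by_contra! h
    have h0 : ∑ i ∈ T, #{v : E i | κ (fl i v) = c} = 0 :=
      Finset.sum_eq_zero fun i hi => by simp [h i hi]
    have := hodd c hc
    rw [h0] at this
    simp at this
  have hTU : ∀ i ∈ T, ∀ v, fl i v ∉ U := fun i hi v h => hST i ((hflU _ _).1 h) hi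
  have hAne : ∀ c ∈ Q, ∃ u, u ∈ A c := by
    intro c hc
    obtain ⟨i, hi, v, hv⟩ := hTflag c hc
    exact ⟨v, i, v, rfl, hTU i hi v, hv⟩
  obtain ⟨c₀, hc₀⟩ : Q.Nonempty := Finset.card_pos.1 (by omega)
  obtain ⟨i₀, hi₀, -⟩ := hTflag c₀ hc₀
  have hTpos : 1 ≤ ∑ i ∈ T, (#(E i) - 2) := by
    refine le_trans ?_ (Finset.single_le_sum (fun _ _ => Nat.zero_le _) hi₀)
    have := hcE i₀; omega
  have hAproper : ∀ c ∈ Q, ∃ w, w ∉ A c := by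
    intro c hc
    by_contra! h
    have : #Q ≤ 1 := Finset.card_le_one.2 fun a ha b hb => by
      obtain ⟨u, hu⟩ := hAne a ha
      obtain ⟨w, hw⟩ := hAne b hb
      rw [hAdisj u a c hu (h u), hAdisj w b c hw (h w)]
    omega
  have hcutc : ∀ c ∈ Q, 1 + m ≤ ∑ i ∈ T, #{v : E i | κ (fl i v) = c} +
      ∑ i ∈ S, #{v : E i | (v : V) ∈ A c} := by
    intro c hc
    have h := hcut (A c) (T ∪ S) (hAne c hc) (hAproper c hc) ?_
    · rw [Finset.sum_union (Finset.disjoint_left.2 fun i h1 h2 => hST i h2 h1)] at h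
      refine h.trans (Nat.add_le_add (Finset.sum_le_sum fun i hi => ?_) (le_of_eq (by congr!)))
      refine Finset.card_le_card fun v hv => ?_
      simp only [Finset.mem_filter, Finset.mem_univ, true_and] at hv ⊢
      exact hAcol c i v (hTU i hi v) hv
    · intro i hi a ha b hb haA
      rw [Finset.mem_union, not_or] at hi
      have h1 : ∀ v, fl i v ∉ U := fun v => by rw [hflU]; exact hi.2
      have h2 : du i (z i) ∉ U := by rw [hduU]; exact hi.1
      refine ⟨i, ⟨b, hb⟩, rfl, h1 _, ?_⟩
      rw [← hAcol c i ⟨a, ha⟩ (h1 _) haA, hκfd i _ (z i) (h1 _) h2, hκfd i _ (z i) (h1 _) h2]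
  -- double counting
  have hx : ∑ c ∈ Q, ∑ i ∈ T, #{v : E i | κ (fl i v) = c} ≤ ∑ i ∈ T, #(E i) := by
    rw [Finset.sum_comm]
    refine Finset.sum_le_sum fun i _ => ?_
    rw [Finset.sum_card_fiberwise_eq_card_filter]
    exact (Finset.card_filter_le _ _).trans (by simp)
  have hy : ∑ c ∈ Q, ∑ i ∈ S, #{v : E i | (v : V) ∈ A c} ≤ ∑ i ∈ S, #(E i) := by
    rw [Finset.sum_comm]
    refine Finset.sum_le_sum fun i _ => ?_
    rw [← Finset.card_biUnion]
    · exact (Finset.card_le_univ _).trans (by simp)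
    · intro a _ b _ hab
      refine Finset.disjoint_left.2 fun v hv hv' => hab ?_
      simp only [Finset.mem_filter, Finset.mem_univ, true_and] at hv hv'
      exact hAdisj _ _ _ hv hv'
  have hm : 1 ≤ m := by
    rcases Nat.eq_zero_or_pos m with rfl | h
    · have := hcE i₀; have := hEr i₀; omega
    · exact h
  have hfin := add_two_mul_le_of_flag_bounds (q := #Q) (S := #S) (T := #T) (s := ∑ i ∈ S, #(E i))
    (t := ∑ i ∈ T, #(E i)) hc3 hm ?_ ?_ hr ?_ ?_ ?_
  · omega
  · rw [mul_comm]; exact Finset.sum_le_card_nsmul _ _ _ fun i _ => hEr i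
  · rw [mul_comm]; exact Finset.card_nsmul_le_sum _ _ _ fun i _ => hcE i
  · refine le_trans ?_ hx
    rw [Finset.card_eq_sum_ones]
    exact Finset.sum_le_sum fun c hc => (hodd c hc).pos
  · refine le_trans ?_ (Nat.add_le_add hx hy)
    rw [← Finset.sum_add_distrib]
    exact Finset.card_nsmul_le_sum _ _ _ fun c hc => hcutc c hc
  · rintro rfl
    refine le_trans ?_ (Nat.add_le_add hx (Nat.mul_le_mul_left 2 hy))
    rw [Finset.mul_sum, ← Finset.sum_add_distrib, mul_comm, ← smul_eq_mul]
    refine Finset.card_nsmul_le_sum _ _ _ fun c hc => ?_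
    have h1 := hcutc c hc
    obtain ⟨k, hk⟩ := hodd c hc
    omega

/-- The closed walk traced by a cycle of a permutation of edge traversals: `x` stands for the
traversal of the edge `ed x` from the vertex `vt x` to the vertex `vt (π x)`. -/
noncomputable def ClosedWalk.ofPerm {V ι X : Type*} [Finite X] {E : ι → Finset V} (π : Equiv.Perm X)
    (vt : X → V) (ed : X → ι) (hself : ∀ x, vt x ∈ E (ed x)) (hsucc : ∀ x, vt (π x) ∈ E (ed x))
    (hne : ∀ x, vt x ≠ vt (π x)) (x : X) : ClosedWalk E :=
  have hpos : 0 < Function.minimalPeriod π x :=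
    Function.minimalPeriod_pos_of_mem_periodicPts (π.injective.mem_periodicPts x)
  have hstep : ∀ i : ZMod (Function.minimalPeriod π x), π^[(i + 1).val] x = π (π^[i.val] x) := by
    intro i
    have : NeZero (Function.minimalPeriod π x) := ⟨hpos.ne'⟩
    rw [ZMod.val_add, ZMod.val_one_eq_one_mod, Nat.add_mod_mod,
      Function.iterate_mod_minimalPeriod_eq, Function.iterate_succ_apply']
  { len := Function.minimalPeriod π x
    len_pos := hpos
    vtx := fun i => vt (π^[i.val] x)
    edg := fun i => ed (π^[i.val] x)
    mem_self := fun i => hself _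
    mem_succ := fun i => by rw [hstep]; exact hsucc _
    vtx_ne := fun i => by rw [hstep]; exact hne _ }

theorem Equiv.Perm.not_sameCycle_mul_apply {X : Type*} {A B : Equiv.Perm X}
    (hA : ∀ x, A (A x) = x) (hB : ∀ x, B (B x) = x) (hA' : ∀ x, A x ≠ x) (hB' : ∀ x, B x ≠ x)
    (x : X) : ¬ (A * B).SameCycle x (B x) := by
  rintro ⟨n, hn⟩
  have hinv : (A * B)⁻¹ = B * A := by
    rw [inv_eq_iff_mul_eq_one]
    ext y
    simp [hA, hB]
  have hsemi : SemiconjBy B (A * B) (A * B)⁻¹ := by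
    rw [hinv]
    ext y
    simp
  have hconj : ∀ (k : ℤ) y, B (((A * B) ^ k) y) = ((A * B) ^ (-k)) (B y) := by
    intro k y
    have := (hsemi.zpow_right k).eq
    rw [inv_zpow'] at this
    exact congrArg (fun g : Equiv.Perm X => g y) this
  rcases Int.even_or_odd' n with ⟨k, rfl | rfl⟩
  · apply hB' (((A * B) ^ k) x)
    rw [hconj, ← hn, ← Equiv.Perm.mul_apply, ← zpow_add]
    congr 2
    ring
  · apply hA' (B (((A * B) ^ k) x))
    have h1 : B (((A * B) ^ k) x) = (A * B) (((A * B) ^ k) x) := by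
      rw [hconj, ← hn, ← Equiv.Perm.mul_apply, ← Equiv.Perm.mul_apply, ← zpow_add, ← zpow_one_add]
      congr 2
      ring
    exact h1.symm

theorem hasEulerFamily_of_finite {V ι J : Type*} [Finite J] {E : ι → Finset V}
    (W : J → ClosedWalk E)
    (h : ∀ i, ∃! p : (j : J) × ZMod (W j).len, (W p.1).edg p.2 = i) : HasEulerFamily E := by
  obtain ⟨m, ⟨f⟩⟩ := Finite.exists_equiv_fin J
  refine ⟨m, fun a => W (f.symm a), fun i => ?_⟩
  let g : ((a : Fin m) × ZMod (W (f.symm a)).len) ≃ ((j : J) × ZMod (W j).len) :=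
    Equiv.sigmaCongrLeft f.symm (β := fun j => ZMod (W j).len)
  exact (g.existsUnique_congr (fun _ => Iff.rfl)).2 (h i)

theorem hasEulerFamily_of_involutions {V ι X : Type*} [Finite X] {E : ι → Finset V}
    (vt : X → V) (ed : X → ι) (hmem : ∀ x, vt x ∈ E (ed x))
    (hinj : ∀ x y, ed x = ed y → vt x = vt y → x = y) (α β : X → X)
    (hα : ∀ x, α (α x) = x) (hα' : ∀ x, α x ≠ x) (hαv : ∀ x, vt (α x) = vt x)
    (hβ : ∀ x, β (β x) = x) (hβ' : ∀ x, β x ≠ x) (hβe : ∀ x, ed (β x) = ed x)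
    (hcover : ∀ i, ∃ x, ed x = i ∧ ∀ y, ed y = i → y = x ∨ y = β x) :
    HasEulerFamily E := by
  classical
  let A : Equiv.Perm X := Function.Involutive.toPerm α hα
  let B : Equiv.Perm X := Function.Involutive.toPerm β hβ
  let π := A * B
  have hπ : ∀ x, π x = α (β x) := fun _ => rfl
  have hnot : ∀ x, ¬ π.SameCycle x (β x) :=
    Equiv.Perm.not_sameCycle_mul_apply (A := A) (B := B) hα hβ hα' hβ'
  have hβcyc : ∀ x y, π.SameCycle x y → π.SameCycle (β x) (β y) := by
    intro x y h
    have h' : (B * π * B⁻¹).SameCycle (β x) (β y) := h.conj (g := B)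
    have : B * π * B⁻¹ = π⁻¹ := by
      rw [eq_inv_iff_mul_eq_one]
      ext z
      simp [π, A, B, hα, hβ, Function.Involutive.toPerm]
    rw [this] at h'
    exact h'.of_inv
  let Z := Quotient (Equiv.Perm.SameCycle.setoid π)
  let cls : X → Z := Quotient.mk _
  have hcls : ∀ x y, cls x = cls y ↔ π.SameCycle x y := fun x y => Quotient.eq
  obtain ⟨n, ⟨e⟩⟩ := Finite.exists_equiv_fin Z
  let J := {z : Z // e z < e (cls (β z.out))}
  have hout : ∀ x, π.SameCycle (cls x).out x := fun x => (hcls _ _).1 (Quotient.out_eq _)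
  have hJ : ∀ x, e (cls x) < e (cls (β (cls x).out)) ↔ e (cls x) < e (cls (β x)) := by
    intro x
    rw [(hcls _ _).2 (hβcyc _ _ (hout x))]
  have hsucc : ∀ x, vt (π x) ∈ E (ed x) := by
    intro x
    rw [hπ, hαv, ← hβe]
    exact hmem _
  have hne : ∀ x, vt x ≠ vt (π x) := by
    intro x h
    rw [hπ, hαv] at h
    exact hβ' x (hinj _ _ (hβe x) h.symm)
  refine hasEulerFamily_of_finite
    (fun j : J => ClosedWalk.ofPerm π vt ed hmem hsucc hne j.1.out) fun i => ?_
  obtain ⟨y, hyJ, hy, huniq⟩ : ∃ y, e (cls y) < e (cls (β y)) ∧ ed y = i ∧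
      ∀ y', ed y' = i → e (cls y') < e (cls (β y')) → y' = y := by
    obtain ⟨x, hx, hx'⟩ := hcover i
    rcases lt_trichotomy (e (cls x)) (e (cls (β x))) with h | h | h
    · refine ⟨x, h, hx, fun y' h1 h2 => ?_⟩
      rcases hx' y' h1 with rfl | rfl
      · rfl
      · rw [hβ] at h2
        exact absurd h2 h.asymm
    · exact absurd ((hcls _ _).1 (e.injective h)) (hnot x)
    · refine ⟨β x, by rwa [hβ], (hβe x).trans hx, fun y' h1 h2 => ?_⟩
      rcases hx' y' h1 with rfl | rfl
      · exact absurd h2 h.asymm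
      · rfl
  have hzJ : e (cls y) < e (cls (β (cls y).out)) := (hJ y).2 hyJ
  let j : J := ⟨cls y, hzJ⟩
  have hval : ∀ (j' : J) k, ed (π^[k] j'.1.out) = i → π^[k] j'.1.out = y ∧ j' = j := by
    rintro ⟨z, hz⟩ k hk
    have hzc : cls (π^[k] z.out) = z := by
      conv_rhs => rw [← Quotient.out_eq z]
      refine (hcls _ _).2 (Equiv.Perm.SameCycle.symm ⟨k, ?_⟩)
      simp [Equiv.Perm.iterate_eq_pow]
    have hky := huniq _ hk (by rw [← hJ, hzc]; exact hz)
    refine ⟨hky, Subtype.ext ?_⟩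
    exact hzc.symm.trans (congrArg cls hky)
  obtain ⟨k, hk⟩ := (hout y).exists_nat_pow_eq
  rw [← Equiv.Perm.iterate_eq_pow] at hk
  have hpos : 0 < Function.minimalPeriod π (cls y).out :=
    Function.minimalPeriod_pos_of_mem_periodicPts (π.injective.mem_periodicPts _)
  have hwalk : ∀ j' : J, ∀ l : ZMod (Function.minimalPeriod π j'.1.out),
      ed (π^[l.val] j'.1.out) = i → (⟨j', l⟩ : Σ j' : J, ZMod (Function.minimalPeriod π j'.1.out)) =
        ⟨j, (k : ZMod (Function.minimalPeriod π (cls y).out))⟩ := by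
    intro j' l hl
    obtain ⟨h1, rfl⟩ := hval j' _ hl
    have : NeZero (Function.minimalPeriod π (cls y).out) := ⟨hpos.ne'⟩
    congr 1
    apply ZMod.val_injective
    rw [ZMod.val_natCast]
    refine Function.iterate_injOn_Iio_minimalPeriod (f := π) (x := (cls y).out)
      (ZMod.val_lt _) (Nat.mod_lt _ hpos) ?_
    exact h1.trans (hk.symm.trans Function.iterate_mod_minimalPeriod_eq.symm)
  refine ⟨⟨j, (k : ZMod (Function.minimalPeriod π (cls y).out))⟩, ?_, fun p hp => hwalk p.1 p.2 hp⟩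
  change ed (π^[(k : ZMod (Function.minimalPeriod π (cls y).out)).val] (cls y).out) = i
  rw [ZMod.val_natCast, Function.iterate_mod_minimalPeriod_eq, hk, hy]

theorem hasEulerFamily_of_flagGraph_isPerfectMatching {V ι : Type*} [Finite ι] {E : ι → Finset V}
    (hE : ∀ i, 2 ≤ #(E i)) (M : (flagGraph E).Subgraph) (hM : M.IsPerfectMatching) :
    HasEulerFamily E := by
  classical
  rw [SimpleGraph.Subgraph.isPerfectMatching_iff] at hM
  choose mate hmate huniq using hM
  have hmm : ∀ x, mate (mate x) = x := fun x => (huniq _ _ (hmate x).symm).symm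
  have hadj : ∀ x, (flagGraph E).Adj x (mate x) := fun x => (hmate x).adj_sub
  have hmate_inj : Function.Injective mate := Function.LeftInverse.injective hmm
  let fl : (Σ i, E i) → Σ i, (E i ⊕ Fin (#(E i) - 2)) := fun p => ⟨p.1, .inl p.2⟩
  have hfl : Function.Injective fl := by
    rintro ⟨i, v⟩ ⟨j, w⟩ h
    simp only [fl, Sigma.mk.injEq] at h
    obtain ⟨rfl, h⟩ := h
    rw [heq_iff_eq, Sum.inl.injEq] at h
    rw [h]
  -- the flags matched to flags
  let P : (Σ i, E i) → Prop := fun p => ∃ q, mate (fl p) = fl q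
  have hpartner : ∀ x : {p // P p}, ∃ y : {p // P p}, mate (fl x.1) = fl y.1 := by
    rintro ⟨p, q, hq⟩
    exact ⟨⟨q, p, by rw [← hq, hmm]⟩, hq⟩
  choose α hα using hpartner
  -- every edge has exactly two such flags
  have htwo : ∀ i, #{v : E i | P ⟨i, v⟩} = 2 := by
    intro i
    have hd : ∀ d : Fin (#(E i) - 2), ∃ v : E i, mate ⟨i, .inr d⟩ = fl ⟨i, v⟩ := by
      intro d
      have h := hadj ⟨i, .inr d⟩
      rcases hm : mate ⟨i, .inr d⟩ with ⟨j, w | d'⟩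
      · rw [hm] at h
        obtain rfl : i = j := h
        exact ⟨w, rfl⟩
      · rw [hm] at h
        exact h.elim
    choose g hg using hd
    have hginj : Function.Injective g := by
      intro d d' h
      have h' := (hg d).trans ((congrArg (fun v => fl ⟨i, v⟩) h).trans (hg d').symm)
      simpa using hmate_inj h'
    have hcompl : ({v : E i | ¬ P ⟨i, v⟩} : Finset (E i)) = Finset.univ.image g := by
      ext v
      simp only [Finset.mem_filter, Finset.mem_univ, true_and, Finset.mem_image]
      constructor
      · intro hv
        have h := hadj (fl ⟨i, v⟩)
        rcases hm : mate (fl ⟨i, v⟩) with ⟨j, w | d⟩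
        · exact absurd ⟨⟨j, w⟩, hm⟩ hv
        · rw [hm] at h
          obtain rfl : i = j := h
          refine ⟨d, ?_⟩
          have h' := hg d
          rw [← hm, hmm] at h'
          have := hfl h'
          simpa using this.symm
      · rintro ⟨d, rfl⟩ ⟨q, hq⟩
        rw [← hg, hmm] at hq
        simp only [fl, Sigma.mk.injEq] at hq
        obtain ⟨j, w⟩ := q
        obtain ⟨rfl, hq⟩ := hq
        simp at hq
    have h1 := Finset.card_filter_add_card_filter_not (s := (Finset.univ : Finset (E i)))
      (fun v => P ⟨i, v⟩)
    rw [hcompl, Finset.card_image_of_injective _ hginj] at h1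
    simp only [Finset.card_univ, Fintype.card_fin, Fintype.card_coe] at h1
    have := hE i
    omega
  have hfibre : ∀ x : {p // P p}, ∃ y : {p // P p}, y ≠ x ∧ y.1.1 = x.1.1 ∧
      ∀ w : {p // P p}, w.1.1 = x.1.1 → w = x ∨ w = y := by
    rintro ⟨⟨i, v⟩, hv⟩
    obtain ⟨w, hw, hwv, huw⟩ : ∃ w : E i, P ⟨i, w⟩ ∧ w ≠ v ∧ ∀ u, P ⟨i, u⟩ → u = v ∨ u = w := by
      obtain ⟨a, b, hab, hset⟩ := Finset.card_eq_two.1 (htwo i)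
      have hmem : ∀ u, P ⟨i, u⟩ ↔ u = a ∨ u = b := by
        intro u
        simpa using Finset.ext_iff.1 hset u
      rcases (hmem v).1 hv with rfl | rfl
      · exact ⟨b, (hmem b).2 (Or.inr rfl), hab.symm, fun u hu => (hmem u).1 hu⟩
      · exact ⟨a, (hmem a).2 (Or.inl rfl), hab, fun u hu => ((hmem u).1 hu).symm⟩
    refine ⟨⟨⟨i, w⟩, hw⟩, ?_, rfl, ?_⟩
    · simpa using hwv
    · rintro ⟨⟨j, u⟩, hu⟩ hj
      obtain rfl : j = i := hj
      rcases huw u hu with rfl | rfl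
      · exact Or.inl rfl
      · exact Or.inr rfl
  choose β hβne hβe hβu using hfibre
  have : Finite {p // P p} := Subtype.finite
  refine hasEulerFamily_of_involutions (X := {p // P p}) (fun x => (x.1.2 : V)) (fun x => x.1.1)
    (fun x => x.1.2.2) ?_ α β ?_ ?_ ?_ ?_ hβne hβe ?_
  · rintro ⟨⟨i, v⟩, hv⟩ ⟨⟨j, w⟩, hw⟩ hij hvw
    obtain rfl : i = j := hij
    obtain rfl : v = w := Subtype.ext hvw
    rfl
  · intro x
    apply Subtype.ext
    apply hfl
    rw [← hα, ← hα, hmm]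
  · intro x hx
    have h := hadj (fl x.1)
    rw [hα, hx] at h
    exact h.ne rfl
  · intro x
    have h := hadj (fl x.1)
    rw [hα] at h
    exact h.2.symm
  · intro x
    exact ((hβu (β x) x (hβe x).symm).resolve_left (hβne x).symm).symm
  · intro i
    obtain ⟨v, hv⟩ := Finset.card_pos.1 ((htwo i).symm ▸ Nat.two_pos)
    exact ⟨⟨⟨i, v⟩, (Finset.mem_filter.1 hv).2⟩, rfl, fun y hy => hβu _ y hy⟩

open Classical in
theorem FlagConnected.le_sum_card {V ι : Type*} [Fintype ι] {E : ι → Finset V} {k : ℕ}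
    (h : FlagConnected E k) (A : Set V) (B : Finset ι) (hA : ∃ u, u ∈ A) (hA' : ∃ w, w ∉ A)
    (hclosed : ∀ i, i ∉ B → ∀ a ∈ E i, ∀ b ∈ E i, a ∈ A → b ∈ A) :
    k ≤ ∑ i ∈ B, #{v : E i | (v : V) ∈ A} := by
  obtain ⟨u, hu⟩ := hA
  obtain ⟨w, hw⟩ := hA'
  by_contra! hlt
  let F : Finset (V × ι) :=
    (B.sigma fun i => ({v : E i | (v : V) ∈ A} : Finset (E i))).image fun p => ((p.2 : V), p.1)
  have hF : ∀ v i, (v, i) ∈ F ↔ i ∈ B ∧ v ∈ E i ∧ v ∈ A := by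
    intro v i
    simp only [F, Finset.mem_image, Finset.mem_sigma, Finset.mem_filter, Finset.mem_univ, true_and]
    constructor
    · rintro ⟨⟨j, x⟩, ⟨hj, hx⟩, heq⟩
      obtain ⟨rfl, rfl⟩ := Prod.mk.inj heq
      exact ⟨hj, x.2, hx⟩
    · rintro ⟨hi, hv, hvA⟩
      exact ⟨⟨i, ⟨v, hv⟩⟩, ⟨hi, hvA⟩, rfl⟩
  have hcard : #F < k := by
    refine (Finset.card_image_le.trans ?_).trans_lt hlt
    rw [Finset.card_sigma]
  have hcon := h.2 F (fun p hp => ((hF p.1 p.2).1 hp).2.1) hcard u w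
  apply hw
  clear hw
  induction hcon with
  | refl => exact hu
  | tail _ hstep ih =>
    obtain ⟨i, ha, hb⟩ := hstep
    rw [Finset.mem_filter] at ha hb
    by_cases hi : i ∈ B
    · exact absurd ((hF _ _).2 ⟨hi, ha.1, ih⟩) ha.2
    · exact hclosed i hi _ ha.1 _ hb.1 ih

/-- **Theorem 1.2.** Any `(1 + ⌈rk(𝒢)/crk(𝒢)⌉)`-flag-connected hypergraph `𝒢` with
`crk(𝒢) ≥ 3` is quasi-Eulerian, i.e. it admits an Euler family.
(Here `⌈k/c⌉` is expressed as `(k + c - 1) / c`, which equals the ceiling since `c > 0`.) -/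
theorem hasEulerFamily_of_flagConnected {V ι : Type*} [Fintype V] [Fintype ι] [Nonempty ι]
    [DecidableEq V] [DecidableEq ι] (E : ι → Finset V)
    (hcrk : 3 ≤ Finset.univ.inf' Finset.univ_nonempty (fun i => (E i).card))
    (hflag : FlagConnected E
      (1 + (Finset.univ.sup' Finset.univ_nonempty (fun i => (E i).card) +
            Finset.univ.inf' Finset.univ_nonempty (fun i => (E i).card) - 1) /
            Finset.univ.inf' Finset.univ_nonempty (fun i => (E i).card))) :
    HasEulerFamily E := by
  set c := Finset.univ.inf' Finset.univ_nonempty (fun i => (E i).card)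
  set r := Finset.univ.sup' Finset.univ_nonempty (fun i => (E i).card)
  have hcE : ∀ i, c ≤ #(E i) := fun i =>
    Finset.inf'_le (fun i => (E i).card) (Finset.mem_univ i)
  have hEr : ∀ i, #(E i) ≤ r := fun i =>
    Finset.le_sup' (fun i => (E i).card) (Finset.mem_univ i)
  have hr : r ≤ c * ((r + c - 1) / c) := by
    have h1 := Nat.div_add_mod (r + c - 1) c
    have h2 := Nat.mod_lt (r + c - 1) (show 0 < c by omega)
    omega
  obtain ⟨M, hM⟩ := flagGraph_exists_isPerfectMatching E hcrk hcE hEr hr fun A B hA hA' hcl =>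
    FlagConnected.le_sum_card (by convert hflag) A B hA hA' hcl
  exact hasEulerFamily_of_flagGraph_isPerfectMatching
    (fun i => le_trans (by omega) (hcE i)) M hM
end

section
/- Every 2-edge-connected h-uniform hypergraph with h ≥ 3 is quasi-Eulerian, i.e., admits an Euler family. -/
open Finset

/-- `k`-edge-connectivity: the hypergraph is connected and remains connected after the
removal of any fewer than `k` edges. -/
def EdgeConnected {V ι : Type*} [DecidableEq ι] (E : ι → Finset V) (k : ℕ) : Prop :=
  HConnected E ∧
    ∀ S : Finset ι, S.card < k →
      ∀ u v : V, Relation.ReflTransGen (fun a b => ∃ i, i ∉ S ∧ a ∈ E i ∧ b ∈ E i) u v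

/-- In a hypergraph without cut edges, any nontrivial vertex partition is crossed by an edge
different from a given one. -/
lemma EdgeConnected.exists_crossing_edge {V ι : Type*} [DecidableEq ι] {E : ι → Finset V}
    (hconn : EdgeConnected E 2) (P : V → Prop) {u v : V} (hu : P u) (hv : ¬ P v) (e : ι) :
    ∃ e', e' ≠ e ∧ (∃ x ∈ E e', P x) ∧ ∃ y ∈ E e', ¬ P y := by
  by_contra! H
  refine hv ?_
  have hr := hconn.2 {e} (by simp) u v
  clear hv
  induction hr with
  | refl => exact hu
  | tail _ hbc ih =>
    obtain ⟨i, hi, hb, hc⟩ := hbc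
    exact H i (by simpa using hi) ⟨_, hb, ih⟩ _ hc

open Classical in
lemma sum_card_filter_eq_some_le {α C : Type*} [Fintype C] (s : Finset α) (g : α → Option C) :
    ∑ K, #{v ∈ s | g v = some K} ≤ #s := by
  rw [← Finset.card_biUnion]
  · exact Finset.card_le_card fun x hx => by
      simp only [mem_biUnion, mem_filter] at hx
      exact hx.choose_spec.2.1
  · intro K _ K' _ hne
    refine Finset.disjoint_left.2 fun x hx hx' => hne ?_
    simp only [mem_filter] at hx hx'
    exact Option.some.inj (hx.2.symm.trans hx'.2)

open Classical in
lemma card_filter_some_add_card_filter_none {α C : Type*} [Fintype α] (a : α → Option C) {K : C}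
    (ha : ∀ v K', a v = some K' → K' = K) :
    #{v | a v = some K} + #{v | a v = none} = Fintype.card α := by
  rw [← Finset.card_univ, add_comm,
    ← Finset.card_filter_add_card_filter_not (s := univ) (fun v => a v = none)]
  congr 1
  refine congrArg _ (Finset.filter_congr fun v _ => ?_)
  cases hv : a v with
  | none => simp
  | some K' => simp [ha v K' hv]

open Classical in
/-- The discharging step at a single edge.  The incidences `α` and the `h - 2` copies `β` of an
edge are coloured with components (or `none`, for the deleted ones), and `g` colours the
underlying vertices.  Every deleted element carries weight `h`, which can be distributed among
the colours so that each one receives enough. -/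
lemma exists_edge_weight {α β C : Type*} [Fintype α] [Fintype β] [Fintype C] {h : ℕ}
    (hh : 3 ≤ h) (hα : Fintype.card α = h) (hβ : Fintype.card β = h - 2)
    (a g : α → Option C) (b : β → Option C) (hag : ∀ v K, a v = some K → g v = some K)
    (hab : ∀ v k K K', a v = some K → b k = some K' → K' = K) :
    ∃ w : C → ℕ, ∑ K, w K ≤ h * (#{v | a v = none} + #{k | b k = none}) ∧ ∀ K,
      (Odd (#{v | a v = some K} + #{k | b k = some K}) →
        h - 2 ≤ w K ∧ ((∀ v, g v = some K) → h ≤ w K) ∧ ((∀ v, g v ≠ some K) → h ≤ w K)) ∧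
      (Even (#{v | a v = some K} + #{k | b k = some K}) →
        (∃ v, g v = some K) → (∃ v, g v ≠ some K) → 2 ≤ w K) := by
  obtain ⟨m, rfl⟩ : ∃ m, h = m + 3 := ⟨h - 3, by omega⟩
  have hm : m + 3 - 2 = m + 1 := by omega
  rw [hm] at hβ ⊢
  have hg := sum_card_filter_eq_some_le {v | a v = none} g
  have ha := sum_card_filter_eq_some_le univ a
  have hb := sum_card_filter_eq_some_le univ b
  rw [Finset.card_univ] at ha hb
  have hdel : ∀ v K, a v = none → g v = some K → 1 ≤ #{v ∈ {v | a v = none} | g v = some K} :=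
    fun v K h1 h2 => Finset.card_pos.2 ⟨v, by simp [h1, h2]⟩
  by_cases hA : ∀ v, a v = none
  · have hj : #{v | a v = none} = m + 3 := by simp [hA, hα]
    refine ⟨fun K => 2 * #{v ∈ {v | a v = none} | g v = some K} + (m + 3) * #{k | b k = some K},
      ?_, fun K => ⟨fun hodd => ?_, fun _ ⟨v, hv⟩ _ => ?_⟩⟩
    · rw [Finset.sum_add_distrib, ← Finset.mul_sum, ← Finset.mul_sum]
      rw [hj] at hg ⊢
      rw [hβ] at hb
      nlinarith
    · have h0 : #{v | a v = some K} = 0 := by simp [hA]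
      rw [h0, zero_add] at hodd
      have h1 := hodd.pos
      have : m + 3 ≤ 2 * #{v ∈ {v | a v = none} | g v = some K} +
          (m + 3) * #{k | b k = some K} := by nlinarith
      exact ⟨by dsimp only; omega, fun _ => this, fun _ => this⟩
    · have := hdel v K (hA v) hv
      dsimp only
      omega
  by_cases hB : ∀ k, b k = none
  · have hc : #{k | b k = none} = m + 1 := by simp [hB, hβ]
    refine ⟨fun K => 2 * #{v ∈ {v | a v = none} | g v = some K} + (m + 1) * #{v | a v = some K},
      ?_, fun K => ⟨fun hodd => ?_, fun heven ⟨v, hv⟩ _ => ?_⟩⟩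
    · rw [Finset.sum_add_distrib, ← Finset.mul_sum, ← Finset.mul_sum, hc]
      rw [hα] at ha
      nlinarith
    all_goals have h0 : #{k | b k = some K} = 0 := by simp [hB]
    · rw [h0, add_zero] at hodd
      have h1 := hodd.pos
      refine ⟨by nlinarith, fun hin => ?_, fun hout => ?_⟩
      · have : #{v ∈ {v | a v = none} | g v = some K} + #{v | a v = some K} = m + 3 := by
          rw [← hα, ← Finset.card_univ, ← Finset.card_union_of_disjoint]
          · congr 1
            ext v
            cases hv : a v with
            | none => simp [hv, hin v]
            | some K' =>
              have := (hag v K' hv).symm.trans (hin v)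
              simp_all
          · refine Finset.disjoint_left.2 fun x hx hx' => ?_
            simp_all
        nlinarith
      · obtain ⟨v, hv⟩ := Finset.card_pos.1 h1
        exact absurd (hag v K (by simpa using hv)) (hout v)
    · rw [h0, add_zero] at heven
      cases hav : a v with
      | none =>
        have := hdel v K hav hv
        dsimp only
        omega
      | some K' =>
        obtain rfl : K' = K := Option.some.inj ((hag v K' hav).symm.trans hv)
        have h1 : 0 < #{v | a v = some K'} := Finset.card_pos.2 ⟨v, by simp [hav]⟩
        have h2 : 2 ≤ #{v | a v = some K'} := by
          obtain ⟨r, hr⟩ := heven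
          omega
        dsimp only
        nlinarith
  push Not at hA hB
  obtain ⟨v₀, hv₀⟩ := hA
  obtain ⟨k₀, hk₀⟩ := hB
  obtain ⟨K₀, hK₀⟩ := Option.ne_none_iff_exists'.1 hv₀
  obtain ⟨K₁, hK₁⟩ := Option.ne_none_iff_exists'.1 hk₀
  obtain rfl := hab _ _ _ _ hK₀ hK₁
  have ha' : ∀ v K, a v = some K → K = K₁ := fun v K hv => (hab _ _ _ _ hv hK₁).symm
  have hb' : ∀ k K, b k = some K → K = K₁ := fun k K hk => hab _ _ _ _ hK₀ hk
  have hj := hα ▸ card_filter_some_add_card_filter_none a ha'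
  have hc := hβ ▸ card_filter_some_add_card_filter_none b hb'
  refine ⟨fun K => 2 * #{v ∈ {v | a v = none} | g v = some K} +
      if K = K₁ then (m + 3) * #{k | b k = none} + (m + 1) * #{v | a v = none} else 0,
      ?_, fun K => ⟨fun hodd => ?_, fun heven ⟨v, hv⟩ ⟨u, hu⟩ => ?_⟩⟩
  · rw [Finset.sum_add_distrib, ← Finset.mul_sum, Finset.sum_ite_eq' univ K₁]
    simp only [mem_univ, if_true]
    nlinarith
  · obtain rfl : K = K₁ := by
      rcases Nat.eq_zero_or_pos #{v | a v = some K} with h0 | h0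
      · rw [h0, zero_add] at hodd
        obtain ⟨k, hk⟩ := Finset.card_pos.1 hodd.pos
        exact hb' k K (by simpa using hk)
      · obtain ⟨v, hv⟩ := Finset.card_pos.1 h0
        exact ha' v K (by simpa using hv)
    have h1 : 1 ≤ #{k | b k = none} + #{v | a v = none} := by
      obtain ⟨r, hr⟩ := hodd
      omega
    simp only [if_true]
    refine ⟨by nlinarith, fun hin => ?_, fun hout => absurd (hag _ _ hK₀) (hout v₀)⟩
    have : #{v ∈ {v | a v = none} | g v = some K} = #{v | a v = none} := by simp [hin]
    nlinarith
  · dsimp only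
    split_ifs with hK
    · subst hK
      have hau : a u = none := by
        by_contra hne
        obtain ⟨K', hK'⟩ := Option.ne_none_iff_exists'.1 hne
        exact hu (by rw [hag u K' hK', ha' u K' hK'])
      have h1 : 0 < #{v | a v = none} := Finset.card_pos.2 ⟨u, by simp [hau]⟩
      have h2 : 2 ≤ #{k | b k = none} + #{v | a v = none} := by
        obtain ⟨r, hr⟩ := heven
        omega
      nlinarith
    · have hav : a v = none := by
        by_contra hne
        obtain ⟨K', hK'⟩ := Option.ne_none_iff_exists'.1 hne
        have := (hag v K' hK').symm.trans hv
        rw [ha' v K' hK'] at this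
        exact hK (Option.some.inj this).symm
      have := hdel v K hav hv
      omega

open Classical in
/-- The discharging argument over all edges. -/
lemma card_odd_colours_le {V ι β C : Type*} [Fintype ι] [Fintype β] [Fintype C]
    {E : ι → Finset V} {h : ℕ} (hh : 3 ≤ h) (hunif : ∀ i, (E i).card = h)
    (hconn : EdgeConnected E 2) (hβ : Fintype.card β = h - 2)
    (a : ∀ i, E i → Option C) (b : ι → β → Option C)
    (haa : ∀ i i' (v : E i) (v' : E i') K K', v.1 = v'.1 → a i v = some K → a i' v' = some K' →
      K = K')
    (hab : ∀ i v k K K', a i v = some K → b i k = some K' → K' = K) :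
    #{K | Odd (∑ i, (#{v | a i v = some K} + #{k | b i k = some K}))} ≤
      ∑ i, (#{v | a i v = none} + #{k | b i k = none}) := by
  obtain ⟨g, hg⟩ : ∃ g : V → Option C, ∀ i (v : E i) K, a i v = some K → g v = some K := by
    refine ⟨fun v => if H : ∃ K, ∃ i, ∃ v' : E i, v'.1 = v ∧ a i v' = some K
      then some H.choose else none, fun i v K hK => ?_⟩
    have H : ∃ K, ∃ i, ∃ v' : E i, v'.1 = v ∧ a i v' = some K := ⟨K, i, v, rfl, hK⟩
    obtain ⟨i', v', hv', hK'⟩ := H.choose_spec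
    dsimp only
    rw [dif_pos H, haa i' i v' v _ _ hv' hK' hK]
  choose w hw hwK using fun i => exists_edge_weight hh (α := E i) (by simp [hunif i]) hβ
    (a i) (fun v => g v) (b i) (hg i) (hab i)
  refine Nat.le_of_mul_le_mul_left (c := h) ?_ (by omega)
  rw [Finset.mul_sum]
  refine le_trans ?_ (Finset.sum_le_sum fun i _ => hw i)
  rw [Finset.sum_comm, mul_comm, ← smul_eq_mul]
  refine (Finset.card_nsmul_le_sum _ (fun K => ∑ i, w i K) h fun K hK => ?_).trans
    (Finset.sum_le_sum_of_subset (Finset.subset_univ _))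
  simp only [mem_filter, mem_univ, true_and] at hK
  rw [Finset.odd_sum_iff_odd_card_odd] at hK
  set O : Finset ι := {i | Odd (#{v | a i v = some K} + #{k | b i k = some K})} with hO
  have hmem : ∀ i, i ∈ O ↔ Odd (#{v | a i v = some K} + #{k | b i k = some K}) := fun i => by
    rw [hO, Finset.mem_filter]
    exact and_iff_right (Finset.mem_univ i)
  have hOw : ∀ i ∈ O, h - 2 ≤ w i K := fun i hi => ((hwK i K).1 ((hmem i).1 hi)).1
  rcases Nat.lt_or_ge #O 2 with hlt | hge
  · have h1 : #O = 1 := by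
      have := hK.pos
      omega
    obtain ⟨e, he⟩ := Finset.card_eq_one.1 h1
    have heO : e ∈ O := by simp [he]
    have heodd := (hwK e K).1 ((hmem e).1 heO)
    have hle : w e K ≤ ∑ i, w i K :=
      Finset.single_le_sum (f := fun i => w i K) (fun _ _ => Nat.zero_le _) (Finset.mem_univ e)
    by_cases hin : ∀ v : E e, g v = some K
    · exact (heodd.2.1 hin).trans hle
    by_cases hout : ∀ v : E e, g v ≠ some K
    · exact (heodd.2.2 hout).trans hle
    push Not at hin hout
    obtain ⟨u, hu⟩ := hin
    obtain ⟨v, hv⟩ := hout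
    obtain ⟨e', hne, ⟨x, hx, hgx⟩, y, hy, hgy⟩ :=
      hconn.exists_crossing_edge (fun v => g v = some K) hv hu e
    have he' : e' ∉ O := by simp [he, hne]
    have h2 := (hwK e' K).2 (Nat.not_odd_iff_even.1 (mt (hmem e').2 he'))
      ⟨⟨x, hx⟩, hgx⟩ ⟨⟨y, hy⟩, hgy⟩
    have hpair : ∑ i ∈ {e, e'}, w i K ≤ ∑ i, w i K :=
      Finset.sum_le_sum_of_subset (Finset.subset_univ _)
    rw [Finset.sum_pair hne.symm] at hpair
    have := heodd.1
    omega
  · have h3 : 3 ≤ #O := by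
      obtain ⟨r, hr⟩ := hK
      omega
    have hsum := Finset.card_nsmul_le_sum O (fun i => w i K) (h - 2) hOw
    have hle : ∑ i ∈ O, w i K ≤ ∑ i, w i K :=
      Finset.sum_le_sum_of_subset (Finset.subset_univ _)
    have : 3 * (h - 2) ≤ #O * (h - 2) := Nat.mul_le_mul_right _ h3
    rw [smul_eq_mul] at hsum
    omega

/-- The gadget graph of an `h`-uniform hypergraph: its vertices are the incidences of the
hypergraph and `h - 2` copies of each edge.  Incidences with the same underlying vertex are
adjacent, and each copy of an edge is adjacent to all incidences of that edge. -/
def incidenceGadget {V ι : Type*} (E : ι → Finset V) (h : ℕ) :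
    SimpleGraph ((Σ i, E i) ⊕ (ι × Fin (h - 2))) where
  Adj
    | .inl p, .inl q => p ≠ q ∧ p.2.1 = q.2.1
    | .inl p, .inr k => k.1 = p.1
    | .inr k, .inl p => k.1 = p.1
    | .inr _, .inr _ => False
  symm := ⟨by
    rintro (p | k) (q | l) hpq
    exacts [⟨hpq.1.symm, hpq.2.symm⟩, hpq, hpq, hpq]⟩
  loopless := ⟨by
    rintro (p | k) hp
    exacts [hp.1 rfl, hp]⟩

lemma card_filter_incidenceGadget {V ι β γ : Type*} [Fintype ι] [Fintype β] [DecidableEq γ]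
    {E : ι → Finset V} (f : (Σ i, E i) ⊕ (ι × β) → γ) (c : γ) :
    #{x | f x = c} = ∑ i, (#{v | f (.inl ⟨i, v⟩) = c} + #{k | f (.inr (i, k)) = c}) := by
  simp only [Finset.card_filter]
  rw [Fintype.sum_sum_type, Fintype.sum_sigma, Fintype.sum_prod_type, Finset.sum_add_distrib]

open Classical in
lemma exists_isPerfectMatching_incidenceGadget {V ι : Type*} [Fintype ι]
    {E : ι → Finset V} {h : ℕ} (hh : 3 ≤ h) (hunif : ∀ i, (E i).card = h)
    (hconn : EdgeConnected E 2) :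
    ∃ M : (incidenceGadget E h).Subgraph, M.IsPerfectMatching := by
  rw [SimpleGraph.tutte]
  intro u
  rw [SimpleGraph.IsTutteViolator, not_lt]
  set H := ((⊤ : (incidenceGadget E h).Subgraph).deleteVerts u) with hH
  have hverts : ∀ x, x ∈ H.verts ↔ x ∉ u := by simp [hH]
  let f : (Σ i, E i) ⊕ (ι × Fin (h - 2)) → Option H.coe.ConnectedComponent := fun x =>
    if hx : x ∈ H.verts then some (H.coe.connectedComponentMk ⟨x, hx⟩) else none
  have hfnone : ∀ x, f x = none ↔ x ∈ u := fun x => by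
    simp only [f]
    split_ifs with hx
    · simpa using (hverts x).1 hx
    · simpa [hverts] using hx
  have hfsome : ∀ x K, f x = some K ↔ ∃ hx : x ∈ H.verts, H.coe.connectedComponentMk ⟨x, hx⟩ = K :=
    fun x K => by
      simp only [f]
      split_ifs with hx <;> simp [hx]
  have hadj : ∀ x y K K', (incidenceGadget E h).Adj x y → f x = some K → f y = some K' →
      K = K' := by
    intro x y K K' hxy hx hy
    obtain ⟨hxv, rfl⟩ := (hfsome _ _).1 hx
    obtain ⟨hyv, rfl⟩ := (hfsome _ _).1 hy
    refine SimpleGraph.ConnectedComponent.sound (SimpleGraph.Adj.reachable ?_)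
    rw [SimpleGraph.Subgraph.coe_adj]
    exact SimpleGraph.Subgraph.deleteVerts_adj.2 ⟨trivial, (hverts x).1 hxv, trivial,
      (hverts y).1 hyv, hxy⟩
  have hu : u.ncard = ∑ i, (#{v | f (.inl ⟨i, v⟩) = none} + #{k | f (.inr (i, k)) = none}) := by
    have : u = ({x | f x = none} : Finset _) := by
      ext x
      simp [hfnone]
    rw [this, Set.ncard_coe_finset]
    convert card_filter_incidenceGadget f none
  have hK : ∀ K : H.coe.ConnectedComponent, K.supp.ncard = #{x | f x = some K} := fun K => by
    rw [← Set.ncard_coe_finset, ← Set.ncard_image_of_injective _ Subtype.val_injective]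
    congr 1
    ext x
    simp [hfsome, SimpleGraph.ConnectedComponent.mem_supp_iff]
  have hodd : H.coe.oddComponents.ncard =
      #{K : H.coe.ConnectedComponent | Odd #{x | f x = some K}} := by
    rw [← Set.ncard_coe_finset]
    congr 1
    ext K
    simp [hK]
  rw [hu, hodd]
  simp only [card_filter_incidenceGadget]
  refine card_odd_colours_le hh hunif hconn (by simp) (fun i v => f (.inl ⟨i, v⟩))
    (fun i k => f (.inr (i, k))) (fun i i' v v' K K' hv hK hK' => ?_)
    (fun i v k K K' hK hK' => hadj _ _ _ _ ?_ hK' hK)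
  · by_cases heq : (⟨i, v⟩ : Σ i, E i) = ⟨i', v'⟩
    · have : some K = some K' := by rw [← hK, ← hK', heq]
      exact Option.some.inj this
    · exact hadj (.inl ⟨i, v⟩) (.inl ⟨i', v'⟩) K K' ⟨heq, hv⟩ hK hK'
  · rfl

/-- A set of incidences consisting of two incidences for each edge, whose elements are moreover
paired up at each vertex, decomposes into closed walks.  Here `τ` swaps the two incidences of an
edge and `σ` is the pairing at the vertices. -/
lemma hasEulerFamily_of_involutions_s1 {V ι R : Type*} [Finite R] {E : ι → Finset V}
    (vert : R → V) (edg : R → ι) (hmem : ∀ x, vert x ∈ E (edg x)) (σ τ : Equiv.Perm R)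
    (hσ : ∀ x, σ (σ x) = x) (hτ : ∀ x, τ (τ x) = x) (hσ_ne : ∀ x, σ x ≠ x)
    (hσ_vert : ∀ x, vert (σ x) = vert x) (hτ_edg : ∀ x, edg (τ x) = edg x)
    (hτ_vert : ∀ x, vert (τ x) ≠ vert x) (hsurj : ∀ e, ∃ x, edg x = e)
    (huniq : ∀ x y, edg y = edg x → y = x ∨ y = τ x) : HasEulerFamily E := by
  set π : Equiv.Perm R := σ * τ with hπ
  have hπ_apply : ∀ x, π x = σ (τ x) := fun _ => rfl
  have hσ_inv : σ⁻¹ = σ := inv_eq_of_mul_eq_one_left (Equiv.ext hσ)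
  have hτ_inv : τ⁻¹ = τ := inv_eq_of_mul_eq_one_left (Equiv.ext hτ)
  have hconj : ∀ (k : ℤ) x, τ ((π ^ k) x) = (π ^ (-k)) (τ x) := fun k x => by
    have h1 : τ * π * τ⁻¹ = π⁻¹ := by
      rw [hπ, mul_inv_rev, hσ_inv, hτ_inv, mul_assoc, mul_assoc, Equiv.ext (f := τ * τ) (g := 1) hτ,
        mul_one]
    have h2 : τ * π ^ k = π ^ (-k) * τ := by
      rw [zpow_neg, ← inv_zpow, ← h1, conj_zpow, inv_mul_cancel_right]
    exact DFunLike.congr_fun h2 x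
  have hτ_cycle : ∀ x y, π.SameCycle x y → π.SameCycle (τ x) (τ y) := by
    rintro x _ ⟨k, rfl⟩
    exact ⟨-k, (hconj k x).symm⟩
  have hτ_not : ∀ x, ¬ π.SameCycle x (τ x) := by
    rintro x ⟨k, hk⟩
    rcases Int.even_or_odd' k with ⟨m, rfl | rfl⟩
    · refine hτ_vert ((π ^ m) x) (congrArg vert ?_)
      rw [hconj, ← hk, ← Equiv.Perm.mul_apply, ← zpow_add]
      congr 2
      ring
    · refine hσ_ne ((π ^ (m + 1)) x) ?_
      have h1 : τ ((π ^ (m + 1)) x) = (π ^ m) x := by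
        rw [hconj, ← hk, ← Equiv.Perm.mul_apply, ← zpow_add]
        congr 2
        ring
      have h2 : (π ^ (m + 1)) x = σ (τ ((π ^ m) x)) := by
        rw [← hπ_apply, add_comm, zpow_add, zpow_one, Equiv.Perm.mul_apply]
      rw [← h1, hτ] at h2
      exact h2.symm
  have hper : ∀ x, 0 < Function.minimalPeriod π x := fun x =>
    Function.minimalPeriod_pos_of_mem_periodicPts (π.injective.mem_periodicPts x)
  let W : R → ClosedWalk E := fun x =>
    { len := Function.minimalPeriod π x
      len_pos := hper x
      vtx := fun i => vert (π^[i.val] x)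
      edg := fun i => edg (π^[i.val] x)
      mem_self := fun i => hmem _
      mem_succ := fun i => by
        have : NeZero (Function.minimalPeriod π x) := ⟨(hper x).ne'⟩
        rw [ZMod.val_add, ZMod.val_one_eq_one_mod, Nat.add_mod_mod,
          Function.iterate_mod_minimalPeriod_eq, Function.iterate_succ_apply', hπ_apply, hσ_vert,
          ← hτ_edg]
        exact hmem _
      vtx_ne := fun i => by
        have : NeZero (Function.minimalPeriod π x) := ⟨(hper x).ne'⟩
        rw [ZMod.val_add, ZMod.val_one_eq_one_mod, Nat.add_mod_mod,
          Function.iterate_mod_minimalPeriod_eq, Function.iterate_succ_apply', hπ_apply, hσ_vert]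
        exact (hτ_vert _).symm }
  let Q := Quotient (Equiv.Perm.SameCycle.setoid π)
  let mk : R → Q := Quotient.mk _
  have hmk : ∀ x y, mk x = mk y ↔ π.SameCycle x y := fun x y => Quotient.eq
  let swap : Q → Q := Quotient.map τ hτ_cycle
  obtain ⟨n, ⟨ord⟩⟩ := Finite.exists_equiv_fin Q
  let T := {q : Q // ord q < ord (swap q)}
  obtain ⟨m, ⟨idx⟩⟩ := Finite.exists_equiv_fin T
  let rep : Fin m → R := fun j => (idx.symm j).1.out
  have hrep : ∀ j, mk (rep j) = (idx.symm j).1 := fun j => Quotient.out_eq _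
  let node : ((j : Fin m) × ZMod (W (rep j)).len) → R := fun p => π^[p.2.val] (rep p.1)
  have hnode : ∀ p, mk (node p) = (idx.symm p.1).1 := fun p => by
    rw [← hrep, hmk]
    exact Equiv.Perm.SameCycle.symm ⟨p.2.val, by rw [zpow_natCast, ← Equiv.Perm.iterate_eq_pow]⟩
  have hinj : Function.Injective node := by
    rintro ⟨j, i⟩ ⟨j', i'⟩ heq
    obtain rfl : j = j' := by
      have := (hnode ⟨j, i⟩).symm.trans ((congrArg mk heq).trans (hnode ⟨j', i'⟩))
      exact idx.symm.injective (Subtype.ext this)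
    have : NeZero (W (rep j)).len := ⟨(W (rep j)).len_pos.ne'⟩
    have hval := (Function.iterate_eq_iterate_iff_of_lt_minimalPeriod (ZMod.val_lt i)
      (ZMod.val_lt i')).1 heq
    rw [ZMod.val_injective _ hval]
  have hsurj' : ∀ y, ord (mk y) < ord (swap (mk y)) → ∃ p, node p = y := fun y hy => by
    obtain ⟨j, hj⟩ := idx.symm.surjective ⟨mk y, hy⟩
    have hcyc : π.SameCycle (rep j) y := by rw [← hmk, hrep, hj]
    obtain ⟨k, hk⟩ := hcyc.exists_nat_pow_eq
    refine ⟨⟨j, (k : ZMod (W (rep j)).len)⟩, ?_⟩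
    change π^[((k : ZMod (W (rep j)).len)).val] (rep j) = y
    rw [ZMod.val_natCast, ← hk, ← Equiv.Perm.iterate_eq_pow]
    exact Function.iterate_mod_minimalPeriod_eq
  refine ⟨m, fun j => W (rep j), fun e => ?_⟩
  obtain ⟨x, hxe, hx⟩ : ∃ x, edg x = e ∧ ord (mk x) < ord (swap (mk x)) := by
    obtain ⟨x, hx⟩ := hsurj e
    have hne : ord (mk x) ≠ ord (mk (τ x)) := fun heq =>
      hτ_not x ((hmk _ _).1 (ord.injective heq))
    rcases lt_or_gt_of_ne hne with hlt | hlt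
    · exact ⟨x, hx, hlt⟩
    · refine ⟨τ x, (hτ_edg x).trans hx, ?_⟩
      change ord (mk (τ x)) < ord (mk (τ (τ x)))
      rwa [hτ]
  obtain ⟨p, hp⟩ := hsurj' x hx
  refine ⟨p, (congrArg edg hp).trans hxe, fun p' hp' => hinj ?_⟩
  rw [hp]
  refine (huniq x (node p') (hp'.trans hxe.symm)).resolve_right fun heq => ?_
  have h1 : ord (mk (node p')) < ord (swap (mk (node p'))) := by
    rw [hnode]
    exact (idx.symm p'.1).2
  rw [heq] at h1
  change ord (mk (τ x)) < ord (mk (τ (τ x))) at h1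
  rw [hτ] at h1
  exact lt_asymm h1 hx

lemma hasEulerFamily_of_isPerfectMatching {V ι : Type*} [Fintype ι] {E : ι → Finset V} {h : ℕ}
    (hh : 2 ≤ h) (hunif : ∀ i, (E i).card = h) {M : (incidenceGadget E h).Subgraph}
    (hM : M.IsPerfectMatching) : HasEulerFamily E := by
  classical
  rw [SimpleGraph.Subgraph.isPerfectMatching_iff] at hM
  choose mate hmate hmate_uniq using hM
  have hinvol : ∀ x y, mate x = y → mate y = x := by
    rintro x _ rfl
    exact (hmate_uniq _ _ (hmate x).symm).symm
  have hadj : ∀ x y, mate x = y → (incidenceGadget E h).Adj x y := by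
    rintro x _ rfl
    exact (hmate x).adj_sub
  have hcopy : ∀ e (k : Fin (h - 2)), ∃ v : E e, mate (.inr (e, k)) = .inl ⟨e, v⟩ := fun e k => by
    rcases hx : mate (.inr (e, k)) with ⟨e', v⟩ | k'
    · obtain rfl : e = e' := hadj _ _ hx
      exact ⟨v, rfl⟩
    · exact (hadj _ _ hx).elim
  choose φ hφ using hcopy
  have hφ_inj : ∀ e, Function.Injective (φ e) := fun e k k' hkk' => by
    have h1 := hinvol _ _ (hφ e k)
    rw [hkk', hinvol _ _ (hφ e k')] at h1
    simpa using h1.symm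
  let kept : (Σ i, E i) → Prop := fun p => ∃ q, mate (.inl p) = .inl q
  have hcard : ∀ e, #{v : E e | kept ⟨e, v⟩} = 2 := fun e => by
    have : ({v : E e | kept ⟨e, v⟩} : Finset (E e)) = (univ.image (φ e))ᶜ := by
      ext v
      simp only [mem_filter, mem_univ, true_and, mem_compl, mem_image, kept]
      constructor
      · rintro ⟨q, hq⟩ ⟨k, rfl⟩
        rw [hinvol _ _ (hφ e k)] at hq
        cases hq
      · intro hv
        rcases hx : mate (.inl ⟨e, v⟩) with q | ⟨e', k⟩
        · exact ⟨q, rfl⟩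
        · obtain rfl : e' = e := hadj _ _ hx
          have := (hφ e' k).symm.trans (hinvol _ _ hx)
          exact absurd ⟨k, by simpa using this⟩ hv
    rw [this, Finset.card_compl, Finset.card_image_of_injective _ (hφ_inj e), Finset.card_univ,
      Fintype.card_fin, Fintype.card_coe, hunif]
    omega
  have hother : ∀ p : {p // kept p}, ∃ q : {p // kept p}, q.1.1 = p.1.1 ∧ q.1.2.1 ≠ p.1.2.1 ∧
      ∀ r : {p // kept p}, r.1.1 = p.1.1 → r = p ∨ r = q := by
    rintro ⟨⟨e, v⟩, hv⟩
    obtain ⟨v', hv', hne⟩ := Finset.exists_mem_ne (by rw [hcard e]; omega) v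
    refine ⟨⟨⟨e, v'⟩, (Finset.mem_filter.1 hv').2⟩, rfl, fun heq => hne (Subtype.ext heq), ?_⟩
    rintro ⟨⟨e', w⟩, hw⟩ heq
    obtain rfl : e' = e := heq
    by_contra! H
    have hsub : ({v, v', w} : Finset (E e')) ⊆ ({v : E e' | kept ⟨e', v⟩} : Finset (E e')) := by
      simp only [insert_subset_iff, singleton_subset_iff, mem_filter, mem_univ, true_and]
      exact ⟨hv, (Finset.mem_filter.1 hv').2, hw⟩
    have h3 : #({v, v', w} : Finset (E e')) = 3 := by
      refine Finset.card_eq_three.2 ⟨v, v', w, hne.symm, ?_, ?_, rfl⟩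
      · rintro rfl
        exact H.1 rfl
      · rintro rfl
        exact H.2 rfl
    have := Finset.card_le_card hsub
    rw [hcard, h3] at this
    omega
  choose τ hτ_edg hτ_vert hτ_uniq using hother
  have hτ : Function.Involutive τ := fun p =>
    ((hτ_uniq p _ ((hτ_edg _).trans (hτ_edg p))).resolve_right fun heq =>
      hτ_vert (τ p) (by rw [heq]))
  have hpair : ∀ p : {p // kept p}, ∃ q : {p // kept p}, mate (.inl p.1) = .inl q.1 := by
    rintro ⟨p, q, hq⟩
    exact ⟨⟨q, p, hinvol _ _ hq⟩, hq⟩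
  choose σ hσ_mate using hpair
  have hσ : Function.Involutive σ := fun p => by
    have := (hσ_mate (σ p)).symm.trans (hinvol _ _ (hσ_mate p))
    exact Subtype.ext (Sum.inl.inj this)
  have hσ_adj : ∀ p, p.1 ≠ (σ p).1 ∧ p.1.2.1 = (σ p).1.2.1 := fun p => hadj _ _ (hσ_mate p)
  refine hasEulerFamily_of_involutions_s1 (R := {p // kept p}) (fun p => p.1.2.1) (fun p => p.1.1)
    (fun p => p.1.2.2) hσ.toPerm hτ.toPerm hσ hτ (fun p heq => (hσ_adj p).1 ?_)
    (fun p => (hσ_adj p).2.symm) hτ_edg hτ_vert (fun e => ?_) hτ_uniq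
  · exact congrArg Subtype.val heq.symm
  · obtain ⟨v, hv⟩ := Finset.card_pos.1 (by rw [hcard e]; omega)
    exact ⟨⟨⟨e, v⟩, (Finset.mem_filter.1 hv).2⟩, rfl⟩

/-- Every `2`-edge-connected `h`-uniform hypergraph with `h ≥ 3` is quasi-Eulerian,
i.e. it admits an Euler family. -/
theorem hasEulerFamily_of_two_edgeConnected {V ι : Type*} [Fintype V] [Fintype ι]
    [DecidableEq ι] (E : ι → Finset V) (h : ℕ) (hh : 3 ≤ h)
    (hunif : ∀ i, (E i).card = h) (hconn : EdgeConnected E 2) :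
    HasEulerFamily E := by
  obtain ⟨M, hM⟩ := exists_isPerfectMatching_incidenceGadget hh hunif hconn
  exact hasEulerFamily_of_isPerfectMatching (by omega) hunif hM
end

section
/- Every (n,c,k,μ)-admissible hypergraph 𝒢 with minimum 2-degree δ₂(𝒢) ≥ k has a spanning Euler tour. -/
open Finset

/-- The threshold function `g(c, k, μ)` from the definition of `(n,c,k,μ)`-admissibility:
`g(3,3,μ) = 7`, `g(3,4,μ) = 10`, `g(c,k,μ) = C(k,2) + 1` if `c ≥ 4, k ≤ 2c − 2`,
`g(c,k,μ) = (4c² + k² − 3k + 2)/(4c − 2k + 2)` if `c ≥ 3, 2c − 1 ≤ k ≤ 2c`, and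
`g(c,k,μ) = 2μ(k−1)(2^(k−c−1) − 2^c + 1) + C(k,2) + 1` if `k > 2c`. -/
def gfun (c k μ : ℕ) : ℚ :=
  if c = 3 ∧ k = 3 then 7
  else if c = 3 ∧ k = 4 then 10
  else if 4 ≤ c ∧ k ≤ 2 * c - 2 then (k.choose 2 : ℚ) + 1
  else if 2 * c - 1 ≤ k ∧ k ≤ 2 * c then
    (4 * (c : ℚ) ^ 2 + (k : ℚ) ^ 2 - 3 * (k : ℚ) + 2) / (4 * (c : ℚ) - 2 * (k : ℚ) + 2)
  else 2 * (μ : ℚ) * ((k : ℚ) - 1) * ((2 : ℚ) ^ (k - c - 1) - 2 ^ c + 1) + (k.choose 2 : ℚ) + 1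

/-- An `n`-vertex hypergraph (with edges indexed by `ι`) is `(n,c,k,μ)`-admissible if its
corank is `c ≥ 3`, its rank is `k`, its maximum edge multiplicity is `μ`, and
`n ≥ g(c,k,μ)`. -/
def Admissible {V ι : Type*} [Fintype V] [Fintype ι] [Nonempty ι] [DecidableEq V]
    (E : ι → Finset V) (n c k μ : ℕ) : Prop :=
  Fintype.card V = n ∧
  Finset.univ.inf' Finset.univ_nonempty (fun i => (E i).card) = c ∧
  3 ≤ c ∧
  Finset.univ.sup' Finset.univ_nonempty (fun i => (E i).card) = k ∧
  Finset.univ.sup' Finset.univ_nonempty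
    (fun j => (Finset.univ.filter (fun i => E i = E j)).card) = μ ∧
  gfun c k μ ≤ (n : ℚ)

/-! ### Euler's theorem for multigraphs -/

section Multigraph

variable {V ι : Type*}

/-- The initial vertex of a dart `(i, s)` of the multigraph whose edge `i` joins `a i` and `b i`. -/
def dartSrc (a b : ι → V) (d : ι × Bool) : V := if d.2 then b d.1 else a d.1

/-- The terminal vertex of a dart. -/
def dartTgt (a b : ι → V) (d : ι × Bool) : V := if d.2 then a d.1 else b d.1

/-- The dart `d` ends where the dart `e` starts. -/
def DartAdj (a b : ι → V) (d e : ι × Bool) : Prop := dartTgt a b d = dartSrc a b e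

lemma exists_dart_src_eq (a b : ι → V) {i : ι} {v : V} (h : a i = v ∨ b i = v) :
    ∃ d : ι × Bool, d.1 = i ∧ dartSrc a b d = v := by
  rcases h with h | h
  · exact ⟨(i, false), rfl, by simpa [dartSrc] using h⟩
  · exact ⟨(i, true), rfl, by simpa [dartSrc] using h⟩

variable [DecidableEq V]

lemma single_dartSrc_add_single_dartTgt (a b : ι → V) (d : ι × Bool) :
    (Pi.single (dartSrc a b d) 1 + Pi.single (dartTgt a b d) 1 : V → ZMod 2) =
      Pi.single (a d.1) 1 + Pi.single (b d.1) 1 := by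
  rcases d with ⟨i, s⟩
  cases s <;> simp [dartSrc, dartTgt, add_comm]

lemma sum_single_of_isChain (a b : ι → V) (d : ι × Bool) (l : List (ι × Bool))
    (h : (d :: l).IsChain (DartAdj a b)) :
    ((d :: l).map fun e => (Pi.single (a e.1) 1 + Pi.single (b e.1) 1 : V → ZMod 2)).sum =
      Pi.single (dartSrc a b d) 1 +
        Pi.single (dartTgt a b ((d :: l).getLast (List.cons_ne_nil d l))) 1 := by
  induction l generalizing d with
  | nil => simp [single_dartSrc_add_single_dartTgt]
  | cons e l ih =>
    rw [List.isChain_cons_cons] at h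
    rw [List.map_cons, List.sum_cons, ih e h.2, List.getLast_cons (List.cons_ne_nil e l),
      ← single_dartSrc_add_single_dartTgt, ← h.1]
    have h2 : (Pi.single (dartTgt a b d) 1 + Pi.single (dartTgt a b d) 1 : V → ZMod 2) = 0 :=
      funext fun _ => CharTwo.add_self_eq_zero _
    linear_combination h2

/-- In a connected multigraph with all degrees even, a trail which is not a closed trail
through all edges can be replaced by a longer trail. -/
lemma exists_longer_trail [Fintype ι] (a b : ι → V)
    (heven : ∑ i, (Pi.single (a i) 1 + Pi.single (b i) 1 : V → ZMod 2) = 0)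
    (hconn : ∀ X : Set V, X.Nonempty → (∀ i, a i ∈ X ↔ b i ∈ X) → X = Set.univ)
    (d : ι × Bool) (l : List (ι × Bool))
    (hl : (d :: l).IsChain (DartAdj a b)) (hnd : ((d :: l).map Prod.fst).Nodup)
    (hbad : ¬ ((d :: (l ++ [d])).IsChain (DartAdj a b) ∧ ∀ i, i ∈ (d :: l).map Prod.fst)) :
    ∃ (d' : ι × Bool) (l' : List (ι × Bool)), (d' :: l').IsChain (DartAdj a b) ∧
      ((d' :: l').map Prod.fst).Nodup ∧ l'.length = l.length + 1 := by
  classical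
  by_cases hclosed : dartTgt a b ((d :: l).getLast (List.cons_ne_nil d l)) = dartSrc a b d
  · have hcl : (d :: (l ++ [d])).IsChain (DartAdj a b) := by
      rw [← List.cons_append, List.isChain_append]
      refine ⟨hl, by simp, ?_⟩
      intro x hx y hy
      rw [List.getLast?_eq_getLast_of_ne_nil (List.cons_ne_nil d l)] at hx
      simp only [Option.mem_def, Option.some.injEq, List.head?_cons] at hx hy
      subst hx hy
      exact hclosed
    have hnall : ∃ i, i ∉ (d :: l).map Prod.fst := by
      by_contra! hall
      exact hbad ⟨hcl, hall⟩
    suffices h : ∃ i, i ∉ (d :: l).map Prod.fst ∧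
        ∃ d₀ ∈ d :: l, a i = dartSrc a b d₀ ∨ b i = dartSrc a b d₀ by
      obtain ⟨i, hi, d₀, hd₀, hid₀⟩ := h
      obtain ⟨e, rfl, he⟩ := exists_dart_src_eq a b hid₀
      obtain ⟨l₁, l₂, hsplit⟩ := List.append_of_mem hd₀
      have hrot : (d :: l) ~r (d₀ :: (l₂ ++ l₁)) := by
        rw [hsplit, ← List.cons_append]
        exact List.isRotated_append
      have hperm := hrot.perm
      have hc := (Cycle.chain_coe_cons (DartAdj a b) d l).2 hcl
      rw [Cycle.coe_eq_coe.2 hrot, Cycle.chain_coe_cons, ← List.cons_append,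
        List.isChain_append] at hc
      refine ⟨d₀, l₂ ++ l₁ ++ [e], ?_, ?_, ?_⟩
      · rw [← List.cons_append, List.isChain_append]
        refine ⟨hc.1, by simp, ?_⟩
        intro x hx y hy
        simp only [List.head?_cons, Option.mem_def, Option.some.injEq] at hy
        subst hy
        have := hc.2.2 x hx d₀ (by simp)
        unfold DartAdj at this ⊢
        rw [this, he]
      · rw [← List.cons_append, List.map_append]
        have h1 : ((d₀ :: (l₂ ++ l₁)).map Prod.fst).Nodup :=
          ((hperm.map Prod.fst).nodup_iff).1 hnd
        have h2 : e.1 ∉ (d₀ :: (l₂ ++ l₁)).map Prod.fst := fun h =>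
          hi (((hperm.map Prod.fst).mem_iff).2 h)
        exact List.Nodup.append h1 (by simp) (by simpa using h2)
      · have := hperm.length_eq
        simp at this ⊢
        omega
    by_contra! hno
    have hX : {v | ∃ d₀ ∈ d :: l, v = dartSrc a b d₀} = Set.univ := by
      apply hconn
      · exact ⟨dartSrc a b d, d, by simp, rfl⟩
      · have htgt : ∀ e ∈ d :: l, ∃ d₀ ∈ d :: l, dartTgt a b e = dartSrc a b d₀ := by
          intro e he
          obtain ⟨j, hj, rfl⟩ := List.getElem_of_mem he
          have := List.isChain_iff_getElem.1 hcl j (by simp at hj ⊢; omega)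
          refine ⟨(d :: (l ++ [d]))[j + 1]'(by simp at hj ⊢; omega), ?_, ?_⟩
          · have hm := List.getElem_mem (l := d :: (l ++ [d])) (n := j + 1)
              (by simp at hj ⊢; omega)
            simp only [List.mem_cons, List.mem_append] at hm ⊢
            tauto
          · have hleft : (d :: (l ++ [d]))[j]'(by simp at hj ⊢; omega) = (d :: l)[j] := by
              simp only [← List.cons_append]
              rw [List.getElem_append_left]
            rw [← hleft]
            exact this
        intro i
        by_cases hi : i ∈ (d :: l).map Prod.fst
        · obtain ⟨e, he, rfl⟩ := List.mem_map.1 hi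
          obtain ⟨d₁, hd₁, h₁⟩ := htgt e he
          have hs : ∃ d₀ ∈ d :: l, dartSrc a b e = dartSrc a b d₀ := ⟨e, he, rfl⟩
          have ht : ∃ d₀ ∈ d :: l, dartTgt a b e = dartSrc a b d₀ := ⟨d₁, hd₁, h₁⟩
          rcases e with ⟨i, s⟩
          cases s <;> simp only [dartSrc, dartTgt] at hs ht <;>
            simp only [Set.mem_ofPred_eq, dartSrc] <;> simp_all
        · constructor
          · rintro ⟨d₀, hd₀, h⟩
            exact absurd h (hno i hi d₀ hd₀).1
          · rintro ⟨d₀, hd₀, h⟩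
            exact absurd h (hno i hi d₀ hd₀).2
    obtain ⟨i, hi⟩ := hnall
    have : a i ∈ {v | ∃ d₀ ∈ d :: l, v = dartSrc a b d₀} := by rw [hX]; trivial
    obtain ⟨d₀, hd₀, h⟩ := this
    exact (hno i hi d₀ hd₀).1 h
  · set y := dartTgt a b ((d :: l).getLast (List.cons_ne_nil d l)) with hy
    suffices h : ∃ i, i ∉ (d :: l).map Prod.fst ∧ (a i = y ∨ b i = y) by
      obtain ⟨i, hi, hiy⟩ := h
      obtain ⟨e, rfl, he⟩ := exists_dart_src_eq a b hiy
      refine ⟨d, l ++ [e], ?_, ?_, by simp⟩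
      · rw [← List.cons_append, List.isChain_append]
        refine ⟨hl, by simp, ?_⟩
        intro x hx z hz
        rw [List.getLast?_eq_getLast_of_ne_nil (List.cons_ne_nil d l)] at hx
        simp only [Option.mem_def, Option.some.injEq, List.head?_cons] at hx hz
        subst hx hz
        exact he.symm
      · rw [← List.cons_append, List.map_append]
        exact List.Nodup.append hnd (by simp) (by simpa using hi)
    by_contra! hno
    have h1 := sum_single_of_isChain a b d l hl
    have h2 := List.sum_toFinset
      (fun i => (Pi.single (a i) 1 + Pi.single (b i) 1 : V → ZMod 2)) hnd
    rw [List.map_map] at h2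
    have h3 := congrFun (h2.trans h1) y
    have h4 := congrFun heven y
    rw [Finset.sum_apply] at h3 h4
    rw [Finset.sum_subset (Finset.subset_univ _), h4] at h3
    · rw [← hy] at h3
      simp [hclosed] at h3
    · intro i _ hi
      rw [List.mem_toFinset] at hi
      have := hno i hi
      simp [this.1.symm, this.2.symm]

/-- **Euler's theorem** for multigraphs: a connected multigraph with all degrees even
has a closed trail through all edges. -/
lemma exists_closed_trail [Fintype ι] [Nonempty ι] (a b : ι → V)
    (heven : ∑ i, (Pi.single (a i) 1 + Pi.single (b i) 1 : V → ZMod 2) = 0)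
    (hconn : ∀ X : Set V, X.Nonempty → (∀ i, a i ∈ X ↔ b i ∈ X) → X = Set.univ) :
    ∃ (d : ι × Bool) (l : List (ι × Bool)), (d :: (l ++ [d])).IsChain (DartAdj a b) ∧
      ((d :: l).map Prod.fst).Nodup ∧ ∀ i, i ∈ (d :: l).map Prod.fst := by
  by_contra! hno
  have key : ∀ m : ℕ, ∃ (d : ι × Bool) (l : List (ι × Bool)), (d :: l).IsChain (DartAdj a b) ∧
      ((d :: l).map Prod.fst).Nodup ∧ l.length = m := by
    intro m
    induction m with
    | zero => exact ⟨(Classical.arbitrary ι, false), [], by simp, by simp, rfl⟩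
    | succ m ih =>
      obtain ⟨d, l, hl, hnd, rfl⟩ := ih
      refine exists_longer_trail a b heven hconn d l hl hnd ?_
      rintro ⟨hc, hall⟩
      obtain ⟨i, hi⟩ := hno d l hc hnd
      exact hi (hall i)
  obtain ⟨d, l, -, hnd, hlen⟩ := key (Fintype.card ι)
  have := hnd.length_le_card
  simp at this
  omega

end Multigraph

/-- A choice of two distinct vertices in every hyperedge which forms a connected multigraph
with all degrees even yields a spanning Euler tour. -/
lemma hasSpanningEulerTour_of_multigraph {V ι : Type*} [Fintype ι] [Nonempty ι] [DecidableEq V]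
    [Nontrivial V] (E : ι → Finset V) (a b : ι → V)
    (ha : ∀ i, a i ∈ E i) (hb : ∀ i, b i ∈ E i) (hab : ∀ i, a i ≠ b i)
    (heven : ∑ i, (Pi.single (a i) 1 + Pi.single (b i) 1 : V → ZMod 2) = 0)
    (hconn : ∀ X : Set V, X.Nonempty → (∀ i, a i ∈ X ↔ b i ∈ X) → X = Set.univ) :
    HasSpanningEulerTour E := by
  obtain ⟨d, l, hchain, hnd, hall⟩ := exists_closed_trail a b heven hconn
  have hchain' := List.isChain_iff_getElem.1 hchain
  have hvertex : ∀ v, ∃ i, a i = v ∨ b i = v := by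
    intro v
    by_contra! hno
    have := hconn {v} (Set.singleton_nonempty v) fun i => by simp [hno i]
    obtain ⟨w, hw⟩ := exists_ne v
    have hw' : w ∈ ({v} : Set V) := by rw [this]; trivial
    exact hw hw'
  set L := l.length with hL
  let dart : ZMod (L + 1) → ι × Bool := fun j => (d :: l)[j.val]'(by
    have := ZMod.val_lt j; simp; omega)
  have hsucc : ∀ j, dartTgt a b (dart j) = dartSrc a b (dart (j + 1)) := by
    intro j
    have hj : j.val < L + 1 := ZMod.val_lt j
    have h := hchain' j.val (by simp; omega)
    have hleft : (d :: (l ++ [d]))[j.val]'(by simp; omega) = dart j := by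
      simp only [← List.cons_append]
      rw [List.getElem_append_left]
    have hright : (d :: (l ++ [d]))[j.val + 1]'(by simp; omega) = dart (j + 1) := by
      by_cases hlt : j.val + 1 < L + 1
      · have hv : (j + 1).val = j.val + 1 := by
          rw [ZMod.val_add, ZMod.val_one_eq_one_mod, Nat.add_mod_mod, Nat.mod_eq_of_lt hlt]
        simp only [← List.cons_append]
        rw [List.getElem_append_left (by simp; omega)]
        simp only [dart, hv]
      · have hv : (j + 1).val = 0 := by
          have : j.val + 1 = L + 1 := by omega
          rw [ZMod.val_add, ZMod.val_one_eq_one_mod, Nat.add_mod_mod, this, Nat.mod_self]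
        simp only [dart, hv]
        have : j.val = l.length := by omega
        simp [this]
    rwa [hleft, hright] at h
  have hsrc : ∀ e : ι × Bool, dartSrc a b e ∈ E e.1 := by
    rintro ⟨i, s⟩
    cases s <;> simp [dartSrc, ha, hb]
  have htgt : ∀ e : ι × Bool, dartTgt a b e ∈ E e.1 := by
    rintro ⟨i, s⟩
    cases s <;> simp [dartTgt, ha, hb]
  have hne : ∀ e : ι × Bool, dartSrc a b e ≠ dartTgt a b e := by
    rintro ⟨i, s⟩
    cases s <;> simp [dartSrc, dartTgt, hab, (hab _).symm]
  have hex : ∀ i, ∃ j, (dart j).1 = i := by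
    intro i
    obtain ⟨e, he, rfl⟩ := List.mem_map.1 (hall i)
    obtain ⟨m, hm, rfl⟩ := List.getElem_of_mem he
    refine ⟨(m : ZMod (L + 1)), ?_⟩
    have : ((m : ZMod (L + 1))).val = m := ZMod.val_cast_of_lt (by simpa using hm)
    simp only [dart, this]
  refine ⟨⟨L + 1, Nat.succ_pos L, fun j => dartSrc a b (dart j), fun j => (dart j).1,
    fun j => hsrc _, fun j => ?_, fun j => ?_⟩, ?_, ?_⟩
  · rw [← hsucc]
    exact htgt _
  · rw [← hsucc]
    exact hne _
  · intro i
    obtain ⟨j, hj⟩ := hex i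
    refine ⟨j, hj, ?_⟩
    intro j' hj'
    apply ZMod.val_injective
    have hlt : j.val < L + 1 := ZMod.val_lt j
    have hlt' : j'.val < L + 1 := ZMod.val_lt j'
    refine (List.Nodup.getElem_inj_iff hnd (hi := by simp; omega) (hj := by simp; omega)).1 ?_
    rw [List.getElem_map, List.getElem_map]
    exact hj'.trans hj.symm
  · intro v
    obtain ⟨i, hi⟩ := hvertex v
    obtain ⟨j, rfl⟩ := hex i
    have hv : dartSrc a b (dart j) = v ∨ dartTgt a b (dart j) = v := by
      revert hi
      generalize dart j = e
      rcases e with ⟨i, s⟩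
      cases s <;> simp [dartSrc, dartTgt, or_comm]
    rcases hv with hv | hv
    · exact ⟨j, hv⟩
    · exact ⟨j + 1, (hsucc j).symm.trans hv⟩

/-! ### Correcting parities along a tree -/

lemma exists_parity_correction {V : Type*} [Fintype V] [DecidableEq V] (z : V)
    (p : {v // v ≠ z} → V) (lev : V → ℕ) (hp : ∀ v, lev (p v) < lev v) (T : V → ZMod 2)
    (hT : ∑ v, T v = 0) :
    ∃ β : {v // v ≠ z} → ZMod 2,
      ∑ v, β v • (Pi.single (v : V) 1 + Pi.single (p v) 1 : V → ZMod 2) = T := by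
  rw [← Submodule.mem_span_range_iff_exists_fun]
  set W := Submodule.span (ZMod 2)
    (Set.range fun v : {v // v ≠ z} => (Pi.single (v : V) 1 + Pi.single (p v) 1 : V → ZMod 2))
  have htwo : ∀ v : V, (Pi.single v 1 + Pi.single v 1 : V → ZMod 2) = 0 :=
    fun v => funext fun _ => CharTwo.add_self_eq_zero _
  have key : ∀ (m : ℕ) (v : V), lev v = m →
      (Pi.single v 1 + Pi.single z 1 : V → ZMod 2) ∈ W := by
    intro m
    induction m using Nat.strong_induction_on with
    | _ m ih =>
      rintro v rfl
      by_cases hv : v = z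
      · rw [hv, htwo]
        exact W.zero_mem
      · have h1 := ih _ (hp ⟨v, hv⟩) (p ⟨v, hv⟩) rfl
        have h2 : (Pi.single v 1 + Pi.single (p ⟨v, hv⟩) 1 : V → ZMod 2) ∈ W :=
          Submodule.subset_span ⟨⟨v, hv⟩, rfl⟩
        have h3 := W.add_mem h2 h1
        convert h3 using 1
        linear_combination -htwo (p ⟨v, hv⟩)
  have hsum : T = ∑ v, T v • (Pi.single v 1 + Pi.single z 1 : V → ZMod 2) := by
    simp only [smul_add, Finset.sum_add_distrib, ← Finset.sum_smul, hT, zero_smul, add_zero]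
    ext w
    simp [Finset.sum_apply, Pi.single_apply]
  rw [hsum]
  exact W.sum_mem fun v _ => W.smul_mem _ (key _ v rfl)

/-! ### Systems of distinct representatives -/

/-- A fractional matching saturating `D` gives an injection from `D`. -/
lemma exists_injective_of_weight {D ι : Type*} [Fintype D] [Fintype ι] (w : D → ι → ℚ)
    (hw : ∀ d i, 0 ≤ w d i) (hD : ∀ d, 1 ≤ ∑ i, w d i) (hι : ∀ i, ∑ d, w d i ≤ 1) :
    ∃ f : D → ι, Function.Injective f ∧ ∀ d, w d (f d) ≠ 0 := by
  classical
  have := (Finset.all_card_le_biUnion_card_iff_exists_injective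
    (fun d => Finset.univ.filter fun i => w d i ≠ 0)).1 ?_
  · obtain ⟨f, hf, h⟩ := this
    exact ⟨f, hf, fun d => by simpa using h d⟩
  intro s
  set N := s.biUnion fun d => Finset.univ.filter fun i => w d i ≠ 0 with hN
  have h : (s.card : ℚ) ≤ N.card := calc
    (s.card : ℚ) = ∑ d ∈ s, (1 : ℚ) := by simp
    _ ≤ ∑ d ∈ s, ∑ i, w d i := Finset.sum_le_sum fun d _ => hD d
    _ = ∑ d ∈ s, ∑ i ∈ N, w d i := by
      refine Finset.sum_congr rfl fun d hd => (Finset.sum_subset (Finset.subset_univ _) ?_).symm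
      intro i _ hi
      by_contra hne
      exact hi (Finset.mem_biUnion.2 ⟨d, hd, by simpa using hne⟩)
    _ = ∑ i ∈ N, ∑ d ∈ s, w d i := Finset.sum_comm
    _ ≤ ∑ i ∈ N, ∑ d, w d i := Finset.sum_le_sum fun i _ =>
      Finset.sum_le_sum_of_subset_of_nonneg (Finset.subset_univ _) fun d _ _ => hw d i
    _ ≤ ∑ i ∈ N, (1 : ℚ) := Finset.sum_le_sum fun i _ => hι i
    _ = N.card := by simp
  exact_mod_cast h

/-- Suppose each `d : D` picks a random partner `u` of the vertex `x d`, with probability `q d u`,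
and that every hyperedge is expected to contain at most `k` of the pairs `{x d, u}`. If every pair
lies in at least `k` hyperedges, then there are distinct hyperedges containing such pairs. -/
lemma exists_injective_of_random_pairs {V ι D : Type*} [Fintype V] [DecidableEq V] [Fintype ι]
    [Fintype D] (E : ι → Finset V) (k : ℕ) (hk : 0 < k)
    (hdeg : ∀ u v : V, u ≠ v → k ≤ (Finset.univ.filter fun i => u ∈ E i ∧ v ∈ E i).card)
    (x : D → V) (q : D → V → ℚ) (hq : ∀ d u, 0 ≤ q d u) (hq1 : ∀ d, ∑ u, q d u = 1)
    (hqx : ∀ d, q d (x d) = 0)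
    (hload : ∀ i, ∑ d, (if x d ∈ E i then ∑ u ∈ E i, q d u else 0) ≤ k) :
    ∃ (f : D → ι) (p : D → V), Function.Injective f ∧
      ∀ d, q d (p d) ≠ 0 ∧ x d ∈ E (f d) ∧ p d ∈ E (f d) := by
  classical
  set deg : V → V → ℕ := fun u v => (Finset.univ.filter fun i => u ∈ E i ∧ v ∈ E i).card with hdeg'
  have hkQ : (0 : ℚ) < k := by exact_mod_cast hk
  let w : D → ι → ℚ := fun d i =>
    ∑ u, if x d ∈ E i ∧ u ∈ E i then q d u / deg (x d) u else 0
  have hterm : ∀ d i u, 0 ≤ if x d ∈ E i ∧ u ∈ E i then q d u / deg (x d) u else 0 := by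
    intro d i u
    split_ifs
    · exact div_nonneg (hq d u) (Nat.cast_nonneg _)
    · exact le_rfl
  have hw1 : ∀ d, 1 ≤ ∑ i, w d i := by
    intro d
    rw [← hq1 d, Finset.sum_comm]
    refine Finset.sum_le_sum fun u _ => ?_
    by_cases hu : u = x d
    · rw [hu, hqx]
      simp
    · have hpos : (0 : ℚ) < deg (x d) u := by
        exact_mod_cast hk.trans_le (hdeg _ _ (Ne.symm hu))
      rw [← Finset.sum_filter, Finset.sum_const, nsmul_eq_mul, mul_div_cancel₀ _ hpos.ne']
  have hload1 : ∀ i, ∑ d, w d i ≤ 1 := by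
    intro i
    have : ∀ d, w d i ≤ (if x d ∈ E i then ∑ u ∈ E i, q d u else 0) / k := by
      intro d
      by_cases hx : x d ∈ E i
      · simp only [w, hx, true_and, if_true]
        rw [← Finset.sum_filter, Finset.sum_div]
        have hE : (Finset.univ.filter fun u => u ∈ E i) = E i := by ext; simp
        rw [hE]
        refine Finset.sum_le_sum fun u _ => ?_
        by_cases hu : u = x d
        · rw [hu, hqx]
          simp
        · have := hdeg _ _ (Ne.symm hu)
          have h' : (k : ℚ) ≤ deg (x d) u := by exact_mod_cast this
          exact div_le_div_of_nonneg_left (hq d u) hkQ h'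
      · simp [w, hx]
    calc ∑ d, w d i ≤ ∑ d, (if x d ∈ E i then ∑ u ∈ E i, q d u else 0) / k :=
          Finset.sum_le_sum fun d _ => this d
      _ ≤ 1 := by
          rw [← Finset.sum_div, div_le_one hkQ]
          exact hload i
  obtain ⟨f, hf, h⟩ := exists_injective_of_weight w
    (fun d i => Finset.sum_nonneg fun u _ => hterm d i u) hw1 hload1
  have : ∀ d, ∃ u, q d u ≠ 0 ∧ x d ∈ E (f d) ∧ u ∈ E (f d) := by
    intro d
    obtain ⟨u, -, hu⟩ := Finset.exists_ne_zero_of_sum_ne_zero (h d)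
    rw [ne_eq, ite_eq_right_iff, not_forall] at hu
    obtain ⟨hu, hne⟩ := hu
    exact ⟨u, fun h0 => hne (by simp [h0]), hu⟩
  choose p hp using this
  exact ⟨f, p, hf, hp⟩

/-! ### Two random spanning trees -/

section RandomTree

variable {V : Type*} [Fintype V] [DecidableEq V]

/-- The probability that `v` picks the parent `u` in the random tree with root `z ∈ Z`: vertices
of `Z` pick `z`, vertices of `Z'` pick uniformly outside `Z'`, and all others pick uniformly
in `Z`. -/
def parentWeight (Z Z' : Finset V) (z v u : V) : ℚ :=
  if v ∈ Z then if u = z then 1 else 0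
  else if v ∈ Z' then if u ∉ Z' then 1 / (Z'ᶜ.card : ℚ) else 0
  else if u ∈ Z then 1 / (Z.card : ℚ) else 0

/-- A level function that decreases from a vertex to its parents. -/
def treeLevel (Z Z' : Finset V) (z v : V) : ℕ :=
  if v = z then 0 else if v ∈ Z then 1 else if v ∈ Z' then 3 else 2

lemma parentWeight_nonneg (Z Z' : Finset V) (z v u : V) : 0 ≤ parentWeight Z Z' z v u := by
  unfold parentWeight
  split_ifs <;> positivity

lemma sum_parentWeight {Z Z' : Finset V} {z : V} (hz : z ∈ Z) (hZ : Disjoint Z Z') (v : V) :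
    ∑ u, parentWeight Z Z' z v u = 1 := by
  have h1 : (Z.card : ℚ) ≠ 0 := by exact_mod_cast (Finset.card_pos.2 ⟨z, hz⟩).ne'
  have h2 : (Z'ᶜ.card : ℚ) ≠ 0 := by
    exact_mod_cast (Finset.card_pos.2
      ⟨z, Finset.mem_compl.2 (Finset.disjoint_left.1 hZ hz)⟩).ne'
  unfold parentWeight
  by_cases hv : v ∈ Z
  · simp [hv]
  · by_cases hv' : v ∈ Z'
    · simp only [hv, hv', if_true, if_false]
      rw [← Finset.sum_filter, Finset.sum_const, nsmul_eq_mul]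
      have : (Finset.univ.filter fun u => u ∉ Z') = Z'ᶜ := by ext; simp
      rw [this, mul_one_div_cancel h2]
    · simp only [hv, hv', if_false]
      rw [← Finset.sum_filter, Finset.sum_const, nsmul_eq_mul]
      have : (Finset.univ.filter fun u => u ∈ Z) = Z := by ext; simp
      rw [this, mul_one_div_cancel h1]

lemma treeLevel_lt {Z Z' : Finset V} {z v u : V} (hz : z ∈ Z) (hv : v ≠ z)
    (h : parentWeight Z Z' z v u ≠ 0) : treeLevel Z Z' z u < treeLevel Z Z' z v := by
  unfold parentWeight at h
  unfold treeLevel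
  split_ifs at h ⊢ <;> simp_all

/-- The expected number of pairs of the random tree inside `e`. -/
lemma sum_parentWeight_le {Z Z' : Finset V} {z : V} (hz : z ∈ Z) (hZ : Disjoint Z Z')
    (e : Finset V) (a b c : ℕ) (ha : (e.filter fun v => v ∈ Z).card = a)
    (hb : (e.filter fun v => v ∈ Z').card = b)
    (hc : (e.filter fun v => v ∉ Z ∧ v ∉ Z').card = c) :
    ∑ v : {v // v ≠ z}, (if (v : V) ∈ e then ∑ u ∈ e, parentWeight Z Z' z v u else 0) ≤
      ((a - 1 : ℕ) : ℚ) + b * ((a + c) / (Z'ᶜ.card : ℚ)) + c * (a / (Z.card : ℚ)) := by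
  have hdisj := Finset.disjoint_left.1 hZ
  set g : V → ℚ := fun v => ∑ u ∈ e, parentWeight Z Z' z v u with hg
  have hgZ : ∀ v ∈ Z, g v = if z ∈ e then 1 else 0 := by
    intro v hv
    simp [hg, parentWeight, hv]
  have hgZ' : ∀ v ∈ Z', g v = (a + c) / (Z'ᶜ.card : ℚ) := by
    intro v hv
    have hv' : v ∉ Z := fun h => hdisj h hv
    simp only [hg, parentWeight, hv, hv', if_true, if_false]
    rw [← Finset.sum_filter, Finset.sum_const, nsmul_eq_mul, mul_one_div]
    congr 1
    rw [← ha, ← hc, ← Nat.cast_add, ← Finset.card_union_of_disjoint]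
    · congr 2
      ext u
      have := @hdisj u
      simp only [Finset.mem_filter, Finset.mem_union]
      tauto
    · rw [Finset.disjoint_filter]
      tauto
  have hgM : ∀ v, v ∉ Z → v ∉ Z' → g v = a / (Z.card : ℚ) := by
    intro v hv hv'
    simp only [hg, parentWeight, hv, hv', if_false]
    rw [← Finset.sum_filter, Finset.sum_const, nsmul_eq_mul, mul_one_div, ha]
  have hsum : ∑ v : {v // v ≠ z}, (if (v : V) ∈ e then g v else 0) =
      ∑ v ∈ e.erase z, g v := by
    rw [← Finset.sum_subtype (Finset.univ.erase z) (by simp) fun v => if v ∈ e then g v else 0,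
      ← Finset.sum_filter]
    congr 1
    ext v
    simp
  have hZpart : ∑ v ∈ (e.erase z).filter (fun v => v ∈ Z), g v ≤ ((a - 1 : ℕ) : ℚ) := by
    rw [Finset.sum_congr rfl fun v hv => hgZ v (Finset.mem_filter.1 hv).2, Finset.sum_const]
    by_cases hze : z ∈ e
    · have : (e.erase z).filter (fun v => v ∈ Z) = (e.filter fun v => v ∈ Z).erase z :=
        Finset.filter_erase _ _ _
      rw [this, Finset.card_erase_of_mem (by simp [hze, hz]), ha]
      simp [hze]
    · simp [hze]
  have hZ'part : ∑ v ∈ (e.erase z).filter (fun v => v ∈ Z'), g v =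
      b * ((a + c) / (Z'ᶜ.card : ℚ)) := by
    rw [Finset.sum_congr rfl fun v hv => hgZ' v (Finset.mem_filter.1 hv).2, Finset.sum_const,
      nsmul_eq_mul, ← hb]
    congr 3
    ext v
    simp only [Finset.mem_filter, Finset.mem_erase]
    constructor
    · tauto
    · rintro ⟨h1, h2⟩
      exact ⟨⟨fun h => hdisj hz (h ▸ h2), h1⟩, h2⟩
  have hMpart : ∑ v ∈ (e.erase z).filter (fun v => v ∉ Z ∧ v ∉ Z'), g v =
      c * (a / (Z.card : ℚ)) := by
    rw [Finset.sum_congr rfl fun v hv => hgM v (Finset.mem_filter.1 hv).2.1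
      (Finset.mem_filter.1 hv).2.2, Finset.sum_const, nsmul_eq_mul, ← hc]
    congr 3
    ext v
    simp only [Finset.mem_filter, Finset.mem_erase]
    constructor
    · tauto
    · rintro ⟨h1, h2⟩
      exact ⟨⟨fun h => h2.1 (h ▸ hz), h1⟩, h2⟩
  have hsplit : ∑ v ∈ e.erase z, g v =
      ∑ v ∈ (e.erase z).filter (fun v => v ∈ Z), g v +
        ∑ v ∈ (e.erase z).filter (fun v => v ∈ Z'), g v +
        ∑ v ∈ (e.erase z).filter (fun v => v ∉ Z ∧ v ∉ Z'), g v := by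
    simp only [Finset.sum_filter]
    rw [← Finset.sum_add_distrib, ← Finset.sum_add_distrib]
    refine Finset.sum_congr rfl fun v _ => ?_
    by_cases h1 : v ∈ Z
    · have h2 := hdisj h1
      simp [h1, h2]
    · by_cases h2 : v ∈ Z' <;> simp [h1, h2]
  rw [hsum, hsplit, hZ'part, hMpart]
  linarith

end RandomTree

lemma tree_load_le (a b c k N : ℕ) (hk : 3 ≤ k) (habc : a + b + c ≤ k) (hN : k ^ 2 ≤ 4 * N) :
    (((a - 1 : ℕ) : ℚ) + b * ((a + c) / (N : ℚ)) + c * (a / ((k - 1 : ℕ) : ℚ))) +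
      (((b - 1 : ℕ) : ℚ) + a * ((b + c) / (N : ℚ)) + c * (b / ((k - 1 : ℕ) : ℚ))) ≤ k := by
  have hK : (0 : ℚ) < ((k - 1 : ℕ) : ℚ) := by exact_mod_cast (by omega : 0 < k - 1)
  have hNpos : (0 : ℚ) < N := by
    have : 0 < N := by nlinarith
    exact_mod_cast this
  have hNQ : (k : ℚ) ^ 2 ≤ 4 * N := by exact_mod_cast hN
  have habcQ : (a : ℚ) + b + c ≤ k := by exact_mod_cast habc
  have ha0 : (0 : ℚ) ≤ a := Nat.cast_nonneg a
  have hb0 : (0 : ℚ) ≤ b := Nat.cast_nonneg b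
  have hc0 : (0 : ℚ) ≤ c := Nat.cast_nonneg c
  have hsq : ((a : ℚ) + b + c) ^ 2 ≤ 4 * N :=
    (pow_le_pow_left₀ (by positivity) habcQ 2).trans hNQ
  have hM : (c : ℚ) * (a / ((k - 1 : ℕ) : ℚ)) + c * (b / ((k - 1 : ℕ) : ℚ)) ≤ c := by
    rcases Nat.eq_zero_or_pos c with rfl | hc
    · simp
    · have : (a : ℚ) + b ≤ ((k - 1 : ℕ) : ℚ) := by exact_mod_cast (by omega : a + b ≤ k - 1)
      have h1 : ((a : ℚ) + b) / ((k - 1 : ℕ) : ℚ) ≤ 1 := (div_le_one hK).2 this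
      calc _ = (c : ℚ) * (((a : ℚ) + b) / ((k - 1 : ℕ) : ℚ)) := by ring
        _ ≤ c * 1 := mul_le_mul_of_nonneg_left h1 hc0
        _ = c := mul_one _
  have hX : (b : ℚ) * ((a + c) / (N : ℚ)) + a * ((b + c) / (N : ℚ)) =
      (2 * a * b + c * (a + b)) / N := by ring
  rcases Nat.eq_zero_or_pos a with rfl | ha
  · rcases Nat.eq_zero_or_pos b with rfl | hb
    · simp
    · have hb1 : ((b - 1 : ℕ) : ℚ) = b - 1 := by push_cast [Nat.cast_sub hb]; ring
      have : (b : ℚ) * ((0 + c) / (N : ℚ)) ≤ 1 := by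
        rw [zero_add, ← mul_div_assoc, div_le_one hNpos]
        push_cast at hsq
        nlinarith [sq_nonneg ((b : ℚ) - c)]
      push_cast at hM habcQ ⊢
      simp only [zero_mul, zero_div, mul_zero, zero_add, add_zero]
        at this hM habcQ ⊢
      linarith
  · have ha1 : ((a - 1 : ℕ) : ℚ) = a - 1 := by push_cast [Nat.cast_sub ha]; ring
    rcases Nat.eq_zero_or_pos b with rfl | hb
    · have : (a : ℚ) * ((0 + c) / (N : ℚ)) ≤ 1 := by
        rw [zero_add, ← mul_div_assoc, div_le_one hNpos]
        push_cast at hsq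
        nlinarith [sq_nonneg ((a : ℚ) - c)]
      push_cast at hM habcQ ⊢
      simp only [zero_mul, zero_div, mul_zero, zero_add, add_zero]
        at this hM habcQ ⊢
      linarith
    · have hb1 : ((b - 1 : ℕ) : ℚ) = b - 1 := by push_cast [Nat.cast_sub hb]; ring
      have : (2 * (a : ℚ) * b + c * (a + b)) / N ≤ 2 := by
        rw [div_le_iff₀ hNpos]
        nlinarith [sq_nonneg ((a : ℚ) - b), sq_nonneg (c : ℚ)]
      linarith

lemma le_of_gfun_le {c k μ n : ℕ} (hc : 3 ≤ c) (hck : c ≤ k) (h : gfun c k μ ≤ n) :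
    k ^ 2 + 4 * (k - 1) ≤ 4 * n ∧ 2 * (k - 1) ≤ n := by
  have hcQ : (3 : ℚ) ≤ c := by exact_mod_cast hc
  have hckQ : (c : ℚ) ≤ k := by exact_mod_cast hck
  suffices hQ : (k : ℚ) ^ 2 + 4 * (k - 1) ≤ 4 * n ∧ 2 * ((k : ℚ) - 1) ≤ n by
    have hk : ((k - 1 : ℕ) : ℚ) = k - 1 := by
      rw [Nat.cast_sub (by omega)]
      simp
    rw [← hk] at hQ
    exact_mod_cast hQ
  have hbig : ∀ x : ℚ, 4 ≤ k → (k.choose 2 : ℚ) + 1 ≤ x →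
      (k : ℚ) ^ 2 + 4 * (k - 1) ≤ 4 * x ∧ 2 * ((k : ℚ) - 1) ≤ x := by
    intro x hk hx
    have hkQ : (4 : ℚ) ≤ k := by exact_mod_cast hk
    rw [Nat.cast_choose_two] at hx
    constructor <;> nlinarith
  unfold gfun at h
  split_ifs at h with h1 h2 h3 h4
  · obtain ⟨rfl, rfl⟩ := h1
    push_cast
    constructor <;> linarith
  · obtain ⟨rfl, rfl⟩ := h2
    push_cast
    constructor <;> linarith
  · exact hbig n (by omega) h
  · have hk5 : (5 : ℚ) ≤ k := by exact_mod_cast (by omega : 5 ≤ k)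
    refine hbig n (by omega) (le_trans ?_ h)
    rw [Nat.cast_choose_two]
    obtain hk | hk : k + 1 = 2 * c ∨ k = 2 * c := by omega
    · have hcq : (c : ℚ) = (k + 1) / 2 := by
        have : (k : ℚ) + 1 = 2 * c := by exact_mod_cast hk
        linarith
      rw [hcq, le_div_iff₀ (by linarith)]
      nlinarith
    · have hcq : (c : ℚ) = k / 2 := by
        have : (k : ℚ) = 2 * c := by exact_mod_cast hk
        linarith
      rw [hcq, le_div_iff₀ (by linarith)]
      nlinarith
  · refine hbig n (by omega) (le_trans ?_ h)
    have hpow : (2 : ℚ) ^ c ≤ 2 ^ (k - c - 1) :=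
      pow_le_pow_right₀ (by norm_num) (by omega)
    have : 0 ≤ 2 * (μ : ℚ) * ((k : ℚ) - 1) * ((2 : ℚ) ^ (k - c - 1) - 2 ^ c + 1) := by
      have hk1 : (0 : ℚ) ≤ (k : ℚ) - 1 := by linarith
      have hp : (0 : ℚ) ≤ (2 : ℚ) ^ (k - c - 1) - 2 ^ c + 1 := by linarith
      positivity
    linarith

/-- If two disjoint sets of hyperedges contain the edges of spanning trees, then there is a
spanning Euler tour: the first tree ensures connectivity, and the hyperedges of the second one,
having a third vertex each, are used to correct the parities of the degrees. -/
lemma hasSpanningEulerTour_of_two_trees {V ι : Type*} [Fintype V] [Fintype ι] [Nonempty ι]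
    [DecidableEq V] [Nontrivial V] (E : ι → Finset V) (hE : ∀ i, 3 ≤ (E i).card) (z₁ z₂ : V)
    (f₁ : {v // v ≠ z₁} → ι) (f₂ : {v // v ≠ z₂} → ι) (p₁ : {v // v ≠ z₁} → V)
    (p₂ : {v // v ≠ z₂} → V) (lev₁ lev₂ : V → ℕ)
    (hf₁ : Function.Injective f₁) (hf₂ : Function.Injective f₂) (hf : ∀ u v, f₁ u ≠ f₂ v)
    (hlev₁ : ∀ v, lev₁ (p₁ v) < lev₁ v) (hlev₂ : ∀ v, lev₂ (p₂ v) < lev₂ v)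
    (hmem₁ : ∀ v, (v : V) ∈ E (f₁ v) ∧ p₁ v ∈ E (f₁ v))
    (hmem₂ : ∀ v, (v : V) ∈ E (f₂ v) ∧ p₂ v ∈ E (f₂ v)) :
    HasSpanningEulerTour E := by
  classical
  have hne₁ : ∀ v : {v // v ≠ z₁}, (v : V) ≠ p₁ v := fun v h => (hlev₁ v).ne (congrArg lev₁ h.symm)
  have hstart : ∀ i, ∃ ab : V × V, ab.1 ∈ E i ∧ ab.2 ∈ E i ∧ ab.1 ≠ ab.2 ∧
      (∀ v, i = f₁ v → ab.1 = v ∧ ab.2 = p₁ v) ∧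
      (∀ v, i = f₂ v → ab.1 ≠ p₂ v ∧ ab.2 = v) := by
    intro i
    by_cases h₁ : ∃ v, i = f₁ v
    · obtain ⟨v, rfl⟩ := h₁
      refine ⟨(v, p₁ v), (hmem₁ v).1, (hmem₁ v).2, hne₁ v, fun w hw => ?_,
        fun w hw => absurd hw (hf v w)⟩
      rw [hf₁ hw]
      exact ⟨rfl, rfl⟩
    · by_cases h₂ : ∃ v, i = f₂ v
      · obtain ⟨v, rfl⟩ := h₂
        have hpos : 0 < (((E (f₂ v)).erase v).erase (p₂ v)).card := by
          have h1 := Finset.pred_card_le_card_erase (s := E (f₂ v)) (a := (v : V))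
          have h2 := Finset.pred_card_le_card_erase (s := (E (f₂ v)).erase v) (a := p₂ v)
          have h3 := hE (f₂ v)
          omega
        obtain ⟨x, hx⟩ := Finset.card_pos.1 hpos
        simp only [Finset.mem_erase] at hx
        refine ⟨(x, v), hx.2.2, (hmem₂ v).1, hx.2.1, fun w hw => absurd ⟨w, hw⟩ h₁,
          fun w hw => ?_⟩
        rw [← hf₂ hw]
        exact ⟨hx.1, rfl⟩
      · obtain ⟨x, hx, y, hy, hxy⟩ := Finset.one_lt_card.1 (lt_of_lt_of_le (by norm_num) (hE i))
        exact ⟨(x, y), hx, hy, hxy, fun w hw => absurd ⟨w, hw⟩ h₁,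
          fun w hw => absurd ⟨w, hw⟩ h₂⟩
  choose ab hab₁ hab₂ hab hT₁ hT₂ using hstart
  set T : V → ZMod 2 := ∑ i, (Pi.single (ab i).1 1 + Pi.single (ab i).2 1) with hT
  have hTsum : ∑ v, T v = 0 := by
    simp only [hT, Finset.sum_apply, Pi.add_apply]
    rw [Finset.sum_comm]
    refine Finset.sum_eq_zero fun i _ => ?_
    rw [Finset.sum_add_distrib]
    simp only [Pi.single_apply, Finset.sum_ite_eq', Finset.mem_univ, if_true]
    exact CharTwo.add_self_eq_zero _
  obtain ⟨β, hβ⟩ := exists_parity_correction z₂ p₂ lev₂ hlev₂ T hTsum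
  have hswitch : ∀ i, ∃ b : V, (∀ v, i = f₂ v → b = if β v = 0 then (v : V) else p₂ v) ∧
      (i ∉ Set.range f₂ → b = (ab i).2) := by
    intro i
    by_cases h : ∃ v, f₂ v = i
    · obtain ⟨v, rfl⟩ := h
      refine ⟨if β v = 0 then (v : V) else p₂ v, fun w hw => ?_, fun h => absurd ⟨v, rfl⟩ h⟩
      rw [hf₂ hw]
    · exact ⟨(ab i).2, fun v hv => absurd ⟨v, hv.symm⟩ h, fun _ => rfl⟩
  choose b hb₂ hb using hswitch
  refine hasSpanningEulerTour_of_multigraph E (fun i => (ab i).1) b hab₁ ?_ ?_ ?_ ?_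
  · intro i
    by_cases h : i ∈ Set.range f₂
    · obtain ⟨v, rfl⟩ := h
      rw [hb₂ _ v rfl]
      split_ifs
      exacts [(hmem₂ v).1, (hmem₂ v).2]
    · rw [hb i h]
      exact hab₂ i
  · intro i
    by_cases h : i ∈ Set.range f₂
    · obtain ⟨v, rfl⟩ := h
      rw [hb₂ _ v rfl]
      have h1 := hT₂ _ v rfl
      split_ifs
      · rw [← h1.2]
        exact hab _
      · exact h1.1
    · rw [hb i h]
      exact hab i
  · have hdiff : ∑ v, β v • (Pi.single (v : V) 1 + Pi.single (p₂ v) 1 : V → ZMod 2) =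
        ∑ i, (Pi.single (b i) 1 - Pi.single (ab i).2 1) := by
      refine Fintype.sum_of_injective f₂ hf₂ _ _ (fun i hi => ?_) fun v => ?_
      · rw [hb i hi, sub_self]
      · rw [hb₂ _ v rfl, (hT₂ _ v rfl).2]
        split_ifs with h0
        · rw [h0, zero_smul, sub_self]
        · have h1 : β v = 1 := by
            revert h0
            generalize β v = t
            revert t
            decide
          rw [h1, one_smul]
          have h2 : (Pi.single (v : V) 1 + Pi.single (v : V) 1 : V → ZMod 2) = 0 :=
            funext fun _ => CharTwo.add_self_eq_zero _
          linear_combination h2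
    have hTT : T + T = 0 := funext fun _ => CharTwo.add_self_eq_zero _
    rw [hβ, Finset.sum_sub_distrib] at hdiff
    rw [Finset.sum_add_distrib] at hT ⊢
    linear_combination hTT - hdiff - hT
  · intro X hX hclosed
    have hedge : ∀ v : {v // v ≠ z₁}, (v : V) ∈ X ↔ p₁ v ∈ X := by
      intro v
      have h := hclosed (f₁ v)
      have hnot : f₁ v ∉ Set.range f₂ := fun ⟨w, hw⟩ => hf v w hw.symm
      rwa [hb _ hnot, (hT₁ _ v rfl).1, (hT₁ _ v rfl).2] at h
    have hroot : ∀ (m : ℕ) (v : V), lev₁ v = m → (v ∈ X ↔ z₁ ∈ X) := by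
      intro m
      induction m using Nat.strong_induction_on with
      | _ m ih =>
        rintro v rfl
        by_cases hv : v = z₁
        · rw [hv]
        · exact (hedge ⟨v, hv⟩).trans (ih _ (hlev₁ ⟨v, hv⟩) _ rfl)
    obtain ⟨x, hx⟩ := hX
    exact Set.eq_univ_of_forall fun v => (hroot _ v rfl).2 ((hroot _ x rfl).1 hx)

/-- There is a spanning Euler tour if every pair of vertices lies in at least `k` hyperedges,
where `k` bounds the sizes of the hyperedges and is small compared to the number of vertices. -/
lemma hasSpanningEulerTour_of_codegree {V ι : Type*} [Fintype V] [Fintype ι] [Nonempty ι]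
    [DecidableEq V] (E : ι → Finset V) (k : ℕ) (hk : 3 ≤ k) (hE : ∀ i, 3 ≤ (E i).card)
    (hEk : ∀ i, (E i).card ≤ k) (hV : k ^ 2 + 4 * (k - 1) ≤ 4 * Fintype.card V)
    (hV' : 2 * (k - 1) ≤ Fintype.card V)
    (hdeg : ∀ u v : V, u ≠ v → k ≤ (Finset.univ.filter fun i => u ∈ E i ∧ v ∈ E i).card) :
    HasSpanningEulerTour E := by
  classical
  obtain ⟨Z, -, hZ⟩ := Finset.exists_subset_card_eq (s := (Finset.univ : Finset V)) hV'
  obtain ⟨Z₁, hZ₁, hcard₁⟩ := Finset.exists_subset_card_eq (s := Z) (n := k - 1) (by omega)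
  set Z₂ := Z \ Z₁ with hZ₂
  have hcard₂ : Z₂.card = k - 1 := by
    rw [hZ₂, Finset.card_sdiff_of_subset hZ₁]
    omega
  have hdisj : Disjoint Z₁ Z₂ := Finset.disjoint_sdiff
  obtain ⟨z₁, hz₁⟩ := Finset.card_pos.1 (show 0 < Z₁.card by omega)
  obtain ⟨z₂, hz₂⟩ := Finset.card_pos.1 (show 0 < Z₂.card by omega)
  have : Nontrivial V := Fintype.one_lt_card_iff_nontrivial.1 (by omega)
  have hself₁ : ∀ v : {v // v ≠ z₁}, parentWeight Z₁ Z₂ z₁ v v = 0 := fun v => by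
    by_contra h
    exact lt_irrefl _ (treeLevel_lt hz₁ v.2 h)
  have hself₂ : ∀ v : {v // v ≠ z₂}, parentWeight Z₂ Z₁ z₂ v v = 0 := fun v => by
    by_contra h
    exact lt_irrefl _ (treeLevel_lt hz₂ v.2 h)
  obtain ⟨f, p, hf, hp⟩ := exists_injective_of_random_pairs (D := {v // v ≠ z₁} ⊕ {v // v ≠ z₂})
    E k (by omega) hdeg (Sum.elim (fun v => v) fun v => v)
    (Sum.elim (fun v => parentWeight Z₁ Z₂ z₁ v) fun v => parentWeight Z₂ Z₁ z₂ v)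
    (by rintro (v | v) u <;> exact parentWeight_nonneg _ _ _ _ _)
    (by
      rintro (v | v)
      exacts [sum_parentWeight hz₁ hdisj v, sum_parentWeight hz₂ hdisj.symm v])
    (by
      rintro (v | v)
      exacts [hself₁ v, hself₂ v])
    (by
      intro i
      rw [Fintype.sum_sum_type]
      simp only [Sum.elim_inl, Sum.elim_inr]
      have hsplit : ((E i).filter fun v => v ∈ Z₁).card + ((E i).filter fun v => v ∈ Z₂).card +
          ((E i).filter fun v => v ∉ Z₁ ∧ v ∉ Z₂).card ≤ k := by
        refine le_trans (le_of_eq ?_) (hEk i)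
        simp only [Finset.card_filter]
        rw [← Finset.sum_add_distrib, ← Finset.sum_add_distrib, Finset.card_eq_sum_ones]
        refine Finset.sum_congr rfl fun v _ => ?_
        by_cases h1 : v ∈ Z₁
        · simp [h1, Finset.disjoint_left.1 hdisj h1]
        · by_cases h2 : v ∈ Z₂ <;> simp [h1, h2]
      have h1 := sum_parentWeight_le hz₁ hdisj (E i) _ _ _ rfl rfl rfl
      have h2 := sum_parentWeight_le hz₂ hdisj.symm (E i) _ _
        ((E i).filter fun v => v ∉ Z₁ ∧ v ∉ Z₂).card rfl rfl (by simp only [and_comm])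
      rw [Finset.card_compl, hcard₂, hcard₁] at h1
      rw [Finset.card_compl, hcard₂, hcard₁] at h2
      exact (add_le_add h1 h2).trans
        (tree_load_le _ _ _ k (Fintype.card V - (k - 1)) hk hsplit (by omega)))
  exact hasSpanningEulerTour_of_two_trees E hE z₁ z₂ (f ∘ Sum.inl) (f ∘ Sum.inr) (p ∘ Sum.inl)
    (p ∘ Sum.inr) (treeLevel Z₁ Z₂ z₁) (treeLevel Z₂ Z₁ z₂) (hf.comp Sum.inl_injective)
    (hf.comp Sum.inr_injective) (fun u v h => Sum.inl_ne_inr (hf h))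
    (fun v => treeLevel_lt hz₁ v.2 (hp (Sum.inl v)).1)
    (fun v => treeLevel_lt hz₂ v.2 (hp (Sum.inr v)).1)
    (fun v => (hp (Sum.inl v)).2) (fun v => (hp (Sum.inr v)).2)

/-- **Theorem 1.4(i).** Every `(n,c,k,μ)`-admissible hypergraph with minimum `2`-degree
`δ₂(𝒢) ≥ k` has a spanning Euler tour. -/
theorem hasSpanningEulerTour_of_admissible_deg2 {V ι : Type*} [Fintype V] [Fintype ι]
    [Nonempty ι] [DecidableEq V] (E : ι → Finset V) (n c k μ : ℕ)
    (hadm : Admissible E n c k μ)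
    (hdeg : ∀ T : Finset V, T.card = 2 →
      k ≤ (Finset.univ.filter (fun i => T ⊆ E i)).card) :
    HasSpanningEulerTour E := by
  obtain ⟨rfl, hcrk, hc, hrk, -, hg⟩ := hadm
  have hlow : ∀ i, c ≤ (E i).card := fun i =>
    hcrk ▸ Finset.inf'_le (fun i => (E i).card) (Finset.mem_univ i)
  have hupp : ∀ i, (E i).card ≤ k := fun i =>
    hrk ▸ Finset.le_sup' (fun i => (E i).card) (Finset.mem_univ i)
  have hck : c ≤ k := (hlow (Classical.arbitrary ι)).trans (hupp _)
  obtain ⟨h1, h2⟩ := le_of_gfun_le hc hck hg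
  refine hasSpanningEulerTour_of_codegree E k (hc.trans hck) (fun i => hc.trans (hlow i)) hupp
    h1 h2 fun u v huv => ?_
  simpa [Finset.insert_subset_iff] using hdeg {u, v} (Finset.card_pair huv)
end

section
/- Every (n,c,k,μ)-admissible hypergraph 𝒢 with minimum 3-degree δ₃(𝒢) ≥ 1 and n ≥ k²−3k+5 has a spanning Euler tour. -/
open Finset

section MultigraphEuler

variable {V ι : Type*} {a b : ι → V}

/-- In the multigraph whose edge `i` joins `a i` and `b i`, the list of edges is the edge
sequence of a walk between the two given vertices. -/
def IsEdgeWalk (a b : ι → V) : V → List ι → V → Prop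
  | u, [], w => u = w
  | u, i :: l, w => ∃ x, (a i = u ∧ b i = x ∨ a i = x ∧ b i = u) ∧ IsEdgeWalk a b x l w

theorem isEdgeWalk_append {l₁ l₂ : List ι} {u w : V} :
    IsEdgeWalk a b u (l₁ ++ l₂) w ↔ ∃ x, IsEdgeWalk a b u l₁ x ∧ IsEdgeWalk a b x l₂ w := by
  induction l₁ generalizing u with
  | nil => simp [IsEdgeWalk]
  | cons i l ih =>
    simp only [List.cons_append, IsEdgeWalk, ih]
    constructor
    · rintro ⟨x, hx, y, h1, h2⟩
      exact ⟨y, ⟨x, hx, h1⟩, h2⟩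
    · rintro ⟨y, ⟨x, hx, h1⟩, h2⟩
      exact ⟨x, hx, y, h1, h2⟩

/-- A closed walk can be rotated so as to start at an end of any of its edges. -/
theorem IsEdgeWalk.exists_rotate {l : List ι} {u p : V} {i : ι} (h : IsEdgeWalk a b u l u)
    (hi : i ∈ l) (hp : a i = p ∨ b i = p) : ∃ l', l'.Perm l ∧ IsEdgeWalk a b p l' p := by
  obtain ⟨l₁, l₂, rfl⟩ := List.append_of_mem hi
  obtain ⟨x, h1, y, hxy, h2⟩ := isEdgeWalk_append.1 h
  by_cases hpx : p = x
  · subst hpx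
    exact ⟨(i :: l₂) ++ l₁, List.perm_append_comm, isEdgeWalk_append.2 ⟨u, ⟨y, hxy, h2⟩, h1⟩⟩
  · have hpy : p = y := by grind
    subst hpy
    refine ⟨l₂ ++ (l₁ ++ [i]), ?_, isEdgeWalk_append.2 ⟨u, h2, isEdgeWalk_append.2
      ⟨x, h1, p, hxy, rfl⟩⟩⟩
    have := List.perm_append_comm (l₁ := l₂) (l₂ := l₁ ++ [i])
    simpa using this

theorem IsEdgeWalk.even_count [DecidableEq V] {l : List ι} {u w : V} (h : IsEdgeWalk a b u l w)
    (x : V) : Even (l.countP (fun i => a i = x) + l.countP (fun i => b i = x) +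
      (if u = x then 1 else 0) + (if w = x then 1 else 0)) := by
  induction l generalizing u with
  | nil =>
    obtain rfl : u = w := h
    split_ifs <;> simp
  | cons i l ih =>
    obtain ⟨y, hy, h'⟩ := h
    have := ih h'
    simp only [List.countP_cons, decide_eq_true_eq]
    rcases hy with ⟨rfl, rfl⟩ | ⟨rfl, rfl⟩ <;> grind

theorem IsEdgeWalk.exists_vertices {l : List ι} {u w : V} (h : IsEdgeWalk a b u l w) :
    ∃ f : ℕ → V, f 0 = u ∧ f l.length = w ∧ ∀ j (hj : j < l.length),
      a l[j] = f j ∧ b l[j] = f (j + 1) ∨ a l[j] = f (j + 1) ∧ b l[j] = f j := by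
  induction l generalizing u with
  | nil => exact ⟨fun _ => u, rfl, h, by simp⟩
  | cons i l ih =>
    obtain ⟨y, hy, h'⟩ := h
    obtain ⟨f, h0, hl, hf⟩ := ih h'
    refine ⟨fun j => j.casesOn u f, rfl, hl, ?_⟩
    rintro (_ | j) hj
    · simpa [h0] using hy
    · simpa using hf j (by simpa using hj)

theorem countP_eq_card_filter [Fintype ι] {l : List ι} (hl : l.Nodup)
    (P : ι → Prop) [DecidablePred P] (h : ∀ i, P i → i ∈ l) :
    l.countP (fun i => P i) = (univ.filter P).card := by
  classical
  rw [List.countP_eq_length_filter, ← List.toFinset_card_of_nodup (hl.filter _)]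
  congr 1
  ext i
  simpa using h i

/-- An edge walk repeating no edge whose ends differ can be prolonged at its start, in a
multigraph all of whose degrees are even. -/
theorem IsEdgeWalk.exists_unused_of_ne [DecidableEq V] [Fintype ι] {l : List ι} {u w : V}
    (h : IsEdgeWalk a b u l w) (hl : l.Nodup) (huw : u ≠ w)
    (heven : ∀ v, Even ((univ.filter (fun i => a i = v)).card +
      (univ.filter (fun i => b i = v)).card)) :
    ∃ i, i ∉ l ∧ (a i = u ∨ b i = u) := by
  by_contra! hcon
  have h1 := countP_eq_card_filter hl (fun i => a i = u) (by grind)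
  have h2 := countP_eq_card_filter hl (fun i => b i = u) (by grind)
  have h3 := h.even_count u
  have h4 := heven u
  rw [h1, h2] at h3
  grind

theorem IsEdgeWalk.exists_longer_of_closed [Fintype ι] {l : List ι} {u : V}
    (h : IsEdgeWalk a b u l u) (hl : l.Nodup) (hlen : l.length < Fintype.card ι)
    (hconn : ∀ p q, Relation.ReflTransGen
      (fun p q => ∃ i, a i = p ∧ b i = q ∨ a i = q ∧ b i = p) p q) :
    ∃ l' p i, l'.Perm l ∧ IsEdgeWalk a b p l' p ∧ i ∉ l ∧ (a i = p ∨ b i = p) := by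
  classical
  obtain ⟨j, hj⟩ : ∃ j, j ∉ l := by
    by_contra! hall
    have : (univ : Finset ι) ⊆ l.toFinset := fun i _ => by simpa using hall i
    have := card_le_card this
    rw [List.toFinset_card_of_nodup hl, card_univ] at this
    omega
  have key : ∀ p, Relation.ReflTransGen
      (fun p q => ∃ i, a i = p ∧ b i = q ∨ a i = q ∧ b i = p) u p →
      (∃ i p, i ∉ l ∧ (a i = p ∨ b i = p) ∧ (p = u ∨ ∃ i ∈ l, a i = p ∨ b i = p)) ∨
      (p = u ∨ ∃ i ∈ l, a i = p ∨ b i = p) := by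
    intro p hp
    induction hp with
    | refl => exact Or.inr (Or.inl rfl)
    | tail _ hst ih =>
      obtain ⟨i, hi⟩ := hst
      rcases ih with ih | ih
      · exact Or.inl ih
      · by_cases hil : i ∈ l
        · exact Or.inr (Or.inr ⟨i, hil, by grind⟩)
        · exact Or.inl ⟨i, _, hil, by grind, ih⟩
  obtain ⟨i, p, hil, hip, hp⟩ : ∃ i p, i ∉ l ∧ (a i = p ∨ b i = p) ∧
      (p = u ∨ ∃ i ∈ l, a i = p ∨ b i = p) := by
    rcases key (a j) (hconn _ _) with h | h
    · exact h
    · exact ⟨j, a j, hj, Or.inl rfl, h⟩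
  rcases hp with rfl | ⟨i', hi', hp⟩
  · exact ⟨l, p, i, List.Perm.refl _, h, hil, hip⟩
  · obtain ⟨l', hperm, hw⟩ := h.exists_rotate hi' hp
    exact ⟨l', p, i, hperm, hw, hil, hip⟩

/-- Euler's theorem: a connected finite multigraph with all degrees even has a closed walk
using every edge exactly once. -/
theorem exists_closed_edgeWalk [DecidableEq V] [Nonempty V] [Fintype ι]
    (heven : ∀ v, Even ((univ.filter (fun i => a i = v)).card +
      (univ.filter (fun i => b i = v)).card))
    (hconn : ∀ p q, Relation.ReflTransGen
      (fun p q => ∃ i, a i = p ∧ b i = q ∨ a i = q ∧ b i = p) p q) :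
    ∃ u l, IsEdgeWalk a b u l u ∧ l.Nodup ∧ ∀ i, i ∈ l := by
  classical
  have key : ∀ m ≤ Fintype.card ι, ∃ u l w, IsEdgeWalk a b u l w ∧ l.Nodup ∧ l.length = m := by
    intro m
    induction m with
    | zero => exact fun _ => ⟨Classical.arbitrary V, [], _, rfl, List.nodup_nil, rfl⟩
    | succ m ih =>
      intro hm
      obtain ⟨u, l, w, hw, hl, rfl⟩ := ih (by omega)
      obtain ⟨l', p, q, i, hperm, hw', hil, hip⟩ : ∃ l' p q i, l'.Perm l ∧
          IsEdgeWalk a b p l' q ∧ i ∉ l ∧ (a i = p ∨ b i = p) := by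
        by_cases huw : u = w
        · subst huw
          obtain ⟨l', p, i, h⟩ := hw.exists_longer_of_closed hl hm hconn
          exact ⟨l', p, p, i, h⟩
        · obtain ⟨i, h⟩ := hw.exists_unused_of_ne hl huw heven
          exact ⟨l, u, w, i, List.Perm.refl _, hw, h⟩
      have hnd : (i :: l').Nodup :=
        List.nodup_cons.2 ⟨fun h => hil (hperm.mem_iff.1 h), hperm.nodup_iff.2 hl⟩
      rcases hip with hip | hip
      · exact ⟨b i, i :: l', q, ⟨p, Or.inr ⟨hip, rfl⟩, hw'⟩, hnd, by simp [hperm.length_eq]⟩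
      · exact ⟨a i, i :: l', q, ⟨p, Or.inl ⟨rfl, hip⟩, hw'⟩, hnd, by simp [hperm.length_eq]⟩
  obtain ⟨u, l, w, hw, hl, hlen⟩ := key _ le_rfl
  have hall : ∀ i, i ∈ l := by
    have : l.toFinset = univ := by
      rw [← card_eq_iff_eq_univ, List.toFinset_card_of_nodup hl, hlen]
    intro i
    exact List.mem_toFinset.1 (this ▸ mem_univ i)
  obtain rfl : u = w := by
    by_contra huw
    obtain ⟨i, hi, -⟩ := hw.exists_unused_of_ne hl huw heven
    exact hi (hall i)
  exact ⟨u, l, hw, hl, hall⟩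

/-- A choice of two vertices from each edge of a hypergraph that yields a connected multigraph
with all degrees even gives a spanning Euler tour. -/
theorem hasSpanningEulerTour_of_even_connected [DecidableEq V] [Nontrivial V] [Fintype ι]
    {E : ι → Finset V} (ha : ∀ i, a i ∈ E i) (hb : ∀ i, b i ∈ E i) (hab : ∀ i, a i ≠ b i)
    (heven : ∀ v, Even ((univ.filter (fun i => a i = v)).card +
      (univ.filter (fun i => b i = v)).card))
    (hconn : ∀ p q, Relation.ReflTransGen
      (fun p q => ∃ i, a i = p ∧ b i = q ∨ a i = q ∧ b i = p) p q) :
    HasSpanningEulerTour E := by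
  obtain ⟨u, l, hw, hl, hall⟩ := exists_closed_edgeWalk heven hconn
  obtain ⟨f, h0, hlast, hf⟩ := hw.exists_vertices
  have hinc : ∀ v, ∃ i, a i = v ∨ b i = v := by
    intro v
    obtain ⟨q, hq⟩ := exists_ne v
    rcases (hconn v q).cases_head with h | ⟨c, ⟨i, hi⟩, -⟩
    · exact absurd h.symm hq
    · exact ⟨i, by grind⟩
  have hpos : 0 < l.length := by
    obtain ⟨i, -⟩ := hinc u
    exact List.length_pos_of_mem (hall i)
  have : NeZero l.length := ⟨hpos.ne'⟩
  have hsucc : ∀ j : ZMod l.length, f (j + 1).val = f (j.val + 1) := by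
    intro j
    have hj := ZMod.val_lt j
    have hcast : ((j.val + 1 : ℕ) : ZMod l.length) = j + 1 := by simp
    rw [← hcast, ZMod.val_natCast]
    rcases Nat.lt_or_ge (j.val + 1) l.length with h | h
    · rw [Nat.mod_eq_of_lt h]
    · have h' : j.val + 1 = l.length := by omega
      rw [h', Nat.mod_self, h0, hlast]
  have hstep : ∀ j : ZMod l.length,
      a (l[j.val]'(ZMod.val_lt j)) = f j.val ∧ b (l[j.val]'(ZMod.val_lt j)) = f (j + 1).val ∨
      a (l[j.val]'(ZMod.val_lt j)) = f (j + 1).val ∧ b (l[j.val]'(ZMod.val_lt j)) = f j.val := by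
    intro j
    rw [hsucc]
    exact hf _ _
  have hidx : ∀ i, ∃ j : ZMod l.length, l[j.val]'(ZMod.val_lt j) = i := by
    intro i
    obtain ⟨j, hj, rfl⟩ := List.getElem_of_mem (hall i)
    exact ⟨(j : ZMod l.length), by simp [ZMod.val_natCast, Nat.mod_eq_of_lt hj]⟩
  let W : ClosedWalk E :=
    { len := l.length
      len_pos := hpos
      vtx := fun j => f j.val
      edg := fun j => l[j.val]'(ZMod.val_lt j)
      mem_self := fun j => by
        rcases hstep j with ⟨h, -⟩ | ⟨-, h⟩
        · exact h ▸ ha _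
        · exact h ▸ hb _
      mem_succ := fun j => by
        rcases hstep j with ⟨-, h⟩ | ⟨h, -⟩
        · exact h ▸ hb _
        · exact h ▸ ha _
      vtx_ne := fun j => by
        have := hab (l[j.val]'(ZMod.val_lt j))
        rcases hstep j with ⟨h, h'⟩ | ⟨h, h'⟩
        · exact h ▸ h' ▸ this
        · exact h ▸ h' ▸ this.symm }
  refine ⟨W, fun i => ?_, fun v => ?_⟩
  · obtain ⟨j, hj⟩ := hidx i
    refine ⟨j, hj, fun j' hj' => ?_⟩
    have : l[j'.val]'(ZMod.val_lt j') = l[j.val]'(ZMod.val_lt j) := Eq.trans hj' hj.symm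
    exact ZMod.val_injective _ ((hl.getElem_inj_iff).1 this)
  · obtain ⟨i, hi⟩ := hinc v
    obtain ⟨j, rfl⟩ := hidx i
    rcases hstep j with ⟨h, h'⟩ | ⟨h, h'⟩ <;> rcases hi with hi | hi
    · exact ⟨j, h.symm.trans hi⟩
    · exact ⟨j + 1, h'.symm.trans hi⟩
    · exact ⟨j + 1, h.symm.trans hi⟩
    · exact ⟨j, h'.symm.trans hi⟩

end MultigraphEuler

section PairDegree

variable {V ι : Type*} [Fintype ι] [DecidableEq V] {E : ι → Finset V} {k : ℕ}

/-- If every three vertices lie in a common edge, all edges have at most `k` vertices and there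
are at least `k² - 3k + 5` vertices, then every two vertices lie in at least `k` edges. -/
theorem le_card_filter_pair [Fintype V] (hk : ∀ i, (E i).card ≤ k) (hk3 : 3 ≤ k)
    (hn : k ^ 2 - 3 * k + 5 ≤ Fintype.card V)
    (hdeg : ∀ T : Finset V, T.card = 3 → ∃ i, T ⊆ E i) {u v : V} (huv : u ≠ v) :
    k ≤ (univ.filter (fun i => u ∈ E i ∧ v ∈ E i)).card := by
  classical
  have h := card_mul_le_card_mul (s := univ \ {u, v})
    (t := univ.filter (fun i => u ∈ E i ∧ v ∈ E i)) (fun w i => w ∈ E i) (m := 1) (n := k - 2)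
    (fun w hw => by
      simp only [mem_sdiff, mem_univ, mem_insert, mem_singleton, not_or, true_and] at hw
      obtain ⟨i, hi⟩ := hdeg {u, v, w} (card_eq_three.2
        ⟨u, v, w, huv, Ne.symm hw.1, Ne.symm hw.2, rfl⟩)
      refine card_pos.2 ⟨i, ?_⟩
      simp only [bipartiteAbove, mem_filter, mem_univ, true_and]
      exact ⟨⟨hi (by simp), hi (by simp)⟩, hi (by simp)⟩)
    (fun i hi => by
      simp only [mem_filter, mem_univ, true_and] at hi
      have hsub : (univ \ {u, v}).bipartiteBelow (fun w i => w ∈ E i) i ⊆ E i \ {u, v} := by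
        intro w hw
        simp only [bipartiteBelow, mem_filter, mem_sdiff, mem_univ, true_and] at hw
        exact mem_sdiff.2 ⟨hw.2, hw.1⟩
      refine (card_le_card hsub).trans ?_
      rw [card_sdiff_of_subset (by simp [insert_subset_iff, hi.1, hi.2]), card_pair huv]
      have := hk i
      omega)
  rw [card_sdiff_of_subset (subset_univ _), card_pair huv, card_univ] at h
  by_contra! hlt
  obtain ⟨m, rfl⟩ := Nat.exists_eq_add_of_le hk3
  have h1 : (3 + m) ^ 2 - 3 * (3 + m) = m ^ 2 + 3 * m := by
    rw [Nat.sub_eq_iff_eq_add (by nlinarith)]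
    ring
  have h2 : (univ.filter (fun i => u ∈ E i ∧ v ∈ E i)).card ≤ m + 2 := by omega
  have h3 : 3 + m - 2 = m + 1 := by omega
  have h4 := Nat.mul_le_mul_right (m + 1) h2
  rw [h3] at h
  have h5 : (m + 2) * (m + 1) = m ^ 2 + 3 * m + 2 := by ring
  omega

/-- If every two vertices lie in at least `k` edges of size at most `k`, then every vertex `r`
can be joined to all the others through distinct edges. -/
theorem exists_injective_star (hk : ∀ i, (E i).card ≤ k) (hk0 : 0 < k)
    (hpair : ∀ u v : V, u ≠ v → k ≤ (univ.filter (fun i => u ∈ E i ∧ v ∈ E i)).card) (r : V) :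
    ∃ e : {v : V // v ≠ r} → ι, Function.Injective e ∧
      ∀ v, r ∈ E (e v) ∧ v.1 ∈ E (e v) := by
  classical
  have hall := (all_card_le_biUnion_card_iff_exists_injective
    (fun v : {v : V // v ≠ r} => univ.filter (fun i => r ∈ E i ∧ v.1 ∈ E i))).1 (by
      intro S
      have h := card_mul_le_card_mul (s := S)
        (t := S.biUnion (fun v => univ.filter (fun i => r ∈ E i ∧ v.1 ∈ E i)))
        (fun v i => r ∈ E i ∧ v.1 ∈ E i) (m := k) (n := k)
        (fun v hv => (hpair r v.1 v.2.symm).trans (card_le_card (fun i hi => by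
          simp only [mem_filter, mem_univ, true_and] at hi
          simp only [bipartiteAbove, mem_filter, mem_biUnion, mem_univ, true_and]
          exact ⟨⟨v, hv, hi⟩, hi⟩)))
        (fun i _ => by
          refine le_trans ?_ (hk i)
          refine card_le_card_of_injOn Subtype.val (fun v hv => ?_)
            Subtype.val_injective.injOn
          simp only [bipartiteBelow, coe_filter, Set.mem_ofPred_eq] at hv
          exact hv.2.2)
      exact Nat.le_of_mul_le_mul_right h hk0)
  obtain ⟨e, he, hmem⟩ := hall
  exact ⟨e, he, fun v => by simpa using hmem v⟩

theorem mul_mul_le_of_le {a b p q : ℕ} (ha : 1 ≤ a) (hb : 1 ≤ b) (hap : a ≤ p) (hbq : b ≤ q) :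
    a * b * (p + q - 1) ≤ (a + b - 1) * (p * q) := by
  obtain ⟨a, rfl⟩ := Nat.exists_eq_add_of_le' ha
  obtain ⟨b, rfl⟩ := Nat.exists_eq_add_of_le' hb
  obtain ⟨p, rfl⟩ := Nat.exists_eq_add_of_le hap
  obtain ⟨q, rfl⟩ := Nat.exists_eq_add_of_le hbq
  have h1 : a + 1 + p + (b + 1 + q) - 1 = a + b + p + q + 1 := by omega
  have h2 : a + 1 + (b + 1) - 1 = a + b + 1 := by omega
  rw [h1, h2]
  zify
  nlinarith [Nat.zero_le (a * (a + 1) * q), Nat.zero_le (b * (b + 1) * p),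
    Nat.zero_le ((a + b + 1) * p * q)]

/-- If every two vertices lie in at least `k` edges of size at most `k`, then every nontrivial
cut is crossed by at least as many edges as there are vertices. -/
theorem card_le_card_cut [Fintype V] (hk : ∀ i, (E i).card ≤ k)
    (hpair : ∀ u v : V, u ≠ v → k ≤ (univ.filter (fun i => u ∈ E i ∧ v ∈ E i)).card)
    (hk0 : 0 < k) {C : Finset V} (hC : C.Nonempty) (hC' : Cᶜ.Nonempty) :
    Fintype.card V ≤
      (univ.filter (fun i => (∃ c ∈ C, c ∈ E i) ∧ ∃ s ∈ Cᶜ, s ∈ E i)).card := by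
  classical
  set X := univ.filter (fun i => (∃ c ∈ C, c ∈ E i) ∧ ∃ s ∈ Cᶜ, s ∈ E i)
  have hsum : C.card + Cᶜ.card = Fintype.card V := card_add_card_compl C
  have hp := hC.card_pos
  have hq := hC'.card_pos
  have hn : 0 < Fintype.card V - 1 := by omega
  set B := (k - 1) * (C.card * Cᶜ.card) / (Fintype.card V - 1) with hB
  have h := card_mul_le_card_mul (s := C ×ˢ Cᶜ) (t := X)
    (fun x i => x.1 ∈ E i ∧ x.2 ∈ E i) (m := k) (n := B)
    (fun x hx => by
      obtain ⟨h1, h2⟩ := mem_product.1 hx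
      refine (hpair x.1 x.2 (fun h => (mem_compl.1 h2) (h ▸ h1))).trans
        (card_le_card (fun i hi => ?_))
      simp only [mem_filter, mem_univ, true_and] at hi
      simp only [X, bipartiteAbove, mem_filter, mem_univ, true_and]
      exact ⟨⟨⟨x.1, h1, hi.1⟩, x.2, h2, hi.2⟩, hi⟩)
    (fun i hi => by
      simp only [X, mem_filter, mem_univ, true_and] at hi
      obtain ⟨⟨c, hc, hci⟩, s, hs, hsi⟩ := hi
      have hsub : (C ×ˢ Cᶜ).bipartiteBelow (fun x i => x.1 ∈ E i ∧ x.2 ∈ E i) i ⊆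
          (E i ∩ C) ×ˢ (E i ∩ Cᶜ) := by
        intro x hx
        simp only [bipartiteBelow, mem_filter, mem_product] at hx
        simp only [mem_product, mem_inter]
        tauto
      refine (card_le_card hsub).trans ?_
      rw [card_product, hB, Nat.le_div_iff_mul_le hn, ← hsum]
      refine (mul_mul_le_of_le (card_pos.2 ⟨c, mem_inter.2 ⟨hci, hc⟩⟩)
        (card_pos.2 ⟨s, mem_inter.2 ⟨hsi, hs⟩⟩) (card_le_card inter_subset_right)
        (card_le_card inter_subset_right)).trans (Nat.mul_le_mul_right _ ?_)
      have h1 : (E i ∩ C).card + (E i ∩ Cᶜ).card = (E i).card := by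
        rw [← sdiff_eq_inter_compl]
        exact card_inter_add_card_sdiff _ _
      have := hk i
      omega)
  rw [card_product] at h
  have hBle : B * (Fintype.card V - 1) ≤ (k - 1) * (C.card * Cᶜ.card) := Nat.div_mul_le_self _ _
  by_contra! hlt
  have hX : X.card ≤ Fintype.card V - 1 := by omega
  have hpq : 0 < C.card * Cᶜ.card := Nat.mul_pos hp hq
  have h1 : C.card * Cᶜ.card * k ≤ (k - 1) * (C.card * Cᶜ.card) := by
    calc _ ≤ X.card * B := h
      _ ≤ (Fintype.card V - 1) * B := Nat.mul_le_mul_right _ hX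
      _ = B * (Fintype.card V - 1) := Nat.mul_comm _ _
      _ ≤ _ := hBle
  rw [Nat.mul_comm] at h1
  have := Nat.le_of_mul_le_mul_right h1 hpq
  omega

end PairDegree

section Switching

variable {V ι : Type*} [DecidableEq V] {E : ι → Finset V}

/-- A choice of a vertex `x i` and two possible partners `y i`, `z i` in every edge `i`, the
partners in the edge `e v` being `r` and `v`. -/
structure IsSwitching (E : ι → Finset V) (r : V) (e : {v : V // v ≠ r} → ι)
    (x y z : ι → V) : Prop where
  x_mem : ∀ i, x i ∈ E i
  y_mem : ∀ i, y i ∈ E i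
  z_mem : ∀ i, z i ∈ E i
  x_ne_y : ∀ i, x i ≠ y i
  x_ne_z : ∀ i, x i ≠ z i
  y_star : ∀ v, y (e v) = r
  z_star : ∀ v, z (e v) = v.1

theorem exists_isSwitching (h3 : ∀ i, 3 ≤ (E i).card) {r : V} {e : {v : V // v ≠ r} → ι}
    (he : Function.Injective e) (hmem : ∀ v, r ∈ E (e v) ∧ v.1 ∈ E (e v)) :
    ∃ x y z, IsSwitching E r e x y z := by
  classical
  have h : ∀ i, ∃ t : V × V × V, t.1 ∈ E i ∧ t.2.1 ∈ E i ∧ t.2.2 ∈ E i ∧ t.1 ≠ t.2.1 ∧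
      t.1 ≠ t.2.2 ∧ ∀ v, e v = i → t.2.1 = r ∧ t.2.2 = v.1 := by
    intro i
    by_cases hi : ∃ v, e v = i
    · obtain ⟨v, rfl⟩ := hi
      obtain ⟨x, hx, hx'⟩ := exists_mem_notMem_of_card_lt_card
        (lt_of_le_of_lt (card_le_two (a := r) (b := v.1)) (h3 (e v)))
      simp only [mem_insert, mem_singleton, not_or] at hx'
      refine ⟨(x, r, v.1), hx, (hmem v).1, (hmem v).2, hx'.1, hx'.2, fun v' hv' => ?_⟩
      rw [he hv']
      exact ⟨rfl, rfl⟩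
    · obtain ⟨x, hx, y, hy, hxy⟩ := one_lt_card.1 (lt_of_lt_of_le (by norm_num) (h3 i))
      exact ⟨(x, y, y), hx, hy, hy, hxy, hxy, fun v hv => absurd ⟨v, hv⟩ hi⟩
  choose t h1 h2 h3 h4 h5 h6 using h
  exact ⟨fun i => (t i).1, fun i => (t i).2.1, fun i => (t i).2.2, h1, h2, h3, h4, h5,
    fun v => (h6 _ v rfl).1, fun v => (h6 _ v rfl).2⟩

/-- If every nontrivial cut is crossed by as many edges as there are vertices, then some
switching connects all vertices to `r`, whichever partners are selected. -/
theorem exists_isSwitching_connected [Fintype V] [Fintype ι] (h3 : ∀ i, 3 ≤ (E i).card)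
    (hcut : ∀ C : Finset V, C.Nonempty → Cᶜ.Nonempty → Fintype.card V ≤
      (univ.filter (fun i => (∃ c ∈ C, c ∈ E i) ∧ ∃ s ∈ Cᶜ, s ∈ E i)).card)
    {r : V} {e : {v : V // v ≠ r} → ι}
    (he : Function.Injective e) (hmem : ∀ v, r ∈ E (e v) ∧ v.1 ∈ E (e v)) :
    ∃ x y z, IsSwitching E r e x y z ∧ ∀ R : V → V → Prop,
      (∀ i, R (x i) (y i) ∨ R (x i) (z i)) → ∀ v, Relation.ReflTransGen R v r := by
  classical
  have key : ∀ m, m + 1 ≤ Fintype.card V → ∃ (C : Finset V) (D : Finset ι) (x y z : ι → V),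
      r ∈ C ∧ C.card = m + 1 ∧ D.card = m ∧ IsSwitching E r e x y z ∧ ∀ R : V → V → Prop,
      (∀ i ∈ D, R (x i) (y i) ∨ R (x i) (z i)) → ∀ v ∈ C, Relation.ReflTransGen R v r := by
    intro m
    induction m with
    | zero =>
      intro _
      obtain ⟨x, y, z, h⟩ := exists_isSwitching h3 he hmem
      refine ⟨{r}, ∅, x, y, z, by simp, by simp, by simp, h, fun R _ v hv => ?_⟩
      rw [mem_singleton.1 hv]
    | succ m ih =>
      intro hm
      obtain ⟨C, D, x, y, z, hr, hC, hD, hsw, hreach⟩ := ih (by omega)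
      have hcc : C.card + Cᶜ.card = Fintype.card V := card_add_card_compl C
      have hcutC := hcut C ⟨r, hr⟩ (card_pos.1 (by omega))
      have hbad : (D ∪ (univ.filter (fun v : {v : V // v ≠ r} => v.1 ∈ Cᶜ)).image e).card <
          Fintype.card V := by
        have h1 : (univ.filter (fun v : {v : V // v ≠ r} => v.1 ∈ Cᶜ)).card ≤ Cᶜ.card :=
          card_le_card_of_injOn Subtype.val (fun v hv => by simpa using hv)
            Subtype.val_injective.injOn
        have h2 := card_union_le D
          ((univ.filter (fun v : {v : V // v ≠ r} => v.1 ∈ Cᶜ)).image e)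
        have h3 := card_image_le (s := univ.filter (fun v : {v : V // v ≠ r} => v.1 ∈ Cᶜ)) (f := e)
        omega
      obtain ⟨i, hi, hi'⟩ := exists_mem_notMem_of_card_lt_card (hbad.trans_le hcutC)
      simp only [mem_filter, mem_univ, true_and, mem_union, mem_image, not_or, not_exists,
        not_and] at hi hi'
      obtain ⟨⟨c, hc, hci⟩, s, hs, hsi⟩ := hi
      obtain ⟨hiD, hie⟩ := hi'
      have hsC : s ∉ C := mem_compl.1 hs
      obtain ⟨y', z', hy', hz', hyC, hzC, hyz⟩ : ∃ y' z', y' ∈ E i ∧ z' ∈ E i ∧ y' ∈ C ∧ z' ∈ C ∧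
          ∀ v, e v = i → y' = r ∧ z' = v.1 := by
        by_cases hv : ∃ v, e v = i
        · obtain ⟨v, rfl⟩ := hv
          refine ⟨r, v.1, (hmem v).1, (hmem v).2, hr, ?_, fun v' hv' => by simp [he hv']⟩
          by_contra hvC
          exact hie v (mem_compl.2 hvC) rfl
        · exact ⟨c, c, hci, hci, hc, hc, fun v hv' => absurd ⟨v, hv'⟩ hv⟩
      refine ⟨insert s C, insert i D, Function.update x i s, Function.update y i y',
        Function.update z i z', mem_insert_of_mem hr, by rw [card_insert_of_notMem hsC, hC],
        by rw [card_insert_of_notMem hiD, hD], ?_, ?_⟩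
      · obtain ⟨h1, h2, h3, h4, h5, h6, h7⟩ := hsw
        constructor <;> intro j
        · by_cases hj : j = i <;> simp_all
        · by_cases hj : j = i <;> simp_all
        · by_cases hj : j = i <;> simp_all
        · by_cases hj : j = i
          · subst hj
            simpa using fun h : s = y' => hsC (h ▸ hyC)
          · simpa [hj] using h4 j
        · by_cases hj : j = i
          · subst hj
            simpa using fun h : s = z' => hsC (h ▸ hzC)
          · simpa [hj] using h5 j
        · by_cases hj : e j = i
          · simpa [hj] using (hyz j hj).1
          · simpa [hj] using h6 j
        · by_cases hj : e j = i
          · simpa [hj] using (hyz j hj).2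
          · simpa [hj] using h7 j
      · intro R hR
        have hold := hreach R (fun j hj => by
          have hji : j ≠ i := fun h => hiD (h ▸ hj)
          simpa [hji] using hR j (mem_insert_of_mem hj))
        intro v hv
        rcases mem_insert.1 hv with rfl | hv
        · have := hR i (mem_insert_self _ _)
          simp only [Function.update_self] at this
          rcases this with h | h
          · exact (hold _ hyC).head h
          · exact (hold _ hzC).head h
        · exact hold v hv
  have hpos : 0 < Fintype.card V := Fintype.card_pos_iff.2 ⟨r⟩
  obtain ⟨C, D, x, y, z, -, hC, -, hsw, hreach⟩ := key (Fintype.card V - 1) (by omega)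
  have hCu : C = univ := (card_eq_iff_eq_univ C).1 (by omega)
  exact ⟨x, y, z, hsw, fun R hR v => hreach R (fun i _ => hR i) v (hCu ▸ mem_univ v)⟩

/-- The partners in a switching can be selected so that all degrees become even. -/
theorem IsSwitching.exists_even [Fintype V] [Fintype ι] {r : V} {e : {v : V // v ≠ r} → ι} {x y z : ι → V}
    (h : IsSwitching E r e x y z) (he : Function.Injective e) :
    ∃ w : ι → V, (∀ i, w i = y i ∨ w i = z i) ∧
      ∀ v, Even ((univ.filter (fun i => x i = v)).card +
        (univ.filter (fun i => w i = v)).card) := by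
  classical
  let base : V → ℕ := fun v => (univ.filter (fun i => x i = v)).card +
    (univ.filter (fun i => (∀ v, e v ≠ i) ∧ y i = v)).card
  let w : ι → V := fun i => if ∃ v, e v = i ∧ Odd (base v.1) then z i else y i
  have hw_star : ∀ v, w (e v) = if Odd (base v.1) then v.1 else r := by
    intro v
    have : (∃ v', e v' = e v ∧ Odd (base v'.1)) ↔ Odd (base v.1) :=
      ⟨fun ⟨v', hv', ho⟩ => he hv' ▸ ho, fun ho => ⟨v, rfl, ho⟩⟩
    simp only [w, this, h.y_star, h.z_star]
  have hw_other : ∀ i, (∀ v, e v ≠ i) → w i = y i := by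
    intro i hi
    exact if_neg (fun ⟨v, hv, _⟩ => hi v hv)
  have hne : ∀ v, v ≠ r → Even ((univ.filter (fun i => x i = v)).card +
      (univ.filter (fun i => w i = v)).card) := by
    intro v hv
    have hsplit : univ.filter (fun i => w i = v) =
        univ.filter (fun i => (∀ v, e v ≠ i) ∧ y i = v) ∪
          (if Odd (base v) then {e ⟨v, hv⟩} else ∅) := by
      ext i
      simp only [mem_filter, mem_univ, true_and, mem_union]
      by_cases hi : ∃ v, e v = i
      · obtain ⟨u, rfl⟩ := hi
        rw [hw_star]
        have h1 : ¬ ∀ v, e v ≠ e u := fun h => h u rfl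
        have h2 : e u = e ⟨v, hv⟩ ↔ u.1 = v := by
          rw [he.eq_iff, Subtype.ext_iff]
        by_cases huv : u.1 = v
        · subst huv
          by_cases ho : Odd (base u.1)
          · simp [ho]
          · rw [if_neg ho, if_neg ho]
            simp only [h1, hv.symm, false_and, notMem_empty, or_self]
        · have h3 : e u ∉ (if Odd (base v) then {e ⟨v, hv⟩} else ∅ : Finset ι) := by
            split_ifs <;> simp [h2, huv]
          simp only [h1, false_and, h3, or_self, iff_false]
          split_ifs
          · exact huv
          · exact hv.symm
      · push Not at hi
        rw [hw_other i hi]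
        have h3 : i ∉ (if Odd (base v) then {e ⟨v, hv⟩} else ∅ : Finset ι) := by
          split_ifs
          · simpa using (hi _).symm
          · simp
        simp [h3, hi]
    have hdisj : Disjoint (univ.filter (fun i => (∀ v, e v ≠ i) ∧ y i = v))
        (if Odd (base v) then {e ⟨v, hv⟩} else ∅) := by
      split_ifs
      · simp only [disjoint_singleton_right, mem_filter, mem_univ, true_and, not_and]
        exact fun h => absurd rfl (h ⟨v, hv⟩)
      · simp
    rw [hsplit, card_union_of_disjoint hdisj, ← add_assoc]
    change Even (base v + _)
    by_cases ho : Odd (base v)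
    · simp [ho]
    · rw [if_neg ho]
      exact Nat.not_odd_iff_even.1 ho
  refine ⟨w, fun i => ?_, fun v => ?_⟩
  · simp only [w]
    split_ifs <;> simp
  · by_cases hv : v = r
    · subst hv
      have htot : ∑ u, ((univ.filter (fun i => x i = u)).card +
          (univ.filter (fun i => w i = u)).card) = Fintype.card ι + Fintype.card ι := by
        rw [sum_add_distrib, ← card_eq_sum_card_fiberwise (fun i _ => by simp),
          ← card_eq_sum_card_fiberwise (fun i _ => by simp), card_univ]
      rw [← add_sum_erase _ _ (mem_univ v)] at htot
      have hrest : Even (∑ u ∈ univ.erase v, ((univ.filter (fun i => x i = u)).card +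
          (univ.filter (fun i => w i = u)).card)) :=
        even_sum _ (fun u hu => hne u (ne_of_mem_erase hu))
      exact (Nat.even_add.1 (htot ▸ ⟨_, rfl⟩)).2 hrest
    · exact hne v hv

end Switching

/-- **Theorem 1.4(ii).** Every `(n,c,k,μ)`-admissible hypergraph with minimum `3`-degree
`δ₃(𝒢) ≥ 1` and `n ≥ k² − 3k + 5` has a spanning Euler tour. -/
theorem hasSpanningEulerTour_of_admissible_deg3 {V ι : Type*} [Fintype V] [Fintype ι]
    [Nonempty ι] [DecidableEq V] (E : ι → Finset V) (n c k μ : ℕ)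
    (hadm : Admissible E n c k μ)
    (hn : k ^ 2 - 3 * k + 5 ≤ n)
    (hdeg : ∀ T : Finset V, T.card = 3 →
      1 ≤ (Finset.univ.filter (fun i => T ⊆ E i)).card) :
    HasSpanningEulerTour E := by
  classical
  obtain ⟨hV, hc, hc3, hk, -, -⟩ := hadm
  have h3 : ∀ i, 3 ≤ (E i).card := fun i =>
    (hc3.trans hc.ge).trans (inf'_le _ (mem_univ i))
  have hk' : ∀ i, (E i).card ≤ k := fun i =>
    (le_sup' (fun i => (E i).card) (mem_univ i)).trans hk.le
  have hk3 : 3 ≤ k := (h3 (Classical.arbitrary ι)).trans (hk' _)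
  have : Nontrivial V := Fintype.one_lt_card_iff_nontrivial.1 (by omega)
  have hpair : ∀ u v : V, u ≠ v → k ≤ (univ.filter (fun i => u ∈ E i ∧ v ∈ E i)).card :=
    fun u v huv => le_card_filter_pair hk' hk3 (hV ▸ hn) (fun T hT => by
      obtain ⟨i, hi⟩ := card_pos.1 (hdeg T hT)
      exact ⟨i, (mem_filter.1 hi).2⟩) huv
  obtain ⟨r⟩ : Nonempty V := inferInstance
  obtain ⟨e, he, hmem⟩ := exists_injective_star hk' (by omega) hpair r
  obtain ⟨x, y, z, hsw, hreach⟩ := exists_isSwitching_connected h3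
    (fun C hC hC' => card_le_card_cut hk' hpair (by omega) hC hC') he hmem
  obtain ⟨w, hw, heven⟩ := hsw.exists_even he
  have hroot := hreach (fun p q => ∃ i, x i = p ∧ w i = q ∨ x i = q ∧ w i = p) (fun i => by
    rcases hw i with h | h
    · exact Or.inl ⟨i, Or.inl ⟨rfl, h⟩⟩
    · exact Or.inr ⟨i, Or.inl ⟨rfl, h⟩⟩)
  have : Std.Symm (fun p q => ∃ i, x i = p ∧ w i = q ∨ x i = q ∧ w i = p) :=
    ⟨fun p q ⟨i, hi⟩ => ⟨i, hi.symm⟩⟩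
  refine hasSpanningEulerTour_of_even_connected (a := x) (b := w) hsw.x_mem (fun i => ?_)
    (fun i => ?_) heven (fun p q => (hroot p).trans
      (Relation.ReflTransGen.stdSymm.symm _ _ (hroot q)))
  · rcases hw i with h | h
    · exact h ▸ hsw.y_mem i
    · exact h ▸ hsw.z_mem i
  · rcases hw i with h | h
    · exact h ▸ hsw.x_ne_y i
    · exact h ▸ hsw.x_ne_z i
end

section
/- Every (n,c,k,μ)-admissible hypergraph 𝒢 with minimum r-degree δ_r(𝒢) ≥ 1 for some r with 4 ≤ r ≤ k has a spanning Euler tour. -/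
open Finset

namespace SimpleGraph

variable {α : Type*} [Fintype α] [DecidableEq α] {G : SimpleGraph α} [DecidableRel G.Adj]

/-- A trail ending at a vertex of even degree that is not its start can be extended. -/
theorem Walk.IsTrail.exists_adj_notMem_edges {u v : α} {p : G.Walk u v} (hp : p.IsTrail)
    (huv : u ≠ v) (hv : Even (G.degree v)) : ∃ x, G.Adj x v ∧ s(x, v) ∉ p.edges := by
  by_contra! hcon
  have hodd : ¬ Even (p.edges.countP fun e => v ∈ e) := by
    rw [hp.even_countP_edges_iff]
    exact fun h => (h huv).2 rfl
  apply hodd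
  convert hv
  rw [← card_incidenceFinset_eq_degree, List.countP_eq_length_filter,
    ← List.toFinset_card_of_nodup (hp.edges_nodup.filter _)]
  congr 1
  ext e
  induction e using Sym2.ind with | _ a b =>
  simp only [List.mem_toFinset, List.mem_filter, decide_eq_true_eq, mem_incidenceFinset,
    mk'_mem_incidenceSet_iff, Sym2.mem_iff]
  constructor
  · rintro ⟨h, rfl | rfl⟩
    · exact ⟨p.adj_of_mem_edges h, .inl rfl⟩
    · exact ⟨p.adj_of_mem_edges h, .inr rfl⟩
  · rintro ⟨h, rfl | rfl⟩
    · exact ⟨Sym2.eq_swap ▸ hcon b h.symm, .inl rfl⟩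
    · exact ⟨hcon a h, .inr rfl⟩

/-- **Euler's theorem**: a connected finite graph with even degrees has an Eulerian circuit. -/
theorem Connected.exists_isEulerian (hG : G.Connected) (hdeg : ∀ v, Even (G.degree v)) :
    ∃ u, ∃ p : G.Walk u u, p.IsEulerian := by
  classical
  let P : ℕ → Prop := fun n => ∃ u v, ∃ p : G.Walk u v, p.IsTrail ∧ p.length = n
  obtain ⟨a⟩ := hG.nonempty
  have hP0 : P 0 := ⟨a, a, .nil, .nil, rfl⟩
  obtain ⟨u, v, p, hp, hlen⟩ := Nat.findGreatest_spec (Nat.zero_le (#G.edgeFinset)) hP0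
  have hmax : ∀ {u' v' : α} (q : G.Walk u' v'), q.IsTrail → q.length ≤ p.length := fun q hq =>
    hlen ▸ Nat.le_findGreatest hq.length_le_card_edgeFinset ⟨_, _, q, hq, rfl⟩
  have huv : u = v := by
    by_contra huv
    obtain ⟨x, hx, hxp⟩ := hp.exists_adj_notMem_edges huv (hdeg v)
    have h := hmax (p.reverse.cons hx)
      ((Walk.IsTrail.reverse p hp).cons hx (by simpa using hxp))
    simp at h
  subst huv
  have hclosed : ∀ x y, x ∈ p.support → G.Adj x y → s(x, y) ∈ p.edges := by
    intro x y hx hxy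
    by_contra hmem
    have h := hmax ((p.rotate x hx).cons hxy.symm)
      (((Walk.isTrail_rotate hx).2 hp).cons hxy.symm (by
        rwa [(p.rotate_edges x hx).mem_iff, Sym2.eq_swap]))
    simp at h
  have hsupp : ∀ x, x ∈ p.support := by
    intro x
    obtain ⟨w⟩ := hG.preconnected u x
    induction w using Walk.concatRec with
    | Hnil => exact p.start_mem_support
    | Hconcat w h ih =>
      exact p.snd_mem_support_of_mem_edges (hclosed _ _ (ih p hp hlen hmax hclosed) h)
  refine ⟨u, p, hp.isEulerian_of_forall_mem ?_⟩
  intro e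
  induction e using Sym2.ind with | _ a b =>
  exact fun h => hclosed a b (hsupp a) h

end SimpleGraph

section Combinatorics

variable {V ι : Type*} [Fintype ι] [DecidableEq V]

/-- If every `r`-set with `r ≥ 4` lies in an edge, every edge has at most `k` vertices and there are
more than `k.choose 2` vertices, then every pair of vertices lies in at least `2 * (k - 1)` edges. -/
theorem two_mul_sub_one_le_card_filter_pair_subset [Fintype V] {E : ι → Finset V} {k r : ℕ}
    (hr4 : 4 ≤ r) (hrk : r ≤ k) (hk : ∀ i, #(E i) ≤ k) (hn : k.choose 2 + 1 ≤ Fintype.card V)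
    (hdeg : ∀ T : Finset V, #T = r → ∃ i, T ⊆ E i) {u v : V} (huv : u ≠ v) :
    2 * (k - 1) ≤ #{i | u ∈ E i ∧ v ∈ E i} := by
  classical
  obtain ⟨m, rfl⟩ : ∃ m, k = m + 4 := ⟨k - 4, by omega⟩
  have hchoose : 2 * (m + 4).choose 2 = (m + 4) * (m + 3) := by
    rw [Nat.choose_two_right, Nat.mul_div_cancel' (Nat.even_mul_pred_self _).two_dvd]
    rfl
  have h4n : 4 ≤ Fintype.card V := by nlinarith
  obtain ⟨l, hl⟩ : ∃ l, Fintype.card V = l + 4 := ⟨Fintype.card V - 4, by omega⟩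
  have hrn : r ≤ Fintype.card V := by nlinarith
  have key : #(powersetCard 2 (univ \ {u, v} : Finset V)) * 1 ≤
      #({i | u ∈ E i ∧ v ∈ E i} : Finset ι) * (m + 2).choose 2 := by
    refine card_mul_le_card_mul (fun Q i => Q ⊆ E i) ?_ ?_
    · intro Q hQ
      rw [mem_powersetCard] at hQ
      have hdisj : Disjoint Q {u, v} := disjoint_of_subset_left hQ.1 sdiff_disjoint
      obtain ⟨T, hT, hTr⟩ := exists_superset_card_eq (s := Q ∪ {u, v}) (n := r)
        (by rw [card_union_of_disjoint hdisj, hQ.2, card_pair huv]; exact hr4) hrn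
      obtain ⟨i, hi⟩ := hdeg T hTr
      have hQi := hT.trans hi
      simp only [union_subset_iff, insert_subset_iff, singleton_subset_iff] at hQi
      exact card_pos.2 ⟨i, by simp [bipartiteAbove, hQi]⟩
    · intro i hi
      simp only [mem_filter, mem_univ, true_and] at hi
      calc _ ≤ #(powersetCard 2 (E i \ {u, v})) := by
            refine card_le_card fun Q hQ => ?_
            simp only [bipartiteBelow, mem_filter, mem_powersetCard] at hQ ⊢
            refine ⟨fun x hx => mem_sdiff.2 ⟨hQ.2 hx, (mem_sdiff.1 (hQ.1.1 hx)).2⟩, hQ.1.2⟩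
        _ = (#(E i) - 2).choose 2 := by
            rw [card_powersetCard, card_sdiff_of_subset (by simp [insert_subset_iff, hi]),
              card_pair huv]
        _ ≤ _ := Nat.choose_le_choose 2 (by have := hk i; omega)
  rw [card_powersetCard, card_sdiff_of_subset (subset_univ _), card_pair huv, card_univ, hl,
    mul_one] at key
  have h1 : 2 * (m + 2).choose 2 = (m + 2) * (m + 1) := by
    rw [Nat.choose_two_right, Nat.mul_div_cancel' (Nat.even_mul_pred_self _).two_dvd]
    rfl
  have h2 : 2 * (l + 4 - 2).choose 2 = (l + 2) * (l + 1) := by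
    rw [Nat.choose_two_right, Nat.mul_div_cancel' (Nat.even_mul_pred_self _).two_dvd]
    rfl
  have h3 : (m + 2) * (m + 5) ≤ 2 * (l + 2) := by nlinarith
  have h4 : (m + 1) * (m + 6) ≤ 2 * (l + 1) := by nlinarith
  have h5 := Nat.mul_le_mul h3 h4
  set d := #({i | u ∈ E i ∧ v ∈ E i} : Finset ι)
  by_contra! hd
  have h6 : d + 1 ≤ 2 * (m + 3) := hd
  have h7 : (l + 2) * (l + 1) ≤ d * ((m + 2) * (m + 1)) := by
    rw [← h1, ← h2]; nlinarith
  have h8 : (m + 2) * (m + 1) * ((m + 5) * (m + 6)) ≤ (m + 2) * (m + 1) * (4 * d) := by nlinarith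
  have h9 := Nat.le_of_mul_le_mul_left h8 (by positivity)
  nlinarith

/-- Two disjoint systems of distinct representatives for the stars centred at `x₀`. -/
theorem exists_injective_star_s4 {E : ι → Finset V} {k : ℕ} (hk2 : 2 ≤ k)
    (hk : ∀ i, #(E i) ≤ k) (x₀ : V)
    (hdeg : ∀ v, v ≠ x₀ → 2 * (k - 1) ≤ #{i | x₀ ∈ E i ∧ v ∈ E i}) :
    ∃ g : {v // v ≠ x₀} × Bool → ι, Function.Injective g ∧
      ∀ p, x₀ ∈ E (g p) ∧ (p.1 : V) ∈ E (g p) := by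
  classical
  let t : {v // v ≠ x₀} × Bool → Finset ι := fun p => {i | x₀ ∈ E i ∧ (p.1 : V) ∈ E i}
  suffices h : ∀ s : Finset ({v // v ≠ x₀} × Bool), #s ≤ #(s.biUnion t) by
    obtain ⟨g, hg, hgt⟩ := (Finset.all_card_le_biUnion_card_iff_exists_injective t).1 h
    exact ⟨g, hg, fun p => by simpa [t] using hgt p⟩
  intro s
  refine Nat.le_of_mul_le_mul_right (c := 2 * (k - 1)) ?_ (by omega)
  refine card_mul_le_card_mul (fun p i => i ∈ t p) ?_ ?_
  · intro p hp
    refine (hdeg p.1 p.1.2).trans (card_le_card fun i hi => ?_)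
    simp only [bipartiteAbove, mem_filter, mem_biUnion]
    exact ⟨⟨p, hp, hi⟩, hi⟩
  · intro i hi
    obtain ⟨q, -, hq⟩ := mem_biUnion.1 hi
    have hx : x₀ ∈ E i := (mem_filter.1 hq).2.1
    calc _ ≤ #(((E i).erase x₀) ×ˢ (univ : Finset Bool)) := by
          refine card_le_card_of_injOn (fun p => ((p.1 : V), p.2)) ?_ ?_
          · intro p hp
            simp only [bipartiteBelow, coe_filter, Set.mem_ofPred_eq, t, mem_filter] at hp
            simp [p.1.2, hp.2.2.2]
          · rintro ⟨⟨a, _⟩, b⟩ _ ⟨⟨c, _⟩, d⟩ _ h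
            simpa using h
      _ ≤ _ := by
          rw [card_product, card_erase_of_mem hx, mul_comm]
          have := hk i
          simp only [card_univ, Fintype.card_bool]
          omega

/-- Given two disjoint systems of representatives for the star centred at `x₀`, one can choose
a pair in each edge such that all degrees are even and all pairs `{x₀, v}` are chosen. -/
theorem exists_even_pairs [Fintype V] {E : ι → Finset V} (h3 : ∀ i, 3 ≤ #(E i)) (x₀ : V)
    {g : {v // v ≠ x₀} × Bool → ι} (hg : Function.Injective g)
    (hgE : ∀ p, x₀ ∈ E (g p) ∧ (p.1 : V) ∈ E (g p)) :
    ∃ P : ι → Finset V, (∀ i, P i ⊆ E i) ∧ (∀ i, #(P i) = 2) ∧ (∀ v, Even #{i | v ∈ P i}) ∧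
      ∀ v, v ≠ x₀ → ∃ i, P i = {x₀, v} := by
  classical
  have hQ : ∀ i, ∃ Q ⊆ E i, #Q = 2 ∧ (∀ v, g (v, true) = i → Q = {x₀, v.1}) ∧
      ∀ v, g (v, false) = i → x₀ ∈ Q ∧ v.1 ∉ Q := by
    intro i
    by_cases hi : ∃ p, g p = i
    · obtain ⟨⟨v, b⟩, rfl⟩ := hi
      have hv := hgE (v, b)
      cases b with
      | true =>
        refine ⟨{x₀, v.1}, by simp [insert_subset_iff, hv], card_pair v.2.symm, ?_, ?_⟩
        · intro w hw
          cases hg hw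
          rfl
        · intro w hw
          cases hg hw
      | false =>
        obtain ⟨y, hy, hyn⟩ := exists_mem_notMem_of_card_lt_card
          (show #({x₀, v.1} : Finset V) < #(E (g (v, false))) from
            card_le_two.trans_lt (h3 _))
        simp only [mem_insert, mem_singleton, not_or] at hyn
        refine ⟨{x₀, y}, by simp [insert_subset_iff, hv, hy], card_pair (Ne.symm hyn.1), ?_, ?_⟩
        · intro w hw
          cases hg hw
        · intro w hw
          cases hg hw
          simp [v.2, Ne.symm hyn.2]
    · push Not at hi
      obtain ⟨Q, hQ, hQ2⟩ := exists_subset_card_eq (show 2 ≤ #(E i) from (h3 i).trans' (by simp))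
      exact ⟨Q, hQ, hQ2, fun v h => (hi _ h).elim, fun v h => (hi _ h).elim⟩
  choose Q hQE hQ2 hQt hQf using hQ
  let odd : {v // v ≠ x₀} → Prop := fun v => ¬ Even #{i | v.1 ∈ Q i}
  have hP : ∀ i, ∃ P ⊆ E i, #P = 2 ∧
      ∀ v : {v // v ≠ x₀}, v.1 ∈ P ↔ v.1 ∈ Q i ∨ g (v, false) = i ∧ odd v := by
    intro i
    by_cases hi : ∃ v, g (v, false) = i ∧ odd v
    · obtain ⟨v, rfl, hv⟩ := hi
      obtain ⟨hx, hvQ⟩ := hQf _ v rfl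
      refine ⟨insert v.1 ((Q (g (v, false))).erase x₀), ?_, ?_, ?_⟩
      · exact insert_subset (hgE _).2 ((erase_subset _ _).trans (hQE _))
      · rw [card_insert_of_notMem (fun h => hvQ (mem_of_mem_erase h)), card_erase_of_mem hx, hQ2]
      · intro w
        simp only [mem_insert, mem_erase, ne_eq, w.2, not_false_eq_true, true_and]
        constructor
        · rintro (h | h)
          · obtain rfl := Subtype.ext h
            exact .inr ⟨rfl, hv⟩
          · exact .inl h
        · rintro (h | ⟨h, -⟩)
          · exact .inr h
          · cases hg h
            exact .inl rfl
    · exact ⟨Q i, hQE i, hQ2 i, fun v => ⟨.inl, fun h => h.elim id fun h => (hi ⟨v, h⟩).elim⟩⟩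
  choose P hPE hP2 hPv using hP
  have heven : ∀ v, v ≠ x₀ → Even #{i | v ∈ P i} := by
    intro v hv
    by_cases ho : odd ⟨v, hv⟩
    · have hnot : g (⟨v, hv⟩, false) ∉ ({i | v ∈ Q i} : Finset ι) := by
        simpa using (hQf _ ⟨v, hv⟩ rfl).2
      have heq : (univ.filter fun i => v ∈ P i) =
          insert (g (⟨v, hv⟩, false)) (univ.filter fun i => v ∈ Q i) := by
        ext i
        simp only [mem_filter, mem_univ, true_and, mem_insert, hPv i ⟨v, hv⟩, ho, and_true]
        rw [or_comm, eq_comm (a := i)]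
      rw [heq, card_insert_of_notMem hnot, Nat.even_add_one]
      exact ho
    · have heq : (univ.filter fun i => v ∈ P i) = univ.filter fun i => v ∈ Q i := by
        ext i
        simp [hPv i ⟨v, hv⟩, ho]
      rw [heq]
      exact not_not.1 ho
  refine ⟨P, hPE, hP2, ?_, ?_⟩
  · intro v
    by_cases hv : v = x₀
    · subst hv
      have hsum : ∑ w, #{i | w ∈ P i} = ∑ i, #(P i) := by
        have := sum_card_bipartiteAbove_eq_sum_card_bipartiteBelow (s := (univ : Finset V))
          (t := (univ : Finset ι)) (fun w i => w ∈ P i)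
        simpa [bipartiteAbove, bipartiteBelow] using this
      simp only [hP2, sum_const, smul_eq_mul] at hsum
      rw [← add_sum_erase _ _ (mem_univ v)] at hsum
      have h1 : Even (∑ w ∈ univ.erase v, #{i | w ∈ P i}) :=
        even_sum _ fun w hw => heven w (ne_of_mem_erase hw)
      have h2 : Even (#(univ : Finset ι) * 2) := even_two.mul_left _
      rw [← hsum, Nat.even_add] at h2
      exact h2.2 h1
    · exact heven v hv
  · intro v hv
    refine ⟨g (⟨v, hv⟩, true), ?_⟩
    have hQg := hQt _ ⟨v, hv⟩ rfl
    have hvP : v ∈ P (g (⟨v, hv⟩, true)) := (hPv _ ⟨v, hv⟩).2 (.inl (by simp [hQg]))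
    have hPQ : P (g (⟨v, hv⟩, true)) ⊆ {x₀, v} := by
      intro w hw
      by_cases hwx : w = x₀
      · simp [hwx]
      · rcases (hPv _ ⟨w, hwx⟩).1 hw with h | ⟨h, -⟩
        · exact hQg ▸ h
        · cases hg h
    exact eq_of_subset_of_card_le hPQ (by rw [hP2]; exact card_le_two)

end Combinatorics

section Tour

variable {V ι : Type*}

/-- The bipartite incidence graph of a hypergraph. -/
def incidenceGraph (P : ι → Finset V) : SimpleGraph (V ⊕ ι) where
  Adj
    | .inl v, .inr i => v ∈ P i
    | .inr i, .inl v => v ∈ P i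
    | _, _ => False
  symm := ⟨by rintro (a | a) (b | b) h <;> exact h⟩
  loopless := ⟨by rintro (a | a) h <;> exact h⟩

@[simp] theorem incidenceGraph_adj_inl_inr {P : ι → Finset V} {v : V} {i : ι} :
    (incidenceGraph P).Adj (.inl v) (.inr i) ↔ v ∈ P i := Iff.rfl

@[simp] theorem incidenceGraph_adj_inr_inl {P : ι → Finset V} {v : V} {i : ι} :
    (incidenceGraph P).Adj (.inr i) (.inl v) ↔ v ∈ P i := Iff.rfl

@[simp] theorem not_incidenceGraph_adj_inl_inl {P : ι → Finset V} {v w : V} :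
    ¬ (incidenceGraph P).Adj (.inl v) (.inl w) := id

@[simp] theorem not_incidenceGraph_adj_inr_inr {P : ι → Finset V} {i j : ι} :
    ¬ (incidenceGraph P).Adj (.inr i) (.inr j) := id

/-- An Eulerian circuit of the incidence graph of a family of pairs `P i ⊆ E i` yields a spanning
Euler tour of `E`. -/
theorem hasSpanningEulerTour_of_isEulerian [DecidableEq V] [DecidableEq ι] [Nonempty ι]
    {E P : ι → Finset V} (hPE : ∀ i, P i ⊆ E i) (hP2 : ∀ i, #(P i) = 2) {x₀ : V}
    {p : (incidenceGraph P).Walk (.inl x₀) (.inl x₀)} (hp : p.IsEulerian)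
    (hsupp : ∀ x, x ∈ p.support) : HasSpanningEulerTour E := by
  have hparity : ∀ j ≤ p.length, (Even j → ∃ v, p.getVert j = .inl v) ∧
      (¬ Even j → ∃ i, p.getVert j = .inr i) := by
    intro j
    induction j with
    | zero => simp
    | succ j ih =>
      intro hj
      obtain ⟨h0, h1⟩ := ih (by omega)
      have hadj := p.adj_getVert_succ (show j < p.length by omega)
      rw [Nat.even_add_one]
      constructor
      · intro h
        obtain ⟨i, hi⟩ := h1 h
        rw [hi] at hadj
        cases hw : p.getVert (j + 1) with
        | inl w => exact ⟨w, rfl⟩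
        | inr w => simp [hw] at hadj
      · intro h
        obtain ⟨i, hi⟩ := h0 (not_not.1 h)
        rw [hi] at hadj
        cases hw : p.getVert (j + 1) with
        | inl w => simp [hw] at hadj
        | inr w => exact ⟨w, rfl⟩
  obtain ⟨m, hm⟩ : Even p.length := by
    by_contra h
    obtain ⟨i, hi⟩ := (hparity _ le_rfl).2 h
    simp at hi
  have hvx : ∀ j, ∃ v, p.getVert (2 * j) = .inl v := by
    intro j
    by_cases hj : 2 * j ≤ p.length
    · exact (hparity _ hj).1 (even_two_mul j)
    · exact ⟨x₀, p.getVert_of_length_le (by omega)⟩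
  choose vx hvx using hvx
  have hed : ∀ j, ∃ i, j < m → p.getVert (2 * j + 1) = .inr i := by
    intro j
    by_cases hj : j < m
    · obtain ⟨i, hi⟩ := (hparity (2 * j + 1) (by omega)).2 (by simp)
      exact ⟨i, fun _ => hi⟩
    · exact ⟨Classical.arbitrary ι, fun h => (hj h).elim⟩
  choose ed hed using hed
  have hmem : ∀ j < m, vx j ∈ P (ed j) := by
    intro j hj
    have := p.adj_getVert_succ (show 2 * j < p.length by omega)
    simpa [hvx, hed j hj] using this
  have hmem' : ∀ j < m, vx (j + 1) ∈ P (ed j) := by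
    intro j hj
    have := p.adj_getVert_succ (show 2 * j + 1 < p.length by omega)
    rw [hed j hj, show 2 * j + 1 + 1 = 2 * (j + 1) by ring, hvx] at this
    simpa using this
  have hinj : ∀ a b, a < p.length → b < p.length →
      s(p.getVert a, p.getVert (a + 1)) = s(p.getVert b, p.getVert (b + 1)) → a = b := by
    intro a b ha hb hab
    rw [← p.getElem_edges (by simpa), ← p.getElem_edges (by simpa)] at hab
    exact (hp.isTrail.edges_nodup.getElem_inj_iff).1 hab
  have hne : ∀ j < m, vx j ≠ vx (j + 1) := by
    intro j hj h
    have := hinj (2 * j) (2 * j + 1) (by omega) (by omega) (by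
      rw [hed j hj, show 2 * j + 1 + 1 = 2 * (j + 1) by ring, hvx, hvx, h, Sym2.eq_swap])
    omega
  have hed_inj : ∀ a b, a < b → b < m → ed a ≠ ed b := by
    intro a b hab hb h
    have ha : a < m := by omega
    have h1 : vx a ≠ vx b := fun hv => by
      have := hinj (2 * a) (2 * b) (by omega) (by omega) (by
        rw [hed a ha, hed b hb, hvx, hvx, h, hv])
      omega
    have h2 : vx (a + 1) ≠ vx b := fun hv => by
      have := hinj (2 * a + 1) (2 * b) (by omega) (by omega) (by
        rw [hed a ha, show 2 * a + 1 + 1 = 2 * (a + 1) by ring, hed b hb, hvx, hvx, h, hv,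
          Sym2.eq_swap])
      omega
    have h3 : #{vx a, vx (a + 1), vx b} ≤ #(P (ed a)) := by
      refine card_le_card ?_
      simp only [insert_subset_iff, singleton_subset_iff]
      exact ⟨hmem a ha, hmem' a ha, h ▸ hmem b hb⟩
    rw [hP2, card_eq_three.2 ⟨_, _, _, hne a ha, h1, h2, rfl⟩] at h3
    omega
  have hed_surj : ∀ i, ∃ j < m, ed j = i := by
    intro i
    obtain ⟨k, hk, hkl⟩ := SimpleGraph.Walk.mem_support_iff_exists_getVert.1 (hsupp (.inr i))
    rcases Nat.even_or_odd' k with ⟨j, rfl | rfl⟩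
    · simp [hvx] at hk
    · refine ⟨j, by omega, ?_⟩
      simpa [hed j (by omega)] using hk
  obtain ⟨j₀, hj₀, -⟩ := hed_surj (Classical.arbitrary ι)
  have : NeZero m := ⟨by omega⟩
  have hv0 : vx m = vx 0 := by
    have h1 := hvx m
    have h2 := hvx 0
    rw [← two_mul] at hm
    rw [← hm, p.getVert_length] at h1
    rw [Nat.mul_zero, p.getVert_zero] at h2
    exact Sum.inl_injective (h1.symm.trans h2)
  have hsucc : ∀ i : ZMod m, vx (i + 1).val = vx (i.val + 1) := by
    intro i
    have hi := i.val_lt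
    have hval : (i + 1).val = (i.val + 1) % m := by
      rw [ZMod.val_add, ZMod.val_one_eq_one_mod, Nat.add_mod_mod]
    rcases Nat.lt_or_ge (i.val + 1) m with h | h
    · rw [hval, Nat.mod_eq_of_lt h]
    · rw [hval, show i.val + 1 = m by omega, Nat.mod_self, hv0]
  refine ⟨⟨m, by omega, fun i => vx i.val, fun i => ed i.val, fun i => hPE _ (hmem _ i.val_lt),
    fun i => ?_, fun i => ?_⟩, fun e => ?_, fun v => ?_⟩
  · rw [hsucc]
    exact hPE _ (hmem' _ i.val_lt)
  · rw [hsucc]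
    exact hne _ i.val_lt
  · obtain ⟨j, hj, rfl⟩ := hed_surj e
    refine ⟨(j : ZMod m), congrArg ed (ZMod.val_cast_of_lt hj), fun i hi => ?_⟩
    apply ZMod.val_injective m
    rw [ZMod.val_cast_of_lt hj]
    rcases lt_trichotomy i.val j with h | h | h
    · exact (hed_inj _ _ h hj hi).elim
    · exact h
    · exact (hed_inj _ _ h i.val_lt hi.symm).elim
  · obtain ⟨k, hk, hkl⟩ := SimpleGraph.Walk.mem_support_iff_exists_getVert.1 (hsupp (.inl v))
    rcases Nat.even_or_odd' k with ⟨j, rfl | rfl⟩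
    · rw [hvx] at hk
      obtain rfl := Sum.inl_injective hk
      rcases Nat.lt_or_ge j m with h | h
      · exact ⟨(j : ZMod m), congrArg vx (ZMod.val_cast_of_lt h)⟩
      · refine ⟨(0 : ZMod m), ?_⟩
        rw [show j = m by omega, hv0]
        exact congrArg vx ZMod.val_zero
    · simp [hed j (by omega)] at hk

/-- If one can choose a pair in each edge such that all degrees are even and the chosen pairs
contain a spanning star, then there is a spanning Euler tour. -/
theorem hasSpanningEulerTour_of_even_pairs [Fintype V] [Fintype ι] [DecidableEq V] [Nonempty ι]
    {E P : ι → Finset V} (hPE : ∀ i, P i ⊆ E i) (hP2 : ∀ i, #(P i) = 2)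
    (heven : ∀ v, Even #{i | v ∈ P i}) {x₀ : V} (hstar : ∀ v, v ≠ x₀ → ∃ i, P i = {x₀, v}) :
    HasSpanningEulerTour E := by
  classical
  have hreach : ∀ v, (incidenceGraph P).Reachable (.inl v) (.inl x₀) := by
    intro v
    by_cases hv : v = x₀
    · rw [hv]
    · obtain ⟨i, hi⟩ := hstar v hv
      have h1 : (incidenceGraph P).Adj (.inl v) (.inr i) := by simp [hi]
      have h2 : (incidenceGraph P).Adj (.inr i) (.inl x₀) := by simp [hi]
      exact h1.reachable.trans h2.reachable
  have hmem : ∀ i, ∃ v, v ∈ P i := fun i => card_pos.1 (by rw [hP2]; exact two_pos)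
  have hconn : (incidenceGraph P).Connected := by
    refine SimpleGraph.connected_iff_exists_forall_reachable _ |>.2 ⟨.inl x₀, ?_⟩
    rintro (v | i)
    · exact (hreach v).symm
    · obtain ⟨v, hv⟩ := hmem i
      have h1 : (incidenceGraph P).Adj (.inl v) (.inr i) := hv
      exact (hreach v).symm.trans h1.reachable
  have hdeg : ∀ x, Even ((incidenceGraph P).degree x) := by
    rintro (v | i)
    · have h : (incidenceGraph P).neighborFinset (.inl v) =
          (univ.filter fun i => v ∈ P i).map .inr := by
        ext (w | j) <;> simp
      rw [← SimpleGraph.card_neighborFinset_eq_degree, h, card_map]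
      exact heven v
    · have h : (incidenceGraph P).neighborFinset (.inr i) = (P i).map .inl := by
        ext (w | j) <;> simp
      rw [← SimpleGraph.card_neighborFinset_eq_degree, h, card_map, hP2]
      exact even_two
  obtain ⟨u, p, hp⟩ := hconn.exists_isEulerian hdeg
  have hsupp : ∀ x, x ∈ p.support := by
    have : Nontrivial (V ⊕ ι) := ⟨.inl x₀, .inr (Classical.arbitrary ι), by simp⟩
    intro x
    obtain ⟨y, hy⟩ := hconn.preconnected.exists_adj_of_nontrivial x
    exact p.fst_mem_support_of_mem_edges (hp.mem_edges_iff.2 hy)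
  have hq : (p.rotate (.inl x₀) (hsupp _)).IsEulerian := by
    refine ((SimpleGraph.Walk.isTrail_rotate _).2 hp.isTrail).isEulerian_of_forall_mem ?_
    intro e he
    rw [(p.rotate_edges _ _).mem_iff]
    exact hp.mem_edges_iff.2 he
  exact hasSpanningEulerTour_of_isEulerian hPE hP2 hq fun x =>
    (p.mem_support_rotate_iff _ _).2 (hsupp x)

end Tour

theorem choose_two_add_one_le_gfun {c k μ : ℕ} (hc : 3 ≤ c) (hk : 4 ≤ k) :
    ((k.choose 2 + 1 : ℕ) : ℚ) ≤ gfun c k μ := by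
  have hch : (k.choose 2 : ℚ) = k * (k - 1) / 2 := Nat.cast_choose_two ℚ k
  have hcq : (3 : ℚ) ≤ c := by exact_mod_cast hc
  have hkq : (4 : ℚ) ≤ k := by exact_mod_cast hk
  push_cast
  unfold gfun
  split_ifs with h1 h2 h3 h4
  · omega
  · rw [hch, h2.2]
    norm_num
  · exact le_rfl
  · have h5 : k = 2 * c - 1 ∨ k = 2 * c := by omega
    rw [hch]
    rcases h5 with h | h
    · have hkc : (k : ℚ) = 2 * c - 1 := by
        have : k + 1 = 2 * c := by omega
        have : (k : ℚ) + 1 = 2 * c := by exact_mod_cast this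
        linarith
      rw [hkc, le_div_iff₀ (by linarith)]
      nlinarith
    · have hkc : (k : ℚ) = 2 * c := by exact_mod_cast h
      rw [hkc, le_div_iff₀ (by linarith)]
      nlinarith
  · have hkc : 2 * c < k := by omega
    have hpow : (2 : ℚ) ^ c ≤ 2 ^ (k - c - 1) := pow_le_pow_right₀ one_le_two (by omega)
    have : 0 ≤ 2 * (μ : ℚ) * ((k : ℚ) - 1) * ((2 : ℚ) ^ (k - c - 1) - 2 ^ c + 1) :=
      mul_nonneg (mul_nonneg (by positivity) (by linarith)) (by linarith)
    linarith

theorem hasSpanningEulerTour_of_admissible_degr {V ι : Type*} [Fintype V] [Fintype ι]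
    [Nonempty ι] [DecidableEq V] (E : ι → Finset V) (n c k μ r : ℕ)
    (hadm : Admissible E n c k μ)
    (hr4 : 4 ≤ r) (hrk : r ≤ k)
    (hdeg : ∀ T : Finset V, T.card = r →
      1 ≤ (Finset.univ.filter (fun i => T ⊆ E i)).card) :
    HasSpanningEulerTour E := by
  classical
  obtain ⟨rfl, hc, hc3, hk, -, hg⟩ := hadm
  have h3 : ∀ i, 3 ≤ #(E i) := fun i => hc3.trans (hc ▸ inf'_le _ (mem_univ i))
  have hEk : ∀ i, #(E i) ≤ k := fun i => hk ▸ le_sup' (fun i => #(E i)) (mem_univ i)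
  have hn : k.choose 2 + 1 ≤ Fintype.card V := by
    exact_mod_cast (choose_two_add_one_le_gfun (μ := μ) hc3 (hr4.trans hrk)).trans hg
  have hcover : ∀ T : Finset V, #T = r → ∃ i, T ⊆ E i := by
    intro T hT
    obtain ⟨i, hi⟩ := card_pos.1 (hdeg T hT)
    exact ⟨i, (mem_filter.1 hi).2⟩
  obtain ⟨x₀⟩ : Nonempty V := Fintype.card_pos_iff.1 (by omega)
  obtain ⟨g, hginj, hgE⟩ := exists_injective_star_s4 (show 2 ≤ k by omega) hEk x₀ fun v hv =>
    two_mul_sub_one_le_card_filter_pair_subset hr4 hrk hEk hn hcover hv.symm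
  obtain ⟨P, hPE, hP2, heven, hstar⟩ := exists_even_pairs h3 x₀ hginj hgE
  exact hasSpanningEulerTour_of_even_pairs hPE hP2 heven hstar
end
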